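/- arXiv:1601.00944 — 7 statements merged into one kernel-verified Lean document; each statement's English description precedes it below -/
import Mathlib

section
/- Every tree with n vertices has at least n pairwise nonisomorphic subtrees; that is, ns(T) ≥ n for every tree T of order n ≥ 1. -/
open SimpleGraph

/-- The type of subtrees of a graph `G`: vertex subsets inducing a connected
(hence nonempty) subgraph. -/
def GraphSubtree {V : Type*} (G : SimpleGraph V) : Type _ :=
  {S : Set V // (G.induce S).Connected}

/-- Two subtrees are isomorphic if their induced subgraphs are isomorphic as graphs. -/
def SubtreeIso {V : Type*} (G : SimpleGraph V) (S T : GraphSubtree G) : Prop :=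
  Nonempty (G.induce S.1 ≃g G.induce T.1)

/-- `ns G`: the number of isomorphism classes of subtrees of `G`. -/
noncomputable def ns {V : Type*} (G : SimpleGraph V) : ℕ :=
  Nat.card (Quot (SubtreeIso G))

/-- Subtrees of `G` containing the root `r`. -/
def RootedSubtree {V : Type*} (G : SimpleGraph V) (r : V) : Type _ :=
  {S : Set V // r ∈ S ∧ (G.induce S).Connected}

/-- Root-preserving isomorphism of rooted subtrees. -/
def RootedSubtreeIso {V : Type*} (G : SimpleGraph V) (r : V)
    (S T : RootedSubtree G r) : Prop :=
  ∃ f : G.induce S.1 ≃g G.induce T.1, f ⟨r, S.2.1⟩ = ⟨r, T.2.1⟩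

/-- `nr G r`: the number of root-preserving isomorphism classes of subtrees
of `G` containing `r`. -/
noncomputable def nr {V : Type*} (G : SimpleGraph V) (r : V) : ℕ :=
  Nat.card (Quot (RootedSubtreeIso G r))

/-- `maxNS n` (written `S_n` in the paper): the maximum of `ns T` over all
trees `T` with `n` vertices. -/
noncomputable def maxNS (n : ℕ) : ℕ :=
  sSup {k | ∃ G : SimpleGraph (Fin n), G.IsTree ∧ ns G = k}

/-- `maxNR n` (written `R_n` in the paper): the maximum of `nr T` over all
rooted trees `T` with `n` vertices. -/
noncomputable def maxNR (n : ℕ) : ℕ :=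
  sSup {k | ∃ (G : SimpleGraph (Fin n)) (r : Fin n), G.IsTree ∧ nr G r = k}

/-- A connected vertex set that is not everything can be enlarged by one vertex. -/
theorem SimpleGraph.Connected.exists_connected_induce_insert {V : Type*} {G : SimpleGraph V}
    (hG : G.Connected) {S : Set V} (hS : (G.induce S).Connected) (hne : S ≠ Set.univ) :
    ∃ w ∉ S, (G.induce (insert w S)).Connected := by
  obtain ⟨⟨u, hu⟩⟩ := hS.nonempty
  obtain ⟨v, hv⟩ := (Set.ne_univ_iff_exists_notMem S).1 hne
  obtain ⟨p⟩ := hG.preconnected u v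
  obtain ⟨d, -, hd, hd'⟩ := p.exists_boundary_dart S hu hv
  refine ⟨d.snd, hd', ?_⟩
  have h := induce_union_connected (induce_pair_connected_of_adj d.adj).preconnected
    hS.preconnected ⟨d.fst, by simp, hd⟩
  have h_eq : insert d.snd S = {d.fst, d.snd} ∪ S := by
    ext x
    simp only [Set.mem_insert_iff, Set.mem_union, Set.mem_singleton_iff]
    grind
  rwa [h_eq]

/-- A finite connected graph has connected vertex sets of every positive size up to its order. -/
theorem SimpleGraph.Connected.exists_connected_induce_ncard_eq {V : Type*} [Fintype V]
    {G : SimpleGraph V} (hG : G.Connected) (k : ℕ) (hk : k < Fintype.card V) :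
    ∃ S : Set V, (G.induce S).Connected ∧ S.ncard = k + 1 := by
  induction k with
  | zero =>
    obtain ⟨v⟩ := hG.nonempty
    exact ⟨{v}, by simp [connected_top], Set.ncard_singleton v⟩
  | succ k ih =>
    obtain ⟨S, hS, hcard⟩ := ih (by omega)
    have hne : S ≠ Set.univ := by
      rintro rfl
      rw [Set.ncard_univ, Nat.card_eq_fintype_card] at hcard
      omega
    obtain ⟨w, hw, hconn⟩ := hG.exists_connected_induce_insert hS hne
    exact ⟨insert w S, hconn, by rw [Set.ncard_insert_of_notMem hw, hcard]⟩

/-- The order of an isomorphism class of subtrees. -/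
noncomputable def subtreeClassOrder {V : Type*} (G : SimpleGraph V) :
    Quot (SubtreeIso G) → ℕ :=
  Quot.lift (fun S => S.1.ncard) fun _ _ ⟨f⟩ => Nat.card_congr f.toEquiv

/-- Every tree of order `n ≥ 1` has at least `n` pairwise nonisomorphic subtrees. -/
theorem ns_ge_card {V : Type*} [Fintype V] (G : SimpleGraph V) (hG : G.IsTree)
    (hn : 1 ≤ Fintype.card V) :
    Fintype.card V ≤ ns G := by
  choose S hS hcard using hG.connected.exists_connected_induce_ncard_eq
  have : Finite (GraphSubtree G) := Subtype.finite
  let f : Fin (Fintype.card V) → Quot (SubtreeIso G) := fun k =>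
    Quot.mk _ ⟨S k k.isLt, hS k k.isLt⟩
  have hf : Function.Injective f := fun i j hij => by
    have h : (S i i.isLt).ncard = (S j j.isLt).ncard := congrArg (subtreeClassOrder G) hij
    rw [hcard, hcard] at h
    exact Fin.ext (Nat.succ_injective h)
  simpa [ns] using Nat.card_le_card_of_injective f hf
end

section
/- Let T be a rooted tree that is the union of two rooted subtrees R₁ and R₂, each with at least 2 vertices, which share only the root of T. Then nr(T) ≤ nr(R₁)·nr(R₂) − 1. -/
open SimpleGraph

theorem rootedSubtreeIso_equivalence {V : Type*} (G : SimpleGraph V) (r : V) :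
    Equivalence (RootedSubtreeIso G r) where
  refl _ := ⟨Iso.refl, rfl⟩
  symm := by
    rintro S T ⟨f, hf⟩
    exact ⟨f.symm, by rw [← hf]; exact f.symm_apply_apply _⟩
  trans := by
    rintro S T U ⟨f, hf⟩ ⟨g, hg⟩
    exact ⟨f.trans g, by rw [← hg, ← hf]; rfl⟩

theorem RootedSubtreeIso.of_mk_eq {V : Type*} {G : SimpleGraph V} {r : V}
    {S T : RootedSubtree G r}
    (h : Quot.mk (RootedSubtreeIso G r) S = Quot.mk (RootedSubtreeIso G r) T) :
    RootedSubtreeIso G r S T :=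
  (rootedSubtreeIso_equivalence G r).eqvGen_iff.mp (Quot.eqvGen_exact h)

theorem RootedSubtreeIso.ncard_eq {V : Type*} {G : SimpleGraph V} {r : V}
    {S T : RootedSubtree G r} (h : RootedSubtreeIso G r S T) : S.1.ncard = T.1.ncard := by
  obtain ⟨f, -⟩ := h
  exact Nat.card_congr f.toEquiv

/-- Contracting everything outside `A` to the root shows that the trace on `A` of a connected
set containing the root is connected. -/
theorem connected_induce_preimage {V : Type*} {G : SimpleGraph V} {r : V} {A B : Set V}
    (hrA : r ∈ A) (hI : A ∩ B = {r})
    (hedge : ∀ x y, G.Adj x y → (x ∈ A ∧ y ∈ A) ∨ (x ∈ B ∧ y ∈ B))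
    {S : Set V} (hrS : r ∈ S) (hS : (G.induce S).Connected) :
    ((G.induce A).induce (Subtype.val ⁻¹' S : Set A)).Connected := by
  classical
  let f : S → (Subtype.val ⁻¹' S : Set A) := fun x =>
    if h : x.1 ∈ A then ⟨⟨x.1, h⟩, x.2⟩ else ⟨⟨r, hrA⟩, hrS⟩
  have hfB : ∀ x : S, x.1 ∈ B → f x = ⟨⟨r, hrA⟩, hrS⟩ := by
    intro x hx
    by_cases h : x.1 ∈ A
    · have hxr : x.1 = r := by
        have : x.1 ∈ A ∩ B := ⟨h, hx⟩
        rwa [hI] at this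
      simp [f, hxr]
    · simp [f, h]
  have hstep : ∀ x y : S, (G.induce S).Adj x y →
      ((G.induce A).induce (Subtype.val ⁻¹' S : Set A)).Reachable (f x) (f y) := by
    intro x y hxy
    rcases hedge _ _ hxy with ⟨hx, hy⟩ | ⟨hx, hy⟩
    · refine Adj.reachable ?_
      have hfx : f x = ⟨⟨x.1, hx⟩, x.2⟩ := dif_pos hx
      have hfy : f y = ⟨⟨y.1, hy⟩, y.2⟩ := dif_pos hy
      rw [hfx, hfy]
      exact hxy
    · rw [hfB x hx, hfB y hy]
  have hreach : ∀ x y : S,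
      ((G.induce A).induce (Subtype.val ⁻¹' S : Set A)).Reachable (f x) (f y) := by
    intro x y
    obtain ⟨w⟩ := hS.preconnected x y
    induction w with
    | nil => exact Reachable.refl _
    | cons h _ ih => exact (hstep _ _ h).trans ih
  have : Nonempty (Subtype.val ⁻¹' S : Set A) := ⟨⟨⟨r, hrA⟩, hrS⟩⟩
  refine ⟨fun x y => ?_⟩
  have key := hreach ⟨x.1.1, x.2⟩ ⟨y.1.1, y.2⟩
  simpa [f] using key

/-- The trace of a rooted subtree on one of the two parts. -/
def RootedSubtree.trace {V : Type*} {G : SimpleGraph V} {r : V} {A B : Set V}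
    (hrA : r ∈ A) (hI : A ∩ B = {r})
    (hedge : ∀ x y, G.Adj x y → (x ∈ A ∧ y ∈ A) ∨ (x ∈ B ∧ y ∈ B))
    (S : RootedSubtree G r) : RootedSubtree (G.induce A) ⟨r, hrA⟩ :=
  ⟨Subtype.val ⁻¹' S.1, S.2.1, connected_induce_preimage hrA hI hedge S.2.1 S.2.2⟩

/-- Root-preserving homomorphisms on the two parts of `S` glue to a homomorphism on `S`. -/
theorem exists_hom_glue {V : Type*} {G : SimpleGraph V} {r : V} {A B : Set V}
    (hrA : r ∈ A) (hrB : r ∈ B) (hU : A ∪ B = Set.univ) (hI : A ∩ B = {r})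
    (hedge : ∀ x y, G.Adj x y → (x ∈ A ∧ y ∈ A) ∨ (x ∈ B ∧ y ∈ B))
    {S T : Set V} (hrS : r ∈ S) (hrT : r ∈ T)
    (f : (G.induce A).induce (Subtype.val ⁻¹' S : Set A) →g
      (G.induce A).induce (Subtype.val ⁻¹' T : Set A))
    (g : (G.induce B).induce (Subtype.val ⁻¹' S : Set B) →g
      (G.induce B).induce (Subtype.val ⁻¹' T : Set B))
    (hf : f ⟨⟨r, hrA⟩, hrS⟩ = ⟨⟨r, hrA⟩, hrT⟩)
    (hg : g ⟨⟨r, hrB⟩, hrS⟩ = ⟨⟨r, hrB⟩, hrT⟩) :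
    ∃ h : G.induce S →g G.induce T,
      (∀ x : (Subtype.val ⁻¹' S : Set A), h ⟨x.1.1, x.2⟩ = ⟨(f x).1.1, (f x).2⟩) ∧
      (∀ x : (Subtype.val ⁻¹' S : Set B), h ⟨x.1.1, x.2⟩ = ⟨(g x).1.1, (g x).2⟩) := by
  classical
  have hB : ∀ x : V, x ∉ A → x ∈ B := fun x hx =>
    ((hU ▸ Set.mem_univ x : x ∈ A ∪ B)).resolve_left hx
  let h : S → T := fun x =>
    if hx : x.1 ∈ A then ⟨(f ⟨⟨x.1, hx⟩, x.2⟩).1.1, (f ⟨⟨x.1, hx⟩, x.2⟩).2⟩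
    else ⟨(g ⟨⟨x.1, hB _ hx⟩, x.2⟩).1.1, (g ⟨⟨x.1, hB _ hx⟩, x.2⟩).2⟩
  have hhA : ∀ x : (Subtype.val ⁻¹' S : Set A), h ⟨x.1.1, x.2⟩ = ⟨(f x).1.1, (f x).2⟩ := by
    rintro ⟨⟨x, hx⟩, hxS⟩
    simp [h, hx]
  have hhB : ∀ x : (Subtype.val ⁻¹' S : Set B), h ⟨x.1.1, x.2⟩ = ⟨(g x).1.1, (g x).2⟩ := by
    rintro ⟨⟨x, hx⟩, hxS⟩
    by_cases hxA : x ∈ A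
    · obtain rfl : x = r := by
        have : x ∈ A ∩ B := ⟨hxA, hx⟩
        rwa [hI] at this
      refine (hhA ⟨⟨x, hxA⟩, hxS⟩).trans (Subtype.ext ?_)
      exact (congrArg (fun z => z.1.1) hf).trans (congrArg (fun z => z.1.1) hg).symm
    · simp [h, hxA]
  refine ⟨⟨h, ?_⟩, hhA, hhB⟩
  rintro ⟨x, hxS⟩ ⟨y, hyS⟩ hxy
  rcases hedge _ _ hxy with ⟨hx, hy⟩ | ⟨hx, hy⟩
  · rw [hhA ⟨⟨x, hx⟩, hxS⟩, hhA ⟨⟨y, hy⟩, hyS⟩]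
    exact f.map_adj (v := ⟨⟨x, hx⟩, hxS⟩) (w := ⟨⟨y, hy⟩, hyS⟩) hxy
  · rw [hhB ⟨⟨x, hx⟩, hxS⟩, hhB ⟨⟨y, hy⟩, hyS⟩]
    exact g.map_adj (v := ⟨⟨x, hx⟩, hxS⟩) (w := ⟨⟨y, hy⟩, hyS⟩) hxy

theorem RootedSubtreeIso.of_trace {V : Type*} {G : SimpleGraph V} {r : V} {A B : Set V}
    (hrA : r ∈ A) (hrB : r ∈ B) (hU : A ∪ B = Set.univ) (hI : A ∩ B = {r})
    (hI' : B ∩ A = {r})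
    (hedge : ∀ x y, G.Adj x y → (x ∈ A ∧ y ∈ A) ∨ (x ∈ B ∧ y ∈ B))
    (hedge' : ∀ x y, G.Adj x y → (x ∈ B ∧ y ∈ B) ∨ (x ∈ A ∧ y ∈ A))
    {S T : RootedSubtree G r}
    (hA : RootedSubtreeIso (G.induce A) ⟨r, hrA⟩ (S.trace hrA hI hedge) (T.trace hrA hI hedge))
    (hB : RootedSubtreeIso (G.induce B) ⟨r, hrB⟩ (S.trace hrB hI' hedge')
      (T.trace hrB hI' hedge')) :
    RootedSubtreeIso G r S T := by
  obtain ⟨f, hf⟩ := hA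
  obtain ⟨g, hg⟩ := hB
  have hf' : f.symm ⟨⟨r, hrA⟩, T.2.1⟩ = ⟨⟨r, hrA⟩, S.2.1⟩ :=
    (f.toEquiv.symm_apply_eq).2 hf.symm
  have hg' : g.symm ⟨⟨r, hrB⟩, T.2.1⟩ = ⟨⟨r, hrB⟩, S.2.1⟩ :=
    (g.toEquiv.symm_apply_eq).2 hg.symm
  obtain ⟨h, h₁, h₂⟩ := exists_hom_glue hrA hrB hU hI hedge S.2.1 T.2.1
    f.toHom g.toHom hf hg
  obtain ⟨k, k₁, k₂⟩ := exists_hom_glue hrA hrB hU hI hedge T.2.1 S.2.1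
    f.symm.toHom g.symm.toHom hf' hg'
  have hkh : ∀ x, k (h x) = x := by
    rintro ⟨x, hxS⟩
    rcases (hU ▸ Set.mem_univ x : x ∈ A ∪ B) with hx | hx
    · refine (congrArg k (h₁ ⟨⟨x, hx⟩, hxS⟩)).trans ((k₁ _).trans ?_)
      exact congrArg (fun z => (⟨z.1.1, z.2⟩ : S.1)) (f.symm_apply_apply ⟨⟨x, hx⟩, hxS⟩)
    · refine (congrArg k (h₂ ⟨⟨x, hx⟩, hxS⟩)).trans ((k₂ _).trans ?_)
      exact congrArg (fun z => (⟨z.1.1, z.2⟩ : S.1)) (g.symm_apply_apply ⟨⟨x, hx⟩, hxS⟩)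
  have hhk : ∀ x, h (k x) = x := by
    rintro ⟨x, hxS⟩
    rcases (hU ▸ Set.mem_univ x : x ∈ A ∪ B) with hx | hx
    · refine (congrArg h (k₁ ⟨⟨x, hx⟩, hxS⟩)).trans ((h₁ _).trans ?_)
      exact congrArg (fun z => (⟨z.1.1, z.2⟩ : T.1)) (f.apply_symm_apply ⟨⟨x, hx⟩, hxS⟩)
    · refine (congrArg h (k₂ ⟨⟨x, hx⟩, hxS⟩)).trans ((h₂ _).trans ?_)
      exact congrArg (fun z => (⟨z.1.1, z.2⟩ : T.1)) (g.apply_symm_apply ⟨⟨x, hx⟩, hxS⟩)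
  refine ⟨⟨⟨h, k, hkh, hhk⟩, ?_⟩, ?_⟩
  · intro x y
    refine ⟨fun hxy => ?_, fun hxy => h.map_adj hxy⟩
    have := k.map_adj hxy
    simpa [hkh] using this
  · refine (h₁ ⟨⟨r, hrA⟩, S.2.1⟩).trans ?_
    exact congrArg (fun z => (⟨z.1.1, z.2⟩ : T.1)) hf

theorem SimpleGraph.Connected.adj_iff_ne_of_card_eq_two {V : Type*} {G : SimpleGraph V}
    (hG : G.Connected) (hc : Nat.card V = 2) (x y : V) : G.Adj x y ↔ x ≠ y := by
  refine ⟨Adj.ne, fun hxy => ?_⟩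
  have : Finite V := Nat.finite_of_card_ne_zero (by omega)
  have : Nontrivial V := ⟨x, y, hxy⟩
  obtain ⟨z, hz⟩ := hG.preconnected.exists_adj_of_nontrivial x
  obtain ⟨w, -, hw⟩ := (Nat.card_eq_two_iff' x).1 hc
  rwa [hw y hxy.symm, ← hw z hz.ne']

theorem RootedSubtreeIso.of_ncard_eq_two {V : Type*} {G : SimpleGraph V} {r : V}
    {S T : RootedSubtree G r} (hS : S.1.ncard = 2) (hT : T.1.ncard = 2) :
    RootedSubtreeIso G r S T := by
  classical
  have hS' : Nat.card S.1 = 2 := hS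
  have hT' : Nat.card T.1 = 2 := hT
  have : Finite S.1 := Nat.finite_of_card_ne_zero (by omega)
  have : Finite T.1 := Nat.finite_of_card_ne_zero (by omega)
  let e : S.1 ≃ T.1 := (Finite.card_eq.1 (hS'.trans hT'.symm)).some
  let e' := e.trans (Equiv.swap (e ⟨r, S.2.1⟩) ⟨r, T.2.1⟩)
  refine ⟨⟨e', ?_⟩, Equiv.swap_apply_left _ _⟩
  intro x y
  rw [S.2.2.adj_iff_ne_of_card_eq_two hS', T.2.2.adj_iff_ne_of_card_eq_two hT']
  exact e'.injective.ne_iff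

theorem RootedSubtree.exists_ncard_eq_one {V : Type*} (G : SimpleGraph V) (r : V) :
    ∃ S : RootedSubtree G r, S.1.ncard = 1 :=
  ⟨⟨{r}, rfl, by
    rw [induce_singleton_eq_top]
    exact connected_top⟩, Set.ncard_singleton r⟩

theorem RootedSubtree.exists_ncard_eq_two {V : Type*} [Nontrivial V] {G : SimpleGraph V}
    (hG : G.Connected) (r : V) : ∃ S : RootedSubtree G r, S.1.ncard = 2 := by
  obtain ⟨a, ha⟩ := hG.preconnected.exists_adj_of_nontrivial r
  exact ⟨⟨{r, a}, by simp, induce_pair_connected_of_adj ha⟩, Set.ncard_pair ha.ne⟩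

theorem ncard_trace_add_ncard_trace {V : Type*} [Finite V] {r : V} {A B : Set V}
    (hU : A ∪ B = Set.univ) (hI : A ∩ B = {r}) {S : Set V} (hrS : r ∈ S) :
    (Subtype.val ⁻¹' S : Set A).ncard + (Subtype.val ⁻¹' S : Set B).ncard = S.ncard + 1 := by
  have key : ∀ C : Set V, (Subtype.val ⁻¹' S : Set C).ncard = (C ∩ S).ncard := fun C => by
    rw [← Set.ncard_image_of_injective _ Subtype.val_injective, Subtype.image_preimage_coe]
  rw [key, key, ← Set.ncard_union_add_ncard_inter, ← Set.union_inter_distrib_right,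
    ← Set.inter_inter_distrib_right, hU, hI, Set.univ_inter,
    Set.inter_eq_left.2 (Set.singleton_subset_iff.2 hrS), Set.ncard_singleton]

/-- If a rooted tree `T` is the union of two rooted subtrees `R₁` (on vertex set `A`)
and `R₂` (on vertex set `B`), each of order at least `2`, sharing only the root `r`,
then `nr T ≤ nr R₁ * nr R₂ - 1`. -/
theorem nr_le_of_union {V : Type*} [Fintype V] (G : SimpleGraph V) (hG : G.IsTree)
    (r : V) (A B : Set V) (hrA : r ∈ A) (hrB : r ∈ B)
    (hU : A ∪ B = Set.univ) (hI : A ∩ B = {r})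
    (hconnA : (G.induce A).Connected) (hconnB : (G.induce B).Connected)
    (hedge : ∀ x y, G.Adj x y → (x ∈ A ∧ y ∈ A) ∨ (x ∈ B ∧ y ∈ B))
    (hA2 : 2 ≤ A.ncard) (hB2 : 2 ≤ B.ncard) :
    nr G r ≤ nr (G.induce A) ⟨r, hrA⟩ * nr (G.induce B) ⟨r, hrB⟩ - 1 := by
  have hI' : B ∩ A = {r} := by rw [Set.inter_comm, hI]
  have hedge' : ∀ x y, G.Adj x y → (x ∈ B ∧ y ∈ B) ∨ (x ∈ A ∧ y ∈ A) :=
    fun x y h => (hedge x y h).symm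
  let trA := RootedSubtree.trace (G := G) hrA hI hedge
  let trB := RootedSubtree.trace (G := G) hrB hI' hedge'
  let φ : Quot (RootedSubtreeIso G r) →
      Quot (RootedSubtreeIso (G.induce A) ⟨r, hrA⟩) ×
        Quot (RootedSubtreeIso (G.induce B) ⟨r, hrB⟩) :=
    fun q => (Quot.mk _ (trA q.out), Quot.mk _ (trB q.out))
  have hinj : Function.Injective φ := by
    intro p q hpq
    obtain ⟨h₁, h₂⟩ := Prod.mk.inj hpq
    rw [← p.out_eq, ← q.out_eq]
    exact Quot.sound (.of_trace hrA hrB hU hI hI' hedge hedge' (.of_mk_eq h₁) (.of_mk_eq h₂))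
  have hsurj : ¬ Function.Surjective φ := by
    intro hφ
    have : Nontrivial A :=
      (Set.one_lt_ncard_iff_nontrivial.1 (by omega : 1 < A.ncard)).coe_sort
    have : Nontrivial B :=
      (Set.one_lt_ncard_iff_nontrivial.1 (by omega : 1 < B.ncard)).coe_sort
    obtain ⟨a₁, ha₁⟩ := RootedSubtree.exists_ncard_eq_one (G.induce A) ⟨r, hrA⟩
    obtain ⟨b₁, hb₁⟩ := RootedSubtree.exists_ncard_eq_one (G.induce B) ⟨r, hrB⟩
    obtain ⟨a₂, ha₂⟩ := RootedSubtree.exists_ncard_eq_two hconnA ⟨r, hrA⟩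
    obtain ⟨b₂, hb₂⟩ := RootedSubtree.exists_ncard_eq_two hconnB ⟨r, hrB⟩
    obtain ⟨p, hp⟩ := hφ (Quot.mk _ a₂, Quot.mk _ b₁)
    obtain ⟨q, hq⟩ := hφ (Quot.mk _ a₁, Quot.mk _ b₂)
    obtain ⟨hpA, hpB⟩ := Prod.mk.inj hp
    obtain ⟨hqA, hqB⟩ := Prod.mk.inj hq
    have hpA := (RootedSubtreeIso.of_mk_eq hpA).ncard_eq
    have hpB := (RootedSubtreeIso.of_mk_eq hpB).ncard_eq
    have hqA := (RootedSubtreeIso.of_mk_eq hqA).ncard_eq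
    have hqB := (RootedSubtreeIso.of_mk_eq hqB).ncard_eq
    have hps : (trA p.out).1.ncard + (trB p.out).1.ncard = p.out.1.ncard + 1 :=
      ncard_trace_add_ncard_trace hU hI p.out.2.1
    have hqs : (trA q.out).1.ncard + (trB q.out).1.ncard = q.out.1.ncard + 1 :=
      ncard_trace_add_ncard_trace hU hI q.out.2.1
    have hpq : p = q := by
      rw [← p.out_eq, ← q.out_eq]
      exact Quot.sound (.of_ncard_eq_two (by omega) (by omega))
    subst hpq
    omega
  have hfin : ∀ {W : Type _} [Finite W] (H : SimpleGraph W) (s : W),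
      Finite (Quot (RootedSubtreeIso H s)) := by
    intro W _ H s
    have : Finite (RootedSubtree H s) := Subtype.finite
    infer_instance
  have := hfin (G.induce A) ⟨r, hrA⟩
  have := hfin (G.induce B) ⟨r, hrB⟩
  have hlt : nr G r < nr (G.induce A) ⟨r, hrA⟩ * nr (G.induce B) ⟨r, hrB⟩ := by
    have := Finite.of_injective φ hinj
    have := Fintype.ofFinite (Quot (RootedSubtreeIso G r))
    have := Fintype.ofFinite (Quot (RootedSubtreeIso (G.induce A) ⟨r, hrA⟩) ×
      Quot (RootedSubtreeIso (G.induce B) ⟨r, hrB⟩))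
    have h := Fintype.card_lt_of_injective_not_surjective φ hinj hsurj
    rwa [← Nat.card_eq_fintype_card, ← Nat.card_eq_fintype_card, Nat.card_prod] at h
  exact Nat.le_sub_one_of_lt hlt
end

section
/- Let T be a rooted tree with root r, and let T₁, T₂, …, T_d be the root branches of T (the connected components of T with r removed), each rooted at its vertex adjacent to r. Then nr(T) ≤ ∏_{j=1}^{d} (nr(T_j) + 1). -/
open SimpleGraph

/-- In an acyclic graph, a vertex outside a connected set has at most one neighbour in it. -/
theorem SimpleGraph.IsAcyclic.eq_of_adj_of_connected {V : Type*} {G : SimpleGraph V}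
    (hG : G.IsAcyclic) {B : Set V} (hB : (G.induce B).Connected) {r x y : V} (hr : r ∉ B)
    (hx : x ∈ B) (hy : y ∈ B) (hrx : G.Adj r x) (hry : G.Adj r y) : x = y := by
  by_contra hne
  have hbr := isAcyclic_iff_forall_adj_isBridge.1 hG hrx
  rw [isBridge_iff] at hbr
  have hedge : (G.deleteEdges {s(r, x)}).Adj r y := by
    rw [deleteEdges_adj]
    refine ⟨hry, fun h => ?_⟩
    rcases Sym2.eq_iff.1 (Set.mem_singleton_iff.1 h) with ⟨-, h⟩ | ⟨h, -⟩
    · exact hne h.symm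
    · exact hr (h ▸ hx)
  let φ : G.induce B →g G.deleteEdges {s(r, x)} :=
    { toFun := Subtype.val
      map_rel' := by
        intro a b hab
        rw [deleteEdges_adj]
        refine ⟨hab, fun h => ?_⟩
        rcases Sym2.eq_iff.1 (Set.mem_singleton_iff.1 h) with ⟨h, -⟩ | ⟨-, h⟩
        · exact hr (h ▸ a.2)
        · exact hr (h ▸ b.2) }
  exact hbr (hedge.reachable.trans ((hB.preconnected ⟨y, hy⟩ ⟨x, hx⟩).map φ))

section Branches

variable {V : Type*} {G : SimpleGraph V} {r : V}

/-- If every edge leaving `B` from inside is the edge from `ρ` to `r`, then within a subgraph any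
vertex of `B` that is connected to `r` is connected to `ρ` inside `B`. -/
theorem exists_reachable_of_walk_to_root {B S : Set V} {ρ : V} (hρ : ρ ∈ B) (hr : r ∉ B)
    (hroot : ∀ x ∈ B, G.Adj r x → x = ρ)
    (hout : ∀ x ∈ B, ∀ y, G.Adj x y → y = r ∨ y ∈ B)
    {u v : S} (w : (G.induce S).Walk u v) (hv : v.1 = r) (hu : u.1 ∈ B) :
    ∃ h : ρ ∈ S, ((G.induce B).induce {x : B | x.1 ∈ S}).Reachable
      ⟨⟨u.1, hu⟩, u.2⟩ ⟨⟨ρ, hρ⟩, h⟩ := by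
  induction w with
  | nil => exact absurd (hv ▸ hu) hr
  | @cons a b c hab _ ih =>
    have hab' : G.Adj a.1 b.1 := hab
    rcases hout _ hu _ hab' with hb | hb
    · have ha : a.1 = ρ := hroot _ hu (hb ▸ hab'.symm)
      subst ha
      exact ⟨a.2, Reachable.refl _⟩
    · obtain ⟨h, hreach⟩ := ih hv hb
      refine ⟨h, Reachable.trans (Adj.reachable ?_) hreach⟩
      exact hab'

/-- A root-preserving isomorphism of restrictions to `B`, described on the ambient vertex type. -/
theorem exists_bijOn_of_rootedSubtreeIso {B : Set V} {ρ : B} {S T : Set V}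
    {hS : ρ ∈ {x : B | x.1 ∈ S} ∧ ((G.induce B).induce {x : B | x.1 ∈ S}).Connected}
    {hT : ρ ∈ {x : B | x.1 ∈ T} ∧ ((G.induce B).induce {x : B | x.1 ∈ T}).Connected}
    (h : RootedSubtreeIso (G.induce B) ρ ⟨_, hS⟩ ⟨_, hT⟩) :
    ∃ a : V → V, Set.BijOn a (S ∩ B) (T ∩ B) ∧
      (∀ x ∈ S ∩ B, ∀ y ∈ S ∩ B, G.Adj (a x) (a y) ↔ G.Adj x y) ∧
      a ρ = ρ := by
  classical
  obtain ⟨f, hf⟩ := h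
  let a : V → V := fun x => if h : x ∈ S ∩ B then (f ⟨⟨x, h.2⟩, h.1⟩).1.1 else x
  have ha : ∀ x (h : x ∈ S ∩ B), a x = (f ⟨⟨x, h.2⟩, h.1⟩).1.1 := fun x h => dif_pos h
  refine ⟨a, ⟨?_, ?_, ?_⟩, ?_, ?_⟩
  · intro x hx
    rw [ha x hx]
    exact ⟨(f ⟨⟨x, hx.2⟩, hx.1⟩).2, (f ⟨⟨x, hx.2⟩, hx.1⟩).1.2⟩
  · intro x hx y hy hxy
    rw [ha x hx, ha y hy] at hxy
    have := f.injective (Subtype.ext (Subtype.ext hxy))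
    exact congrArg (fun z => z.1.1) this
  · intro y hy
    refine ⟨(f.symm ⟨⟨y, hy.2⟩, hy.1⟩).1.1,
      ⟨(f.symm ⟨⟨y, hy.2⟩, hy.1⟩).2, (f.symm ⟨⟨y, hy.2⟩, hy.1⟩).1.2⟩, ?_⟩
    rw [ha _ ⟨(f.symm ⟨⟨y, hy.2⟩, hy.1⟩).2, (f.symm ⟨⟨y, hy.2⟩, hy.1⟩).1.2⟩]
    exact congrArg (fun z => z.1.1) (f.apply_symm_apply ⟨⟨y, hy.2⟩, hy.1⟩)
  · intro x hx y hy
    rw [ha x hx, ha y hy]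
    exact f.map_adj_iff (v := ⟨⟨x, hx.2⟩, hx.1⟩) (w := ⟨⟨y, hy.2⟩, hy.1⟩)
  · rw [ha _ ⟨hS.1, ρ.2⟩]
    exact congrArg (fun z => z.1.1) hf

/-- Isomorphisms between the restrictions of two rooted subtrees to all the branches glue to a
root-preserving isomorphism. -/
theorem rootedSubtreeIso_of_branches {ι : Type*} {B : ι → Set V} {ρ : ι → V}
    (hdisj : Pairwise fun i j => Disjoint (B i) (B j))
    (hcover : (⋃ i, B i) = {v | v ≠ r})
    (hcross : ∀ i j, i ≠ j → ∀ x ∈ B i, ∀ y ∈ B j, ¬ G.Adj x y)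
    (hadj : ∀ i, ∀ x ∈ B i, G.Adj r x ↔ x = ρ i) (S T : RootedSubtree G r)
    (hmem : ∀ i, (S.1 ∩ B i).Nonempty → ρ i ∈ S.1 ∩ B i)
    (h : ∀ i, ∃ a : V → V, Set.BijOn a (S.1 ∩ B i) (T.1 ∩ B i) ∧
      (∀ x ∈ S.1 ∩ B i, ∀ y ∈ S.1 ∩ B i, G.Adj (a x) (a y) ↔ G.Adj x y) ∧
      (ρ i ∈ S.1 → a (ρ i) = ρ i)) :
    RootedSubtreeIso G r S T := by
  classical
  choose a hbij hiso hroot using h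
  have hidx : ∀ x, x ≠ r → ∃ i, x ∈ B i := fun x hx => by
    have : x ∈ ⋃ i, B i := by rw [hcover]; exact hx
    exact Set.mem_iUnion.1 this
  have hne : ∀ i, ∀ x ∈ B i, x ≠ r := fun i x hx => by
    have : x ∈ ⋃ i, B i := Set.mem_iUnion.2 ⟨i, hx⟩
    rw [hcover] at this
    exact this
  have huniq : ∀ i j x, x ∈ B i → x ∈ B j → i = j := fun i j x hi hj => by
    by_contra hij
    exact Set.disjoint_left.1 (hdisj hij) hi hj
  choose idx hidx using hidx
  let F : V → V := fun x => if h : x = r then r else a (idx x h) x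
  have hFr : F r = r := dif_pos rfl
  have hFB : ∀ i, ∀ x ∈ B i, F x = a i x := fun i x hx => by
    have h : F x = a (idx x (hne i x hx)) x := dif_neg (hne i x hx)
    rw [h, huniq _ _ _ (hidx x (hne i x hx)) hx]
  have hFmem : ∀ i, ∀ x ∈ S.1, x ∈ B i → F x ∈ T.1 ∩ B i := fun i x hx hi => by
    rw [hFB i x hi]
    exact (hbij i).mapsTo ⟨hx, hi⟩
  have hF : Set.BijOn F S.1 T.1 := by
    refine ⟨?_, ?_, ?_⟩
    · intro x hx
      by_cases h : x = r
      · rw [h, hFr]; exact T.2.1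
      · exact (hFmem _ x hx (hidx x h)).1
    · intro x hx y hy hxy
      by_cases h : x = r <;> by_cases h' : y = r
      · rw [h, h']
      · rw [h, hFr] at hxy
        exact absurd hxy.symm (hne _ _ (hFmem _ y hy (hidx y h')).2)
      · rw [h', hFr] at hxy
        exact absurd hxy (hne _ _ (hFmem _ x hx (hidx x h)).2)
      · have hx' := hidx x h
        have hy' := hidx y h'
        have hij := huniq _ _ _ (hFmem _ x hx hx').2 (hxy ▸ (hFmem _ y hy hy').2)
        rw [← hij] at hy'
        rw [hFB _ x hx', hFB _ y hy'] at hxy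
        exact (hbij _).injOn ⟨hx, hx'⟩ ⟨hy, hy'⟩ hxy
    · intro y hy
      by_cases h : y = r
      · exact ⟨r, S.2.1, by rw [h, hFr]⟩
      · obtain ⟨x, hx, hxy⟩ := (hbij _).surjOn ⟨hy, hidx y h⟩
        exact ⟨x, hx.1, by rw [hFB _ x hx.2, hxy]⟩
  have hadjr : ∀ x ∈ S.1, x ≠ r → (G.Adj r (F x) ↔ G.Adj r x) := fun x hx h => by
    have hi := hidx x h
    have hρ := hmem _ ⟨x, hx, hi⟩
    rw [hadj _ _ (hFmem _ x hx hi).2, hadj _ _ hi, hFB _ x hi]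
    refine ⟨fun h => ?_, fun h => ?_⟩
    · exact (hbij _).injOn ⟨hx, hi⟩ hρ (h.trans (hroot _ hρ.1).symm)
    · exact (congrArg _ h).trans (hroot _ hρ.1)
  have hFadj : ∀ x ∈ S.1, ∀ y ∈ S.1, G.Adj (F x) (F y) ↔ G.Adj x y := by
    intro x hx y hy
    by_cases h : x = r <;> by_cases h' : y = r
    · simp [h, h']
    · rw [h, hFr]; exact hadjr y hy h'
    · rw [h', hFr, G.adj_comm, G.adj_comm x]; exact hadjr x hx h
    · have hx' := hidx x h
      have hy' := hidx y h'
      by_cases hij : idx x h = idx y h'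
      · rw [← hij] at hy'
        rw [hFB _ x hx', hFB _ y hy']
        exact hiso _ x ⟨hx, hx'⟩ y ⟨hy, hy'⟩
      · exact iff_of_false (hcross _ _ hij _ (hFmem _ x hx hx').2 _ (hFmem _ y hy hy').2)
          (hcross _ _ hij _ hx' _ hy')
  exact ⟨⟨hF.equiv F, fun {x y} => hFadj x x.2 y y.2⟩, Subtype.ext hFr⟩

end Branches

/-- If `B 0, …, B (d-1)` are the root branches of a rooted tree `(G, r)`
(the connected components of `G` with `r` removed), each rooted at its vertex
`ρ i` adjacent to `r`, then `nr G r ≤ ∏ i, (nr (B i) + 1)`. -/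
theorem nr_le_prod_branches {V : Type*} [Fintype V] (G : SimpleGraph V)
    (hG : G.IsTree) (r : V) (d : ℕ) (B : Fin d → Set V)
    (hdisj : Pairwise fun i j => Disjoint (B i) (B j))
    (hcover : (⋃ i, B i) = {v | v ≠ r})
    (hconn : ∀ i, (G.induce (B i)).Connected)
    (hcross : ∀ i j, i ≠ j → ∀ x ∈ B i, ∀ y ∈ B j, ¬ G.Adj x y)
    (ρ : Fin d → V) (hρ : ∀ i, ρ i ∈ B i) (hadj : ∀ i, G.Adj r (ρ i)) :
    nr G r ≤ ∏ i, (nr (G.induce (B i)) ⟨ρ i, hρ i⟩ + 1) := by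
  classical
  have hr : ∀ i, r ∉ B i := fun i hi => by
    have : r ∈ ⋃ i, B i := Set.mem_iUnion.2 ⟨i, hi⟩
    rw [hcover] at this
    exact this rfl
  have hroot : ∀ i, ∀ x ∈ B i, G.Adj r x → x = ρ i := fun i x hx h =>
    hG.isAcyclic.eq_of_adj_of_connected (hconn i) (hr i) hx (hρ i) h (hadj i)
  have hout : ∀ i, ∀ x ∈ B i, ∀ y, G.Adj x y → y = r ∨ y ∈ B i := fun i x hx y hxy => by
    refine or_iff_not_imp_left.2 fun hy => ?_
    have : y ∈ ⋃ i, B i := by rw [hcover]; exact hy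
    obtain ⟨j, hj⟩ := Set.mem_iUnion.1 this
    by_cases hij : i = j
    · exact hij ▸ hj
    · exact absurd hxy (hcross i j hij x hx y hj)
  have hreach (S : RootedSubtree G r) (i : Fin d) (x : V) (hx : x ∈ S.1) (hi : x ∈ B i) :
      ∃ h : ρ i ∈ S.1, ((G.induce (B i)).induce {x : B i | x.1 ∈ S.1}).Reachable
        ⟨⟨x, hi⟩, hx⟩ ⟨⟨ρ i, hρ i⟩, h⟩ := by
    obtain ⟨w⟩ := S.2.2.preconnected ⟨x, hx⟩ ⟨r, S.2.1⟩
    exact exists_reachable_of_walk_to_root (hρ i) (hr i) (hroot i) (hout i) w rfl hi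
  have hbranch (S : RootedSubtree G r) (i : Fin d) (h : ρ i ∈ S.1) :
      (⟨ρ i, hρ i⟩ : B i) ∈ {x : B i | x.1 ∈ S.1} ∧
        ((G.induce (B i)).induce {x : B i | x.1 ∈ S.1}).Connected := by
    refine ⟨h, (connected_iff_exists_forall_reachable _).2 ⟨⟨⟨ρ i, hρ i⟩, h⟩, fun x => ?_⟩⟩
    exact (hreach S i x.1.1 x.2 x.1.2).2.symm
  let Φ : RootedSubtree G r → ∀ i, Option (Quot (RootedSubtreeIso (G.induce (B i)) ⟨ρ i, hρ i⟩)) :=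
    fun S i => if h : ρ i ∈ S.1 then some (Quot.mk _ ⟨_, hbranch S i h⟩) else none
  have hΦ (S T : RootedSubtree G r) (hST : Φ S = Φ T) : RootedSubtreeIso G r S T := by
    refine rootedSubtreeIso_of_branches hdisj hcover hcross
      (fun i x hx => ⟨hroot i x hx, fun h => h ▸ hadj i⟩) S T
      (fun i ⟨x, hx, hi⟩ => ⟨(hreach S i x hx hi).1, hρ i⟩) fun i => ?_
    have hi : Φ S i = Φ T i := congrFun hST i
    by_cases hS : ρ i ∈ S.1 <;> by_cases hT : ρ i ∈ T.1
    · simp only [Φ, dif_pos hS, dif_pos hT, Option.some.injEq] at hi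
      have h := (rootedSubtreeIso_equivalence _ _).eqvGen_iff.1 (Quot.eqvGen_exact hi)
      obtain ⟨a, h₁, h₂, h₃⟩ := exists_bijOn_of_rootedSubtreeIso h
      exact ⟨a, h₁, h₂, fun _ => h₃⟩
    · simp [Φ, hS, hT] at hi
    · simp [Φ, hS, hT] at hi
    · have hS' : S.1 ∩ B i = ∅ :=
        Set.eq_empty_of_forall_notMem fun x hx => hS (hreach S i x hx.1 hx.2).1
      have hT' : T.1 ∩ B i = ∅ :=
        Set.eq_empty_of_forall_notMem fun x hx => hT (hreach T i x hx.1 hx.2).1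
      refine ⟨id, ?_, fun _ _ _ _ => Iff.rfl, fun _ => rfl⟩
      rw [hS', hT']
      exact Set.bijOn_empty _
  have hfin (i : Fin d) : Finite (Quot (RootedSubtreeIso (G.induce (B i)) ⟨ρ i, hρ i⟩)) := by
    have : Finite (RootedSubtree (G.induce (B i)) ⟨ρ i, hρ i⟩) := by
      unfold RootedSubtree
      infer_instance
    infer_instance
  have hinj : Function.Injective fun q : Quot (RootedSubtreeIso G r) => Φ q.out := by
    intro p q hpq
    rw [← p.out_eq, ← q.out_eq]
    exact Quot.sound (hΦ _ _ hpq)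
  calc nr G r ≤ Nat.card (∀ i, Option (Quot (RootedSubtreeIso (G.induce (B i)) ⟨ρ i, hρ i⟩))) :=
        Nat.card_le_card_of_injective _ hinj
    _ = ∏ i, (nr (G.induce (B i)) ⟨ρ i, hρ i⟩ + 1) := by
        simp only [Nat.card_pi, Finite.card_option, nr]
end

section
/- For every n ≥ 1 there exists a tree T with exactly n vertices such that ns(T) ≥ 2·5^{n/4 − 2}; equivalently, S_n ≥ 2·5^{n/4−2}. -/
open SimpleGraph

/-! ### Counting isomorphism classes of subtrees -/

lemma subtreeIso_equivalence {V : Type*} (G : SimpleGraph V) :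
    Equivalence (SubtreeIso G) where
  refl _ := ⟨.refl⟩
  symm := fun ⟨f⟩ => ⟨f.symm⟩
  trans := fun ⟨f⟩ ⟨g⟩ => ⟨g.comp f⟩

/-- A family of pairwise non-isomorphic subtrees of `H` bounds `ns G` from below
for every graph `G` isomorphic to `H`. -/
lemma card_le_ns {V W C : Type*} [Finite V] {G : SimpleGraph V} {H : SimpleGraph W}
    (e : H ≃g G) (F : C → Set W) (hF : ∀ c, (H.induce (F c)).Connected)
    (hinj : ∀ c c', Nonempty (H.induce (F c) ≃g H.induce (F c')) → c = c') :
    Nat.card C ≤ ns G := by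
  have : Finite (GraphSubtree G) := inferInstanceAs (Finite {S : Set V // (G.induce S).Connected})
  let i (c : C) : H.induce (F c) ≃g G.induce (e '' F c) :=
    e.induce (e.injective.injOn.bijOn_image)
  refine Nat.card_le_card_of_injective
    (fun c => (Quot.mk _ ⟨e '' F c, (i c).connected_iff.1 (hF c)⟩ : Quot (SubtreeIso G))) ?_
  intro c c' h
  obtain ⟨f⟩ := (subtreeIso_equivalence G).quot_mk_eq_iff _ _ |>.1 h
  exact hinj c c' ⟨(i c').symm.comp (f.comp (i c))⟩

lemma ns_le_maxNS {n : ℕ} {G : SimpleGraph (Fin n)} (hG : G.IsTree) : ns G ≤ maxNS n := by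
  refine le_csSup ?_ ⟨G, hG, rfl⟩
  refine ((Set.finite_range fun G : SimpleGraph (Fin n) => ns G).subset ?_).bddAbove
  rintro _ ⟨G, -, rfl⟩
  exact ⟨G, rfl⟩

/-! ### Trees given by a parent map -/

/-- A map sending each vertex other than the root to a parent one level closer to the root. -/
structure ParentMap (V : Type*) where
  root : V
  parent : V → V
  depth : V → ℕ
  depth_root : depth root = 0
  depth_parent : ∀ x, x ≠ root → depth (parent x) + 1 = depth x

namespace ParentMap

variable {V : Type*} (P : ParentMap V)

/-- The graph joining each vertex other than the root to its parent. -/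
def graph : SimpleGraph V where
  Adj x y := (x ≠ P.root ∧ P.parent x = y) ∨ (y ≠ P.root ∧ P.parent y = x)
  symm := ⟨fun _ _ h => h.symm⟩
  loopless := ⟨fun x h => by
    have h' : x ≠ P.root ∧ P.parent x = x := by simpa using h
    have := P.depth_parent x h'.1
    rw [h'.2] at this
    omega⟩

lemma graph_adj {x y : V} : P.graph.Adj x y ↔
    (x ≠ P.root ∧ P.parent x = y) ∨ (y ≠ P.root ∧ P.parent y = x) := Iff.rfl

lemma adj_parent {x : V} (hx : x ≠ P.root) : P.graph.Adj x (P.parent x) := .inl ⟨hx, rfl⟩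

lemma depth_le_of_adj {x y : V} (h : P.graph.Adj x y) : P.depth x ≤ P.depth y + 1 := by
  rcases h with ⟨hx, rfl⟩ | ⟨hy, rfl⟩
  · exact (P.depth_parent x hx).ge
  · have := P.depth_parent y hy
    omega

/-- A vertex set containing the root and closed under taking parents. -/
structure IsClosed (S : Set V) : Prop where
  root_mem : P.root ∈ S
  parent_mem : ∀ x ∈ S, P.parent x ∈ S

variable {P}

lemma IsClosed.connected {S : Set V} (hS : P.IsClosed S) : (P.graph.induce S).Connected := by
  rw [connected_iff_exists_forall_reachable]
  refine ⟨⟨P.root, hS.root_mem⟩, ?_⟩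
  suffices ∀ k (x : S), P.depth x = k → (P.graph.induce S).Reachable ⟨P.root, hS.root_mem⟩ x from
    fun x => this _ x rfl
  intro k
  induction k with
  | zero =>
    rintro ⟨x, hx⟩ h
    obtain rfl : x = P.root := by
      by_contra hne
      have := P.depth_parent x hne
      simp only at h
      omega
    exact .refl _
  | succ k ih =>
    rintro ⟨x, hx⟩ h
    have hne : x ≠ P.root := by
      rintro rfl
      simp [P.depth_root] at h
    have := P.depth_parent x hne
    refine (ih ⟨P.parent x, hS.parent_mem x hx⟩ (by simp only at h ⊢; omega)).trans
      (Adj.reachable ?_)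
    exact (P.adj_parent hne).symm

variable (P)

lemma isTree [Finite V] : P.graph.IsTree := by
  have hc : P.graph.Connected :=
    (induceUnivIso P.graph).connected_iff.1
      (IsClosed.connected ⟨Set.mem_univ _, fun _ _ => Set.mem_univ _⟩)
  rw [isTree_iff_connected_and_card]
  refine ⟨hc, le_antisymm ?_ hc.card_vert_le_card_edgeSet_add_one⟩
  let φ : {x : V // x ≠ P.root} → P.graph.edgeSet :=
    fun x => ⟨s(x.1, P.parent x.1), P.adj_parent x.2⟩
  have hφ : Function.Surjective φ := by
    rintro ⟨e, he⟩
    induction e with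
    | _ x y =>
      rcases P.graph_adj.1 he with ⟨hx, h⟩ | ⟨hy, h⟩
      · exact ⟨⟨x, hx⟩, Subtype.ext (by simp only [φ, h])⟩
      · exact ⟨⟨y, hy⟩, Subtype.ext (by simp only [φ, h, Sym2.eq_swap])⟩
  have h := Nat.card_le_card_of_surjective φ hφ
  have h' : Nat.card {x : V // x ≠ P.root} + 1 = Nat.card V := by
    classical
    have := Fintype.ofFinite V
    rw [Nat.card_eq_fintype_card, Nat.card_eq_fintype_card, Fintype.card_subtype_compl,
      Fintype.card_subtype_eq]
    exact Nat.sub_add_cancel (Fintype.card_pos_iff.2 ⟨P.root⟩)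
  omega

variable {P} {S T : Set V}

lemma depth_apply_le (hS : P.IsClosed S) (f : P.graph.induce S ≃g P.graph.induce T)
    (hf : ∀ x : S, (x : V) = P.root → (f x : V) = P.root) (x : S) :
    P.depth (f x) ≤ P.depth x := by
  obtain ⟨k, hk⟩ : ∃ k, P.depth x = k := ⟨_, rfl⟩
  induction k generalizing x with
  | zero =>
    have : (x : V) = P.root := by
      by_contra hne
      have := P.depth_parent x hne
      omega
    simp [hf x this, P.depth_root]
  | succ k ih =>
    have hne : (x : V) ≠ P.root := by
      intro h
      simp [h, P.depth_root] at hk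
    have hd := P.depth_parent x hne
    let y : S := ⟨P.parent x, hS.parent_mem x x.2⟩
    have hxy : (P.graph.induce S).Adj x y := P.adj_parent hne
    have h1 := P.depth_le_of_adj (f.map_adj_iff.2 hxy)
    have h2 := ih y (by change P.depth (P.parent x) = k; omega)
    change _ ≤ P.depth (P.parent x) at h2
    simp only [Function.Embedding.subtype_apply] at h1
    omega

/-- An isomorphism of subtrees that preserves the root preserves depths. -/
lemma depth_apply (hS : P.IsClosed S) (hT : P.IsClosed T)
    (f : P.graph.induce S ≃g P.graph.induce T)
    (hf : ∀ x : S, (x : V) = P.root → (f x : V) = P.root) (x : S) :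
    P.depth (f x) = P.depth x := by
  refine (depth_apply_le hS f hf x).antisymm ?_
  have := depth_apply_le hT f.symm (fun y hy => ?_) (f x)
  · simpa using this
  · have h := hf ⟨P.root, hS.root_mem⟩ rfl
    rw [show y = f ⟨P.root, hS.root_mem⟩ from Subtype.ext (hy.trans h.symm)]
    simp

/-- `x` has a child lying in `S`. -/
def HasChildIn (P : ParentMap V) (S : Set V) (x : V) : Prop :=
  ∃ y ∈ S, y ≠ P.root ∧ P.parent y = x

lemma hasChildIn_iff (x : S) : P.HasChildIn S x ↔
    ∃ y : S, (P.graph.induce S).Adj x y ∧ P.depth y = P.depth x + 1 := by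
  constructor
  · rintro ⟨y, hy, hne, h⟩
    refine ⟨⟨y, hy⟩, (.inr ⟨hne, h⟩ : P.graph.Adj x y), ?_⟩
    rw [← h, P.depth_parent y hne]
  · rintro ⟨y, hxy, hd⟩
    rcases (hxy : P.graph.Adj x y) with ⟨hx, h⟩ | ⟨hy, h⟩
    · have := P.depth_parent x hx
      change P.parent (x : V) = y at h
      rw [h] at this
      omega
    · exact ⟨y, y.2, hy, h⟩

lemma hasChildIn_apply (hS : P.IsClosed S) (hT : P.IsClosed T)
    (f : P.graph.induce S ≃g P.graph.induce T)
    (hf : ∀ x : S, (x : V) = P.root → (f x : V) = P.root) (x : S) :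
    P.HasChildIn T (f x) ↔ P.HasChildIn S x := by
  rw [hasChildIn_iff, hasChildIn_iff, f.surjective.exists]
  simp only [f.map_adj_iff, depth_apply hS hT f hf]

end ParentMap

open Classical in
lemma sum_ite_mem_eq_of_equiv {V : Type*} [Fintype V] {S T : Set V} (f : S ≃ T) (w w' : V → ℕ)
    (h : ∀ x : S, w x = w' (f x)) :
    ∑ x, (if x ∈ S then w x else 0) = ∑ x, if x ∈ T then w' x else 0 := by
  have key (A : Set V) (u : V → ℕ) : ∑ x, (if x ∈ A then u x else 0) = ∑ x : A, u x := by
    rw [← Finset.sum_filter]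
    exact Finset.sum_subtype _ (by simp) _
  rw [key, key, ← f.sum_comp]
  exact Finset.sum_congr rfl fun x _ => h x

/-! ### The caterpillar-like tree -/

/-- The vertices of a tree whose root carries `L` leaves and a path of `M` spine vertices,
each spine vertex carrying a path `near`, `far` of length two and a further leaf `twin`. -/
inductive CatVertex (M L : ℕ)
  | root : CatVertex M L
  | spine (i : Fin M) : CatVertex M L
  | near (i : Fin M) : CatVertex M L
  | far (i : Fin M) : CatVertex M L
  | twin (i : Fin M) : CatVertex M L
  | leaf (j : Fin L) : CatVertex M L

namespace CatVertex

variable {M L : ℕ}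

/-- The vertices grouped by kind. -/
def equivSum (M L : ℕ) :
    CatVertex M L ≃ Unit ⊕ (Fin M ⊕ Fin M ⊕ Fin M ⊕ Fin M) ⊕ Fin L where
  toFun
    | root => .inl ()
    | spine i => .inr (.inl (.inl i))
    | near i => .inr (.inl (.inr (.inl i)))
    | far i => .inr (.inl (.inr (.inr (.inl i))))
    | twin i => .inr (.inl (.inr (.inr (.inr i))))
    | leaf j => .inr (.inr j)
  invFun
    | .inl () => root
    | .inr (.inl (.inl i)) => spine i
    | .inr (.inl (.inr (.inl i))) => near i
    | .inr (.inl (.inr (.inr (.inl i)))) => far i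
    | .inr (.inl (.inr (.inr (.inr i)))) => twin i
    | .inr (.inr j) => leaf j
  left_inv x := by cases x <;> rfl
  right_inv x := by rcases x with _ | ⟨_ | _ | _ | _⟩ | _ <;> rfl

instance : Fintype (CatVertex M L) := Fintype.ofEquiv _ (equivSum M L).symm

lemma card_eq : Fintype.card (CatVertex M L) = 1 + 4 * M + L := by
  rw [Fintype.card_congr (equivSum M L)]
  simp only [Fintype.card_sum, Fintype.card_unit, Fintype.card_fin]
  ring

lemma sum_eq (w : CatVertex M L → ℕ) :
    ∑ x, w x = w root + (∑ i, w (spine i) + (∑ i, w (near i) + (∑ i, w (far i) +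
      ∑ i, w (twin i))) + ∑ j, w (leaf j)) := by
  rw [← (equivSum M L).symm.sum_comp]
  simp only [Fintype.sum_sum_type, Finset.univ_unique, Finset.sum_singleton]
  rfl

/-- The parent of a vertex; the root is its own parent. -/
def parent : CatVertex M L → CatVertex M L
  | root => root
  | spine ⟨0, _⟩ => root
  | spine ⟨i + 1, h⟩ => spine ⟨i, Nat.lt_of_succ_lt h⟩
  | near i => spine i
  | far i => near i
  | twin i => spine i
  | leaf _ => root

/-- The distance to the root. -/
def depth : CatVertex M L → ℕ
  | root => 0
  | spine i => i + 1
  | near i => i + 2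
  | far i => i + 3
  | twin i => i + 2
  | leaf _ => 1

/-- The tree, described by its parent map. -/
def parentMap (M L : ℕ) : ParentMap (CatVertex M L) where
  root := root
  parent := parent
  depth := depth
  depth_root := rfl
  depth_parent := by
    rintro (_ | ⟨_ | i, hi⟩ | _ | _ | _ | _) h <;> simp_all [parent, depth]

/-- The `i`-th spine vertex keeps one of the five pendant trees
nothing, `near`, `near` and `twin`, `near` and `far`, or all three;
the root keeps its first `k` leaves. -/
def subtree (s : Fin M → Fin 5) (k : ℕ) : Set (CatVertex M L) :=
  {x | match x with
    | root => True
    | spine _ => True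
    | near i => s i ≠ 0
    | far i => 3 ≤ s i
    | twin i => s i = 2 ∨ s i = 4
    | leaf j => j < k}

variable {s s' : Fin M → Fin 5} {k k' : ℕ}

@[simp] lemma root_mem : root ∈ (subtree s k : Set (CatVertex M L)) := trivial
@[simp] lemma spine_mem (i) : spine i ∈ (subtree s k : Set (CatVertex M L)) := trivial
@[simp] lemma near_mem (i) : near i ∈ (subtree s k : Set (CatVertex M L)) ↔ s i ≠ 0 := Iff.rfl
@[simp] lemma far_mem (i) : far i ∈ (subtree s k : Set (CatVertex M L)) ↔ 3 ≤ s i := Iff.rfl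
@[simp] lemma twin_mem (i) :
    twin i ∈ (subtree s k : Set (CatVertex M L)) ↔ s i = 2 ∨ s i = 4 := Iff.rfl
@[simp] lemma leaf_mem (j) : leaf j ∈ (subtree s k : Set (CatVertex M L)) ↔ j < k := Iff.rfl

lemma isClosed_subtree : (parentMap M L).IsClosed (subtree s k) where
  root_mem := trivial
  parent_mem := by
    rintro (_ | ⟨_ | i, hi⟩ | i | i | i | j) h
    all_goals simp only [parentMap, parent, root_mem, spine_mem, near_mem, far_mem] at h ⊢
    rintro h0
    simp [h0] at h

/-- Every vertex other than the root has at most four neighbours. -/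
lemma exists_neighbor_cover (x : CatVertex M L) (hx : x ≠ root) :
    ∃ g : Fin 4 → CatVertex M L, ∀ y, (parentMap M L).graph.Adj x y → ∃ i, g i = y := by
  obtain ⟨u, hu⟩ : ∃ u : CatVertex M L, ∀ i j : Fin M, x = spine i →
      (j : ℕ) = i + 1 → u = spine j := by
    by_cases h : ∃ i j : Fin M, x = spine i ∧ (j : ℕ) = i + 1
    · obtain ⟨i, j, rfl, hj⟩ := h
      refine ⟨spine j, fun i' j' h1 h2 => ?_⟩
      cases h1
      rw [Fin.ext (hj.trans h2.symm)]
    · exact ⟨root, fun i j h1 h2 => (h ⟨i, j, h1, h2⟩).elim⟩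
  obtain ⟨v, hv⟩ : ∃ v : CatVertex M L, ∀ i,
      (x = spine i → v = near i) ∧ (x = near i → v = far i) := by
    rcases x with _ | i | i | i | i | j
    · exact ⟨root, by simp⟩
    · exact ⟨near i, by simp⟩
    · exact ⟨far i, by simp⟩
    all_goals exact ⟨root, by simp⟩
  obtain ⟨w, hw⟩ : ∃ w : CatVertex M L, ∀ i, x = spine i → w = twin i := by
    rcases x with _ | i | i | i | i | j
    · exact ⟨root, by simp⟩
    · exact ⟨twin i, by simp⟩
    all_goals exact ⟨root, by simp⟩
  refine ⟨![parent x, u, v, w], fun y hy => ?_⟩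
  rcases hy with ⟨-, rfl⟩ | ⟨-, rfl⟩
  · exact ⟨0, rfl⟩
  · rcases y with _ | ⟨_ | i, hi⟩ | i | i | i | j
    · exact (hx rfl).elim
    · exact (hx rfl).elim
    · exact ⟨1, hu _ _ rfl rfl⟩
    · exact ⟨2, (hv i).1 rfl⟩
    · exact ⟨2, (hv i).2 rfl⟩
    · exact ⟨3, hw i rfl⟩
    · exact (hx rfl).elim

/-- If at least four leaves are kept, then the root is recognised by its degree. -/
lemma apply_root (hM : 0 < M) (hk : 4 ≤ k) (hL : 4 ≤ L) {T : Set (CatVertex M L)}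
    (f : (parentMap M L).graph.induce (subtree s k) ≃g (parentMap M L).graph.induce T)
    (x : (subtree s k : Set (CatVertex M L))) (hx : (x : CatVertex M L) = root) :
    (f x : CatVertex M L) = root := by
  by_contra hne
  obtain ⟨g, hg⟩ := exists_neighbor_cover _ hne
  let c : Option (Fin 4) → (subtree s k : Set (CatVertex M L))
    | none => ⟨spine ⟨0, hM⟩, trivial⟩
    | some j => ⟨leaf (j.castLE hL), by simp; omega⟩
  have hc : Function.Injective c := by
    rintro (_ | i) (_ | j) h
    · rfl
    · cases congrArg Subtype.val h
    · cases congrArg Subtype.val h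
    · simpa [c] using h
  have hadj (a) : (parentMap M L).graph.Adj x (c a) := by
    rw [hx]
    rcases a with _ | j
    · exact .inr ⟨by simp [c, parentMap], rfl⟩
    · exact .inr ⟨by simp [c, parentMap], rfl⟩
  have hex (a) : ∃ i, g i = f (c a) :=
    hg _ (f.map_adj_iff.2 (show ((parentMap M L).graph.induce _).Adj x (c a) from hadj a))
  choose φ hφ using hex
  have hinj : Function.Injective φ := fun a b hab => by
    have h := hφ a
    rw [hab, hφ b] at h
    exact hc (f.injective (Subtype.ext h.symm))
  simpa using Fintype.card_le_of_injective φ hinj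

lemma hasChildIn_spine (hs : ∀ i : Fin M, (i : ℕ) + 1 = M → s i ≠ 0) (i : Fin M) :
    (parentMap M L).HasChildIn (subtree s k) (spine i) := by
  by_cases h : (i : ℕ) + 1 = M
  · exact ⟨near i, hs i h, by simp [parentMap], rfl⟩
  · exact ⟨spine ⟨i + 1, by omega⟩, trivial, by simp [parentMap], rfl⟩

lemma hasChildIn_near (i : Fin M) :
    (parentMap M L).HasChildIn (subtree s k) (near i) ↔ 3 ≤ s i := by
  constructor
  · rintro ⟨_ | ⟨_ | i, hi⟩ | i | i | i | j, h, -, h'⟩ <;> cases h'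
    exact h
  · exact fun h => ⟨far i, h, by simp [parentMap], rfl⟩

lemma not_hasChildIn_far (S : Set (CatVertex M L)) (i : Fin M) :
    ¬ (parentMap M L).HasChildIn S (far i) := by
  rintro ⟨_ | ⟨_ | i, hi⟩ | i | i | i | j, h, -, h'⟩ <;> cases h'

lemma not_hasChildIn_twin (S : Set (CatVertex M L)) (i : Fin M) :
    ¬ (parentMap M L).HasChildIn S (twin i) := by
  rintro ⟨_ | ⟨_ | i, hi⟩ | i | i | i | j, h, -, h'⟩ <;> cases h'

lemma not_hasChildIn_leaf (S : Set (CatVertex M L)) (j : Fin L) :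
    ¬ (parentMap M L).HasChildIn S (leaf j) := by
  rintro ⟨_ | ⟨_ | i, hi⟩ | i | i | i | j, h, -, h'⟩ <;> cases h'

/-- The kept pendant trees are determined by the isomorphism class of the subtree. -/
lemma eq_of_iso (hM : 0 < M) (hk : 4 ≤ k) (hkL : k ≤ L) (hkL' : k' ≤ L)
    (hs : ∀ i : Fin M, (i : ℕ) + 1 = M → s i ≠ 0) (hs' : ∀ i : Fin M, (i : ℕ) + 1 = M → s' i ≠ 0)
    (f : (parentMap M L).graph.induce (subtree s k) ≃g
      (parentMap M L).graph.induce (subtree s' k')) : s = s' ∧ k = k' := by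
  classical
  have hf := apply_root hM hk (hk.trans hkL) f
  have hd := ParentMap.depth_apply isClosed_subtree isClosed_subtree f hf
  have hc := ParentMap.hasChildIn_apply isClosed_subtree isClosed_subtree f hf
  have hchild (t : ℕ) := sum_ite_mem_eq_of_equiv f.toEquiv
    (fun x => if (parentMap M L).HasChildIn (subtree s k) x ∧ (parentMap M L).depth x = t
      then 1 else 0)
    (fun x => if (parentMap M L).HasChildIn (subtree s' k') x ∧ (parentMap M L).depth x = t
      then 1 else 0) (fun x => by
        simp only [RelIso.coe_fn_toEquiv, hd, hc])
  have hlevel (t : ℕ) := sum_ite_mem_eq_of_equiv f.toEquiv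
    (fun x => if (parentMap M L).depth x = t then 1 else 0)
    (fun x => if (parentMap M L).depth x = t then 1 else 0) (fun x => by
        simp only [RelIso.coe_fn_toEquiv, hd])
  have hfar (i : Fin M) : 3 ≤ s i ↔ 3 ≤ s' i := by
    have h := hchild (i + 2)
    simp only [sum_eq, hasChildIn_spine hs, hasChildIn_spine hs', hasChildIn_near,
      not_hasChildIn_far, not_hasChildIn_twin, not_hasChildIn_leaf] at h
    simp [parentMap, depth, ← Fin.ext_iff] at h
    rw [Fintype.sum_eq_single i fun j hj => by simp [hj],
      Fintype.sum_eq_single i fun j hj => by simp [hj]] at h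
    revert h
    generalize s i = a, s' i = b
    fin_cases a <;> fin_cases b <;> simp
  have hstate (i : Fin M) : s i = s' i := by
    have h := hlevel (i + 2)
    simp [sum_eq, parentMap, depth, hfar, ← Fin.ext_iff] at h
    rw [add_left_comm, add_left_comm (∑ x, if s' x = 0 then 0 else if x = i then 1 else 0)] at h
    have h := Nat.add_left_cancel h
    rw [Fintype.sum_eq_single i fun j hj => by simp [hj],
      Fintype.sum_eq_single i fun j hj => by simp [hj],
      Fintype.sum_eq_single i fun j hj => by simp [hj],
      Fintype.sum_eq_single i fun j hj => by simp [hj]] at h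
    have h3 := hfar i
    revert h h3
    generalize s i = a, s' i = b
    fin_cases a <;> fin_cases b <;> simp
  refine ⟨funext hstate, ?_⟩
  have h := hlevel 1
  simp [sum_eq, parentMap, depth] at h
  rw [Fin.card_filter_val_lt, Fin.card_filter_val_lt] at h
  omega

/-- A tree with `4 * m + 9 + a` vertices and at least `4 * (a + 1) * 5 ^ m` subtrees
up to isomorphism. -/
lemma exists_tree (m a : ℕ) : ∃ G : SimpleGraph (Fin (4 * m + 9 + a)), G.IsTree ∧
    4 * (a + 1) * 5 ^ m ≤ ns G := by
  have hcard : Fintype.card (CatVertex (m + 1) (4 + a)) = 4 * m + 9 + a := by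
    rw [card_eq]
    ring
  let e : CatVertex (m + 1) (4 + a) ≃ Fin (4 * m + 9 + a) := Fintype.equivFinOfCardEq hcard
  let φ := Iso.map e (parentMap (m + 1) (4 + a)).graph
  refine ⟨_, φ.isTree_iff.1 (parentMap (m + 1) (4 + a)).isTree, ?_⟩
  have h := card_le_ns φ (C := (Fin m → Fin 5) × Fin 4 × Fin (a + 1))
    (fun c => subtree (Fin.snoc (α := fun _ => Fin 5) c.1 c.2.1.succ) (4 + c.2.2))
    (fun _ => isClosed_subtree.connected) ?_
  · refine le_of_eq_of_le ?_ h
    simp only [Nat.card_eq_fintype_card, Fintype.card_prod, Fintype.card_fun, Fintype.card_fin]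
    ring
  · rintro ⟨x, t, j⟩ ⟨x', t', j'⟩ ⟨f⟩
    have hlast (x : Fin m → Fin 5) (t : Fin 4) (i : Fin (m + 1)) (hi : (i : ℕ) + 1 = m + 1) :
        Fin.snoc (α := fun _ => Fin 5) x t.succ i ≠ 0 := by
      obtain rfl : i = Fin.last m := Fin.ext (by simpa using hi)
      simp [Fin.succ_ne_zero]
    obtain ⟨hs, hk⟩ := eq_of_iso (Nat.succ_pos m) (Nat.le_add_right 4 _) (by dsimp only; omega)
      (by dsimp only; omega) (hlast x t) (hlast x' t') f
    obtain ⟨hx, ht⟩ := Fin.snoc_injective2 hs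
    obtain rfl := Fin.succ_injective _ ht
    obtain rfl : j = j' := Fin.ext (by simpa using hk)
    rw [hx]

end CatVertex

/-- The star centred at `0`. -/
def starParentMap (n : ℕ) : ParentMap (Fin (n + 1)) where
  root := 0
  parent _ := 0
  depth x := if x = 0 then 0 else 1
  depth_root := rfl
  depth_parent x hx := by simp [hx]

lemma one_le_ns_star (n : ℕ) : 1 ≤ ns (starParentMap n).graph := by
  have h := card_le_ns (C := Unit) (Iso.refl (G := (starParentMap n).graph)) (fun _ => {0})
    (fun _ => ParentMap.IsClosed.connected ⟨rfl, fun _ _ => rfl⟩) (fun _ _ _ => rfl)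
  simpa using h

lemma two_le_ns_star (n : ℕ) : 2 ≤ ns (starParentMap (n + 1)).graph := by
  have hne (h : ({0} : Set (Fin (n + 2))) ≃ (Set.univ : Set (Fin (n + 2)))) : False := by
    simpa using Nat.card_congr h
  have h := card_le_ns (C := Bool) (Iso.refl (G := (starParentMap (n + 1)).graph))
    (fun b => cond b {0} Set.univ) (fun b => ?_) ?_
  · simpa using h
  · cases b
    · exact ParentMap.IsClosed.connected ⟨trivial, fun _ _ => trivial⟩
    · exact ParentMap.IsClosed.connected ⟨rfl, fun _ _ => rfl⟩
  · rintro (_ | _) (_ | _) ⟨f⟩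
    · rfl
    · exact (hne f.symm.toEquiv).elim
    · exact (hne f.toEquiv).elim
    · rfl

/-- If `x ^ 4` dominates `2 ^ 4 * 5 ^ k`, then `x` dominates `2 * 5 ^ (k / 4)`. -/
lemma two_mul_rpow_div_four_le {x : ℝ} (hx : 0 ≤ x) (k : ℕ) (h : 2 ^ 4 * 5 ^ k ≤ x ^ 4) :
    2 * (5 : ℝ) ^ ((k : ℝ) / 4) ≤ x := by
  refine le_of_pow_le_pow_left₀ (n := 4) (by norm_num) hx ?_
  rw [mul_pow, ← Real.rpow_mul_natCast (by norm_num)]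
  rwa [Nat.cast_ofNat, div_mul_cancel₀ _ (by norm_num), Real.rpow_natCast]

lemma exists_tree_two_mul_rpow_le (n : ℕ) (hn : 1 ≤ n) :
    ∃ G : SimpleGraph (Fin n), G.IsTree ∧ 2 * (5 : ℝ) ^ ((n : ℝ) / 4 - 2) ≤ (ns G : ℝ) := by
  rcases lt_or_ge n 9 with h9 | h9
  · obtain ⟨n, rfl⟩ := Nat.exists_eq_add_of_le' hn
    refine ⟨_, (starParentMap n).isTree, ?_⟩
    rcases n with _ | n
    · refine le_trans ?_ (Nat.one_le_cast.2 (one_le_ns_star 0))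
      have : (5 : ℝ) ^ (((0 + 1 : ℕ) : ℝ) / 4 - 2) ≤ 5 ^ (-1 : ℝ) :=
        Real.rpow_le_rpow_of_exponent_le (by norm_num) (by norm_num)
      rw [Real.rpow_neg_one] at this
      linarith
    · refine le_trans ?_ (Nat.ofNat_le_cast.2 (two_le_ns_star n))
      have hle : ((n + 1 + 1 : ℕ) : ℝ) ≤ 8 := by exact_mod_cast Nat.le_of_lt_succ h9
      have := Real.rpow_le_one_of_one_le_of_nonpos (x := 5)
        (z := ((n + 1 + 1 : ℕ) : ℝ) / 4 - 2) (by norm_num) (by linarith)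
      linarith
  · obtain ⟨m, a, ha, rfl⟩ : ∃ m a, a < 4 ∧ n = 4 * m + 9 + a :=
      ⟨(n - 9) / 4, (n - 9) % 4, Nat.mod_lt _ (by norm_num), by omega⟩
    obtain ⟨G, hG, h⟩ := CatVertex.exists_tree m a
    refine ⟨G, hG, le_trans ?_ (Nat.cast_le.2 h)⟩
    have hexp : ((4 * m + 9 + a : ℕ) : ℝ) / 4 - 2 = ((a + 1 : ℕ) : ℝ) / 4 + (m : ℕ) := by
      push_cast
      ring
    rw [hexp, Real.rpow_add (by norm_num), Real.rpow_natCast, ← mul_assoc]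
    push_cast
    refine mul_le_mul_of_nonneg_right ?_ (by positivity)
    have := two_mul_rpow_div_four_le (x := 4 * ((a : ℝ) + 1)) (by positivity) (a + 1) (by
      interval_cases a <;> norm_num)
    exact_mod_cast this

/-- For every `n ≥ 1` there is a tree `T` with `n` vertices such that
`ns T ≥ 2 * 5 ^ (n/4 - 2)`; equivalently `S_n ≥ 2 * 5 ^ (n/4 - 2)`. -/
theorem exists_tree_many_subtrees (n : ℕ) (hn : 1 ≤ n) :
    (∃ G : SimpleGraph (Fin n), G.IsTree ∧
      2 * (5 : ℝ) ^ ((n : ℝ) / 4 - 2) ≤ (ns G : ℝ)) ∧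
    2 * (5 : ℝ) ^ ((n : ℝ) / 4 - 2) ≤ (maxNS n : ℝ) := by
  obtain ⟨G, hG, h⟩ := exists_tree_two_mul_rpow_le n hn
  exact ⟨⟨G, hG, h⟩, h.trans (Nat.cast_le.2 (ns_le_maxNS hG))⟩
end

section
/- For every n ≥ 1, S_n ≤ R_n + 3·2^{n/2 − 1}; that is, the maximal number of nonisomorphic subtrees of an n-vertex tree is at most the maximal number of nonisomorphic root-containing subtrees of an n-vertex rooted tree plus 3·2^{n/2−1}. -/
open SimpleGraph

lemma two_pow_sub_one_add_le {a b K M : ℕ} (hKa : K ≤ a) (haM : a ≤ M) (hb : a + b = M + K) :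
    (2 ^ a - 1) + (2 ^ b - 1) ≤ (2 ^ M - 1) + (2 ^ K - 1) := by
  obtain ⟨x, rfl⟩ := Nat.exists_eq_add_of_le hKa
  obtain ⟨y, rfl⟩ := Nat.exists_eq_add_of_le haM
  obtain rfl : b = K + y := by omega
  have hK : 1 ≤ 2 ^ K := Nat.one_le_two_pow
  have hx : 1 ≤ 2 ^ x := Nat.one_le_two_pow
  have hy : 1 ≤ 2 ^ y := Nat.one_le_two_pow
  have hxa : 1 ≤ 2 ^ (K + x) := Nat.one_le_two_pow
  have hyb : 1 ≤ 2 ^ (K + y) := Nat.one_le_two_pow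
  have hxy : 1 ≤ 2 ^ (K + x + y) := Nat.one_le_two_pow
  have key : 2 ^ (K + x) + 2 ^ (K + y) ≤ 2 ^ (K + x + y) + 2 ^ K := by
    obtain ⟨p, hp⟩ := Nat.exists_eq_add_of_le hx
    obtain ⟨q, hq⟩ := Nat.exists_eq_add_of_le hy
    simp only [pow_add, hp, hq]
    nlinarith [Nat.zero_le (2 ^ K * (p * q))]
  omega

lemma sum_two_pow_sub_one_le {ι : Type*} (s : Finset ι) (a : ι → ℕ) :
    ∑ i ∈ s, (2 ^ a i - 1) ≤ 2 ^ (∑ i ∈ s, a i) - 1 := by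
  classical
  induction s using Finset.induction_on with
  | empty => simp
  | insert i s hi ih =>
    rw [Finset.sum_insert hi, Finset.sum_insert hi]
    have := two_pow_sub_one_add_le (Nat.zero_le (a i))
      (Nat.le_add_right (a i) (∑ j ∈ s, a j)) (add_zero _).symm
    simp only [pow_zero, Nat.sub_self, add_zero] at this
    omega

lemma sum_two_pow_sub_one_le_of_le {ι : Type*} (s : Finset ι) (a : ι → ℕ) {M : ℕ}
    (ha : ∀ i ∈ s, a i ≤ M) {K : ℕ} (hKM : K ≤ M) (hsum : ∑ i ∈ s, a i ≤ M + K) :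
    ∑ i ∈ s, (2 ^ a i - 1) ≤ (2 ^ M - 1) + (2 ^ K - 1) := by
  classical
  induction s using Finset.induction_on generalizing K with
  | empty => simp
  | insert i s hi ih =>
    rw [Finset.sum_insert hi] at hsum ⊢
    have hiM := ha i (Finset.mem_insert_self i s)
    rcases le_total (a i) K with h | h
    · have hrest := ih (fun j hj => ha j (Finset.mem_insert_of_mem hj))
        ((Nat.sub_le K (a i)).trans hKM) (by omega)
      have := two_pow_sub_one_add_le (Nat.zero_le (a i)) h
        (b := K - a i) (by omega)
      simp only [pow_zero, Nat.sub_self, add_zero] at this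
      omega
    · have hrest := sum_two_pow_sub_one_le s a
      have hmono : 2 ^ (∑ j ∈ s, a j) ≤ 2 ^ (M + K - a i) :=
        Nat.pow_le_pow_right two_pos (by omega)
      have := two_pow_sub_one_add_le h hiM (b := M + K - a i) (by omega)
      omega

section Branch

variable {V : Type*} [Fintype V] {G : SimpleGraph V}

/-- The vertices strictly closer to `u` than to `v`. In a tree with `u` adjacent to `v`, this is
the component of `u` after deleting `v`. -/
noncomputable def branch (G : SimpleGraph V) (v u : V) : Finset V :=
  {w | G.dist u w < G.dist v w}

lemma mem_branch {v u w : V} : w ∈ branch G v u ↔ G.dist u w < G.dist v w := by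
  simp [branch]

lemma dist_of_mem_branch {v u w : V} (hG : G.IsTree) (hvu : G.Adj v u) (hw : w ∈ branch G v u) :
    G.dist v w = G.dist u w + 1 := by
  have h := hG.dist_eq_dist_add_one_of_adj w hvu
  rw [mem_branch] at hw
  rw [G.dist_comm (u := w), G.dist_comm (u := w)] at h
  omega

lemma dist_of_notMem_branch {v u w : V} (hG : G.IsTree) (hvu : G.Adj v u)
    (hw : w ∉ branch G v u) : G.dist u w = G.dist v w + 1 := by
  have h := hG.dist_eq_dist_add_one_of_adj w hvu
  rw [mem_branch] at hw
  rw [G.dist_comm (u := w), G.dist_comm (u := w)] at h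
  omega

lemma root_notMem_branch {v u : V} : v ∉ branch G v u := by
  simp [mem_branch]

lemma exists_mem_branch {v w : V} (hG : G.IsTree) (hw : w ≠ v) :
    ∃ u, G.Adj v u ∧ w ∈ branch G v u := by
  obtain ⟨p, hp⟩ := hG.connected.exists_walk_length_eq_dist v w
  cases p with
  | nil => exact absurd rfl hw
  | @cons _ u _ h q =>
    refine ⟨u, h, mem_branch.2 ?_⟩
    have := dist_le q
    rw [Walk.length_cons] at hp
    omega

lemma branch_unique {v u u' w : V} (hG : G.IsTree) (hu : G.Adj v u) (hu' : G.Adj v u')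
    (hw : w ∈ branch G v u) (hw' : w ∈ branch G v u') : u = u' := by
  obtain ⟨p, hp⟩ := hG.connected.exists_walk_length_eq_dist u w
  obtain ⟨q, hq⟩ := hG.connected.exists_walk_length_eq_dist u' w
  have hp' : (Walk.cons hu p).IsPath := Walk.isPath_of_length_eq_dist _ (by
    rw [Walk.length_cons, hp, dist_of_mem_branch hG hu hw])
  have hq' : (Walk.cons hu' q).IsPath := Walk.isPath_of_length_eq_dist _ (by
    rw [Walk.length_cons, hq, dist_of_mem_branch hG hu' hw'])
  have := (hG.existsUnique_path v w).unique hp' hq'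
  simpa using congrArg Walk.snd this

lemma mem_branch_of_dist_eq {v u w w' : V} (hG : G.IsTree) (hww' : G.Adj w w')
    (hw : w ∈ branch G v u) (hd : G.dist v w' = G.dist v w + 1) : w' ∈ branch G v u := by
  rw [mem_branch] at hw ⊢
  have := hG.connected.dist_triangle (u := u) (v := w) (w := w')
  rw [dist_eq_one_iff_adj.2 hww'] at this
  omega

lemma mem_branch_of_adj {v u w w' : V} (hG : G.IsTree) (hu : G.Adj v u) (hww' : G.Adj w w')
    (hw : w ∈ branch G v u) (hw' : w' ≠ v) : w' ∈ branch G v u := by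
  rcases hG.dist_eq_dist_add_one_of_adj v hww' with h | h
  · obtain ⟨u', hu', hmem⟩ := exists_mem_branch hG hw'
    rwa [branch_unique hG hu hu' hw (mem_branch_of_dist_eq hG hww'.symm hmem h)]
  · exact mem_branch_of_dist_eq hG hww' hw h

lemma exists_subset_branch {v : V} (hG : G.IsTree) {S : Set V} (hS : (G.induce S).Connected)
    (hv : v ∉ S) : ∃ u, G.Adj v u ∧ S ⊆ branch G v u := by
  obtain ⟨⟨s, hs⟩⟩ := hS.nonempty
  obtain ⟨u, hu, hsu⟩ := exists_mem_branch hG (v := v) (w := s) (by rintro rfl; exact hv hs)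
  refine ⟨u, hu, fun w hw => ?_⟩
  obtain ⟨p⟩ := hS.preconnected ⟨s, hs⟩ ⟨w, hw⟩
  suffices H : ∀ (x y : S), (G.induce S).Walk x y → x.1 ∈ branch G v u → y.1 ∈ branch G v u from
    H _ _ p hsu
  intro x y p
  induction p with
  | nil => exact id
  | @cons x y z h _ ih =>
    exact fun hx => ih (mem_branch_of_adj hG hu h hx (fun hy => hv (hy ▸ y.2)))

lemma sum_dist_add_two_mul_card_branch {v u : V} (hG : G.IsTree) (hu : G.Adj v u) :
    ∑ w, G.dist u w + 2 * (branch G v u).card = ∑ w, G.dist v w + Fintype.card V := by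
  classical
  have hcard : (branch G v u).card = ∑ w, if w ∈ branch G v u then 1 else 0 := by simp
  rw [hcard, Finset.mul_sum, ← Finset.sum_add_distrib, Fintype.card_eq_sum_ones,
    ← Finset.sum_add_distrib]
  refine Finset.sum_congr rfl fun w _ => ?_
  split_ifs with h
  · have := dist_of_mem_branch hG hu h
    omega
  · have := dist_of_notMem_branch hG hu h
    omega

/-- Every finite tree has a centroid: a vertex all of whose branches contain at most half of the
vertices. -/
lemma exists_centroid (hG : G.IsTree) :
    ∃ v, ∀ u, G.Adj v u → 2 * (branch G v u).card ≤ Fintype.card V := by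
  obtain ⟨r⟩ := hG.connected.nonempty
  obtain ⟨v, -, hv⟩ := Finset.exists_min_image Finset.univ (fun v => ∑ w, G.dist v w)
    ⟨r, Finset.mem_univ r⟩
  refine ⟨v, fun u hu => ?_⟩
  have := hv u (Finset.mem_univ u)
  have := sum_dist_add_two_mul_card_branch hG hu
  omega

open Classical in
lemma sum_card_branch_lt (hG : G.IsTree) (v : V) :
    ∑ u with G.Adj v u, (branch G v u).card < Fintype.card V := by
  rw [← Finset.card_biUnion]
  · refine Finset.card_lt_univ_of_notMem (x := v) ?_
    simp [root_notMem_branch]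
  · intro u hu u' hu' hne
    rw [Function.onFun, Finset.disjoint_left]
    intro w hw hw'
    exact hne (branch_unique hG (by simpa using hu) (by simpa using hu') hw hw')

open Classical in
lemma ncard_avoiding_le (hG : G.IsTree) (v : V) :
    {S : Set V | (G.induce S).Connected ∧ v ∉ S}.ncard ≤
      ∑ u with G.Adj v u, (2 ^ (branch G v u).card - 1) := by
  let N : Finset V := {u | G.Adj v u}
  have hsub : {S : Set V | (G.induce S).Connected ∧ v ∉ S} ⊆
      ⋃ u ∈ N, (𝒫 (branch G v u : Set V) \ {∅}) := by
    rintro S ⟨hS, hv⟩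
    obtain ⟨u, hu, hSu⟩ := exists_subset_branch hG hS hv
    obtain ⟨s⟩ := hS.nonempty
    simp only [Set.mem_iUnion]
    exact ⟨u, by simpa [N] using hu, hSu, Set.Nonempty.ne_empty ⟨s.1, s.2⟩⟩
  refine (Set.ncard_le_ncard hsub (Set.toFinite _)).trans
    ((Finset.set_ncard_biUnion_le _ _).trans (Finset.sum_le_sum fun u _ => ?_))
  rw [Set.ncard_sdiff_singleton_of_mem (Set.empty_subset _), Set.ncard_powerset,
    Set.ncard_coe_finset]

lemma ns_le_nr_add_ncard_avoiding (G : SimpleGraph V) (v : V) :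
    ns G ≤ nr G v + {S : Set V | (G.induce S).Connected ∧ v ∉ S}.ncard := by
  have : Finite (RootedSubtree G v) := Subtype.finite
  let f : Quot (RootedSubtreeIso G v) ⊕ {S : Set V | (G.induce S).Connected ∧ v ∉ S} →
      Quot (SubtreeIso G) :=
    Sum.elim
      (Quot.map (fun S => (⟨S.1, S.2.2⟩ : GraphSubtree G)) fun _ _ ⟨e, _⟩ => ⟨e⟩)
      (fun S => Quot.mk _ ⟨S.1, S.2.1⟩)
  have hf : Function.Surjective f := by
    rintro ⟨S, hS⟩
    by_cases hv : v ∈ S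
    · exact ⟨Sum.inl (Quot.mk _ ⟨S, hv, hS⟩), rfl⟩
    · exact ⟨Sum.inr ⟨S, hS, hv⟩, rfl⟩
  have := Nat.card_le_card_of_surjective f hf
  rwa [Nat.card_sum, Nat.card_coe_set_eq] at this

end Branch

lemma nr_le_maxNR {n : ℕ} {G : SimpleGraph (Fin n)} (hG : G.IsTree) (r : Fin n) :
    nr G r ≤ maxNR n := by
  refine le_csSup (Set.Finite.bddAbove ?_) ⟨G, r, hG, rfl⟩
  refine (Set.finite_range fun p : SimpleGraph (Fin n) × Fin n => nr p.1 p.2).subset ?_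
  rintro _ ⟨G, r, -, rfl⟩
  exact ⟨(G, r), rfl⟩

lemma ns_le_maxNR_add {n : ℕ} {G : SimpleGraph (Fin n)} (hG : G.IsTree) :
    ns G ≤ maxNR n + ((2 ^ (n / 2) - 1) + (2 ^ ((n - 1) / 2) - 1)) := by
  classical
  obtain ⟨v, hv⟩ := exists_centroid hG
  have hsum := sum_card_branch_lt hG v
  rw [Fintype.card_fin] at hv hsum
  refine (ns_le_nr_add_ncard_avoiding G v).trans (add_le_add (nr_le_maxNR hG v)
    ((ncard_avoiding_le hG v).trans (sum_two_pow_sub_one_le_of_le _ _ ?_ (by omega) (by omega))))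
  intro u hu
  have := hv u (by simpa using hu)
  omega

lemma two_pow_half_add_two_pow_half_le (n : ℕ) (hn : 1 ≤ n) :
    (2 : ℝ) ^ (n / 2) + (2 : ℝ) ^ ((n - 1) / 2) ≤ 3 * (2 : ℝ) ^ ((n : ℝ) / 2 - 1) := by
  rw [Real.rpow_sub_one two_ne_zero]
  rcases Nat.even_or_odd' n with ⟨k, rfl | rfl⟩
  · obtain ⟨j, rfl⟩ : ∃ j, k = j + 1 := ⟨k - 1, by omega⟩
    have h1 : 2 * (j + 1) / 2 = j + 1 := by omega
    have h2 : (2 * (j + 1) - 1) / 2 = j := by omega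
    have h3 : ((2 * (j + 1) : ℕ) : ℝ) / 2 = ((j + 1 : ℕ) : ℝ) := by push_cast; ring
    rw [h1, h2, h3, Real.rpow_natCast, pow_succ]
    linarith
  · have h1 : (2 * k + 1) / 2 = k := by omega
    have h2 : (2 * k + 1 - 1) / 2 = k := by omega
    have h3 : ((2 * k + 1 : ℕ) : ℝ) / 2 = (k : ℝ) + 1 / 2 := by push_cast; ring
    rw [h1, h2, h3, Real.rpow_add two_pos, Real.rpow_natCast, ← Real.sqrt_eq_rpow]
    have hs : (4 / 3 : ℝ) ≤ √2 := Real.le_sqrt_of_sq_le (by norm_num)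
    have hk : (0 : ℝ) < 2 ^ k := by positivity
    nlinarith

/-- For every `n ≥ 1`, `S_n ≤ R_n + 3 * 2 ^ (n/2 - 1)`. -/
theorem maxNS_le_maxNR_add (n : ℕ) (hn : 1 ≤ n) :
    (maxNS n : ℝ) ≤ (maxNR n : ℝ) + 3 * (2 : ℝ) ^ ((n : ℝ) / 2 - 1) := by
  have hle : maxNS n ≤ maxNR n + (2 ^ (n / 2) + 2 ^ ((n - 1) / 2)) := by
    refine csSup_le' ?_
    rintro _ ⟨G, hG, rfl⟩
    exact (ns_le_maxNR_add hG).trans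
      (add_le_add_right (add_le_add (Nat.sub_le _ _) (Nat.sub_le _ _)) _)
  refine (Nat.cast_le.2 hle).trans ?_
  push_cast
  exact (add_le_add_iff_left _).2 (two_pow_half_add_two_pow_half_le n hn)
end

section
/- For every rooted tree T with n vertices, nr(T) ≤ 5^{n/4}; equivalently, R_n ≤ 5^{n/4} for all n ≥ 1. -/
open SimpleGraph

/-- The multisets obtained by choosing, from some of the sets in a list, one element outside `E`. -/
def pick (E : Finset ℕ) : List (Finset ℕ) → Finset (Multiset ℕ)
  | [] => {0}
  | C :: l => pick E l ∪ Finset.image₂ (· ::ₘ ·) (C \ E) (pick E l)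

theorem mem_pick_cons {E C : Finset ℕ} {l : List (Finset ℕ)} {m : Multiset ℕ} :
    m ∈ pick E (C :: l) ↔
      m ∈ pick E l ∨ ∃ y ∈ C, y ∉ E ∧ ∃ m' ∈ pick E l, y ::ₘ m' = m := by
  simp [pick, Finset.mem_image₂, and_assoc]

theorem pick_perm (E : Finset ℕ) {l l' : List (Finset ℕ)} (h : l.Perm l') :
    pick E l = pick E l' := by
  induction h with
  | nil => rfl
  | cons C _ ih => simp only [pick, ih]
  | trans _ _ ih₁ ih₂ => exact ih₁.trans ih₂
  | swap C D l =>
    have key : ∀ C D : Finset ℕ, pick E (C :: D :: l) ⊆ pick E (D :: C :: l) := by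
      intro C D m hm
      rw [mem_pick_cons, mem_pick_cons] at hm
      rw [mem_pick_cons, mem_pick_cons]
      rcases hm with (hm | ⟨y, hy, hyE, m', hm', rfl⟩) | ⟨y, hy, hyE, m', hm', rfl⟩
      · exact Or.inl (Or.inl hm)
      · exact Or.inr ⟨y, hy, hyE, m', mem_pick_cons.2 (Or.inl hm'), rfl⟩
      · rcases mem_pick_cons.1 hm' with hm' | ⟨z, hz, hzE, m'', hm'', rfl⟩
        · exact Or.inl (Or.inr ⟨y, hy, hyE, m', hm', rfl⟩)
        · exact Or.inr ⟨z, hz, hzE, y ::ₘ m'',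
            mem_pick_cons.2 (Or.inr ⟨y, hy, hyE, m'', hm'', rfl⟩), Multiset.cons_swap _ _ _⟩
    exact (key D C).antisymm (key C D)

theorem zero_mem_pick (E : Finset ℕ) (l : List (Finset ℕ)) : 0 ∈ pick E l := by
  induction l with
  | nil => simp [pick]
  | cons C l ih => exact mem_pick_cons.2 (Or.inl ih)

theorem singleton_mem_pick {l : List (Finset ℕ)} {C : Finset ℕ} (hC : C ∈ l) {x : ℕ}
    (hx : x ∈ C) : {x} ∈ pick ∅ l := by
  induction l with
  | nil => simp at hC
  | cons D l ih =>
    rcases List.mem_cons.1 hC with rfl | h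
    · exact mem_pick_cons.2 (Or.inr ⟨x, hx, by simp, 0, zero_mem_pick _ _, rfl⟩)
    · exact mem_pick_cons.2 (Or.inl (ih h))

theorem exists_mem_of_mem_pick {E : Finset ℕ} {l : List (Finset ℕ)} {m : Multiset ℕ}
    (hm : m ∈ pick E l) {x : ℕ} (hx : x ∈ m) : ∃ C ∈ l, x ∈ C := by
  induction l generalizing m with
  | nil => simp_all [pick]
  | cons D l ih =>
    rcases mem_pick_cons.1 hm with h | ⟨y, hy, -, m', hm', rfl⟩
    · obtain ⟨C, hC, h⟩ := ih h hx
      exact ⟨C, List.mem_cons_of_mem _ hC, h⟩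
    · rcases Multiset.mem_cons.1 hx with rfl | hx
      · exact ⟨D, List.mem_cons_self, hy⟩
      · obtain ⟨C, hC, h⟩ := ih hm' hx
        exact ⟨C, List.mem_cons_of_mem _ hC, h⟩

/-- An element unavailable throughout the list may be excluded at no cost. -/
theorem pick_insert_of_forall_notMem (E : Finset ℕ) {x : ℕ} {l : List (Finset ℕ)}
    (h : ∀ C ∈ l, x ∉ C) : pick (insert x E) l = pick E l := by
  induction l with
  | nil => rfl
  | cons C l ih =>
    have hC : C \ insert x E = C \ E := by
      ext y
      have := h C List.mem_cons_self
      simp only [Finset.mem_sdiff, Finset.mem_insert]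
      grind
    rw [pick, pick, hC, ih fun D hD => h D (List.mem_cons_of_mem _ hD)]

/-- A choice either avoids `x`, or contains an `x` that can be dropped or traded for any `y`
available wherever `x` is. -/
theorem pick_exchange {E : Finset ℕ} {x : ℕ} {l : List (Finset ℕ)} {m : Multiset ℕ}
    (hm : m ∈ pick E l) :
    m ∈ pick (insert x E) l ∨ ∃ m', m = x ::ₘ m' ∧ m' ∈ pick E l ∧
      ∀ y ∉ E, (∀ C ∈ l, x ∈ C → y ∈ C) → y ::ₘ m' ∈ pick E l := by
  induction l generalizing m with
  | nil => exact Or.inl hm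
  | cons C l ih =>
    rcases mem_pick_cons.1 hm with h | ⟨z, hz, hzE, m₁, hm₁, rfl⟩
    · rcases ih h with h | ⟨m', rfl, h₁, h₂⟩
      · exact Or.inl (mem_pick_cons.2 (Or.inl h))
      · exact Or.inr ⟨m', rfl, mem_pick_cons.2 (Or.inl h₁), fun y hy hl =>
          mem_pick_cons.2 (Or.inl (h₂ y hy fun D hD => hl D (List.mem_cons_of_mem _ hD)))⟩
    · by_cases hzx : z = x
      · subst hzx
        exact Or.inr ⟨m₁, rfl, mem_pick_cons.2 (Or.inl hm₁), fun y hy hl =>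
          mem_pick_cons.2 (Or.inr ⟨y, hl C List.mem_cons_self hz, hy, m₁, hm₁, rfl⟩)⟩
      · rcases ih hm₁ with h | ⟨m', rfl, h₁, h₂⟩
        · exact Or.inl (mem_pick_cons.2 (Or.inr ⟨z, hz, by simp [hzx, hzE], m₁, h, rfl⟩))
        · refine Or.inr ⟨z ::ₘ m', Multiset.cons_swap _ _ _,
            mem_pick_cons.2 (Or.inr ⟨z, hz, hzE, m', h₁, rfl⟩), fun y hy hl =>
            mem_pick_cons.2 (Or.inr ⟨z, hz, hzE, y ::ₘ m', h₂ y hy fun D hD =>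
              hl D (List.mem_cons_of_mem _ hD), Multiset.cons_swap _ _ _⟩)⟩

/-- Choices avoiding `E`, with at most one further element taken from `B`. -/
def pickHead (E B : Finset ℕ) (l : List (Finset ℕ)) : Finset (Multiset ℕ) :=
  pick E l ∪ Finset.image₂ (· ::ₘ ·) B (pick E l)

theorem mem_pickHead {E B : Finset ℕ} {l : List (Finset ℕ)} {m : Multiset ℕ} :
    m ∈ pickHead E B l ↔ m ∈ pick E l ∨ ∃ y ∈ B, ∃ m' ∈ pick E l, y ::ₘ m' = m := by
  simp [pickHead, Finset.mem_image₂]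

theorem pickHead_empty (E : Finset ℕ) (l : List (Finset ℕ)) : pickHead E ∅ l = pick E l := by
  simp [pickHead]

theorem card_pickHead_insert_le {E B : Finset ℕ} {x : ℕ} {l : List (Finset ℕ)}
    (hB : ∀ y ∈ B, y ∉ E ∧ ∀ C ∈ l, x ∈ C → y ∈ C) :
    (pickHead E (insert x B) l).card ≤ (pick E l).card + (pickHead (insert x E) B l).card := by
  have hsub : pickHead E (insert x B) l ⊆
      (pick E l).image (x ::ₘ ·) ∪ pickHead (insert x E) B l := by
    intro m hm
    rw [Finset.mem_union, Finset.mem_image, mem_pickHead]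
    rcases mem_pickHead.1 hm with h | ⟨y, hy, m₁, hm₁, rfl⟩
    · rcases pick_exchange (x := x) h with h | ⟨m', rfl, h₁, -⟩
      · exact Or.inr (Or.inl h)
      · exact Or.inl ⟨m', h₁, rfl⟩
    · rcases Finset.mem_insert.1 hy with rfl | hy
      · exact Or.inl ⟨m₁, hm₁, rfl⟩
      · rcases pick_exchange (x := x) hm₁ with h | ⟨m', rfl, h₁, h₂⟩
        · exact Or.inr (Or.inr ⟨y, hy, m₁, h, rfl⟩)
        · exact Or.inl ⟨y ::ₘ m', h₂ y (hB y hy).1 (hB y hy).2, Multiset.cons_swap _ _ _⟩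
  calc _ ≤ _ := Finset.card_le_card hsub
    _ ≤ _ := Finset.card_union_le _ _
    _ ≤ _ := Nat.add_le_add_right Finset.card_image_le _

theorem card_pick_cons_le (E B C : Finset ℕ) (l : List (Finset ℕ)) :
    (pick E (C :: l)).card ≤
      ((C \ E) \ B).card * (pick E l).card + (pickHead E B l).card := by
  have hsub : pick E (C :: l) ⊆
      Finset.image₂ (· ::ₘ ·) ((C \ E) \ B) (pick E l) ∪ pickHead E B l := by
    intro m hm
    rw [Finset.mem_union, Finset.mem_image₂, mem_pickHead]
    rcases mem_pick_cons.1 hm with h | ⟨y, hy, hyE, m₁, hm₁, rfl⟩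
    · exact Or.inr (Or.inl h)
    · by_cases hyB : y ∈ B
      · exact Or.inr (Or.inr ⟨y, hyB, m₁, hm₁, rfl⟩)
      · exact Or.inl ⟨y, by simp [hy, hyE, hyB], m₁, hm₁, rfl⟩
  calc _ ≤ _ := Finset.card_le_card hsub
    _ ≤ _ := Finset.card_union_le _ _
    _ ≤ _ := Nat.add_le_add_right (Finset.card_image₂_le _ _ _) _

/-- The code of a rooted tree whose root branches have the given codes. -/
def treeCode (m : Multiset ℕ) : ℕ := Encodable.encode m

theorem treeCode_injective : Function.Injective treeCode := Encodable.encode_injective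

/-- The code of the path with `n` edges rooted at an end. -/
def pathCode : ℕ → ℕ
  | 0 => treeCode 0
  | n + 1 => treeCode {pathCode n}

theorem pathCode_one_ne_zero : pathCode 1 ≠ pathCode 0 := fun h => by
  have := treeCode_injective h
  simp at this

theorem pathCode_two_ne_zero : pathCode 2 ≠ pathCode 0 := fun h => by
  have := treeCode_injective h
  simp at this

theorem pathCode_two_ne_one : pathCode 2 ≠ pathCode 1 := fun h => by
  have := treeCode_injective h
  exact pathCode_one_ne_zero (by simpa using this)

/-- The codes of excluded paths: none for `j = 0`, the path with two edges for `j = 1`, also the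
path with one edge for `j = 2`, and also the trivial tree for `j ≥ 3`. -/
def pathExcluded : ℕ → Finset ℕ
  | 0 => ∅
  | 1 => {pathCode 2}
  | 2 => {pathCode 1, pathCode 2}
  | _ => {pathCode 0, pathCode 1, pathCode 2}

/-- The number of choices from `l` avoiding `pathExcluded j`. -/
def pickCount (j : ℕ) (l : List (Finset ℕ)) : ℕ := (pick (pathExcluded j) l).card

/-- Closure of a set of codes under shortening paths with at most two edges. -/
def PathClosed (C : Finset ℕ) : Prop :=
  (pathCode 2 ∈ C → pathCode 1 ∈ C) ∧ (pathCode 1 ∈ C → pathCode 0 ∈ C)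

theorem card_pickHead_two {l : List (Finset ℕ)} :
    (pickHead (pathExcluded 2) {pathCode 0} l).card ≤ pickCount 2 l + pickCount 3 l := by
  have := card_pickHead_insert_le (E := pathExcluded 2) (B := ∅) (x := pathCode 0) (l := l)
    (by simp)
  rwa [pickHead_empty] at this

theorem card_pickHead_one {l : List (Finset ℕ)} (hl : ∀ C ∈ l, PathClosed C) :
    (pickHead (pathExcluded 1) {pathCode 1, pathCode 0} l).card ≤
      pickCount 1 l + pickCount 2 l + pickCount 3 l := by
  have := card_pickHead_insert_le (E := pathExcluded 1) (B := {pathCode 0}) (x := pathCode 1)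
    (l := l) (by simpa [pathExcluded, pathCode_two_ne_zero.symm] using fun C hC => (hl C hC).2)
  have h₂ := card_pickHead_two (l := l)
  exact (this.trans (Nat.add_le_add_left h₂ _)).trans_eq (by simp only [pickCount]; ring)

theorem card_pickHead_zero {l : List (Finset ℕ)} (hl : ∀ C ∈ l, PathClosed C) :
    (pickHead (pathExcluded 0) {pathCode 2, pathCode 1, pathCode 0} l).card ≤
      pickCount 0 l + pickCount 1 l + pickCount 2 l + pickCount 3 l := by
  have := card_pickHead_insert_le (E := pathExcluded 0) (B := {pathCode 1, pathCode 0})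
    (x := pathCode 2) (l := l) (by
      simp only [pathExcluded, Finset.mem_insert, Finset.mem_singleton]
      rintro y (rfl | rfl)
      · exact ⟨by simp, fun C hC => (hl C hC).1⟩
      · exact ⟨by simp, fun C hC h => (hl C hC).2 ((hl C hC).1 h)⟩)
  have h₁ := card_pickHead_one hl
  exact (this.trans (Nat.add_le_add_left h₁ _)).trans_eq (by simp only [pickCount]; ring)

theorem pickCount_three_cons_le (C : Finset ℕ) (l : List (Finset ℕ)) :
    pickCount 3 (C :: l) ≤ ((C \ pathExcluded 3).card + 1) * pickCount 3 l := by
  have := card_pick_cons_le (pathExcluded 3) ∅ C l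
  rw [pickHead_empty, Finset.sdiff_empty] at this
  exact this.trans_eq (by simp only [pickCount]; ring)

theorem pickCount_two_cons_le (C : Finset ℕ) (l : List (Finset ℕ)) :
    pickCount 2 (C :: l) ≤
      ((C \ pathExcluded 3).card + 1) * pickCount 2 l + pickCount 3 l := by
  have := card_pick_cons_le (pathExcluded 2) {pathCode 0} C l
  have h := card_pickHead_two (l := l)
  rw [show (C \ pathExcluded 2) \ {pathCode 0} = C \ pathExcluded 3 by
    ext; simp [pathExcluded]; tauto] at this
  simp only [pickCount] at *
  linarith

theorem pickCount_one_cons_le (C : Finset ℕ) {l : List (Finset ℕ)}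
    (hl : ∀ C ∈ l, PathClosed C) :
    pickCount 1 (C :: l) ≤
      ((C \ pathExcluded 3).card + 1) * pickCount 1 l + pickCount 2 l + pickCount 3 l := by
  have := card_pick_cons_le (pathExcluded 1) {pathCode 1, pathCode 0} C l
  have h := card_pickHead_one hl
  rw [show (C \ pathExcluded 1) \ {pathCode 1, pathCode 0} = C \ pathExcluded 3 by
    ext; simp [pathExcluded]; tauto] at this
  simp only [pickCount] at *
  linarith

theorem pickCount_zero_cons_le (C : Finset ℕ) {l : List (Finset ℕ)}
    (hl : ∀ C ∈ l, PathClosed C) :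
    pickCount 0 (C :: l) ≤ ((C \ pathExcluded 3).card + 1) * pickCount 0 l +
      pickCount 1 l + pickCount 2 l + pickCount 3 l := by
  have := card_pick_cons_le (pathExcluded 0) {pathCode 2, pathCode 1, pathCode 0} C l
  have h := card_pickHead_zero hl
  rw [show (C \ pathExcluded 0) \ {pathCode 2, pathCode 1, pathCode 0} = C \ pathExcluded 3 by
    ext; simp [pathExcluded]; tauto] at this
  simp only [pickCount] at *
  linarith

theorem pickCount_zero_eq_one {l : List (Finset ℕ)} (h : ∀ C ∈ l, pathCode 2 ∉ C) :
    pickCount 0 l = pickCount 1 l :=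
  (congrArg Finset.card (pick_insert_of_forall_notMem ∅ h)).symm

theorem pickCount_one_eq_two {l : List (Finset ℕ)} (h : ∀ C ∈ l, pathCode 1 ∉ C) :
    pickCount 1 l = pickCount 2 l :=
  (congrArg Finset.card (pick_insert_of_forall_notMem {pathCode 2} h)).symm

/-- The fourth root of `5`. -/
noncomputable def fourthRootFive : ℝ := (5 : ℝ) ^ (1 / 4 : ℝ)

local notation "ρ" => fourthRootFive

theorem fourthRootFive_pos : 0 < ρ := by
  unfold fourthRootFive; positivity

theorem fourthRootFive_pow_four : ρ ^ 4 = 5 := by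
  rw [fourthRootFive, ← Real.rpow_natCast, ← Real.rpow_mul (by norm_num)]
  norm_num

theorem fourthRootFive_pow (n : ℕ) : ρ ^ n = (5 : ℝ) ^ ((n : ℝ) / 4) := by
  rw [fourthRootFive, ← Real.rpow_natCast, ← Real.rpow_mul (by norm_num)]
  congr 1; ring

theorem fourthRootFive_gt : 1.495 < ρ := by
  by_contra! h
  have := pow_le_pow_left₀ fourthRootFive_pos.le h 4
  rw [fourthRootFive_pow_four] at this
  norm_num at this

theorem fourthRootFive_lt : ρ < 1.496 := by
  by_contra! h
  have := pow_le_pow_left₀ (by norm_num) h 4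
  rw [fourthRootFive_pow_four] at this
  norm_num at this

theorem fourthRootFive_sq_gt : 2.236 < ρ ^ 2 := by
  by_contra! h
  have := pow_le_pow_left₀ (sq_nonneg ρ) h 2
  rw [← pow_mul, fourthRootFive_pow_four] at this
  norm_num at this

theorem fourthRootFive_sq_lt : ρ ^ 2 < 2.2361 := by
  by_contra! h
  have := pow_le_pow_left₀ (by norm_num) h 2
  rw [← pow_mul, fourthRootFive_pow_four] at this
  norm_num at this

theorem fourthRootFive_cube_gt : 3.342 < ρ ^ 3 := by
  nlinarith [fourthRootFive_gt, fourthRootFive_sq_gt]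

theorem fourthRootFive_cube_lt : ρ ^ 3 < 3.346 := by
  nlinarith [fourthRootFive_lt, fourthRootFive_sq_lt, fourthRootFive_pos]

theorem sq_add_le_fourthRootFive_pow (k : ℕ) : ρ ^ 2 + k ≤ ρ ^ (k + 2) := by
  induction k with
  | zero => simp
  | succ k ih =>
    have h₁ := fourthRootFive_gt
    have h₂ := fourthRootFive_sq_gt
    rw [show k + 1 + 2 = (k + 2) + 1 by ring, pow_succ ρ (k + 2)]
    push_cast
    nlinarith [Nat.cast_nonneg (α := ℝ) k]

/-- Bounds, at scale `X`, on numbers of partial choices: `b` counts those whose last shared path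
has at least one edge (or that have no shared path yet), `p` those that have not skipped a branch,
and `q` those that have. -/
structure StarBounds (X b p q : ℝ) : Prop where
  b_nonneg : 0 ≤ b
  b_le : b ≤ p
  p_le : p ≤ X
  q_nonneg : 0 ≤ q
  b_p_q : b + 2 * p + q ≤ ρ ^ 3 * X
  b_p_q' : 2 * b + 3 * p + q ≤ 5 * X
  b_p_q'' : 3 * b + 4 * p + q ≤ 7 * X
  no_leaf : p + q ≤ ρ * X
  one_leaf : 2 * p + q ≤ ρ ^ 2 * X
  two_leaves : 3 * p + q ≤ ρ ^ 3 * X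

/-- The bounds of `StarBounds` together with further ones involving the number `a` of partial
choices whose shared paths all have two edges. -/
structure TallBounds (X a b p q : ℝ) : Prop extends StarBounds X b p q where
  a_nonneg : 0 ≤ a
  a_le : a ≤ b
  a_no_leaf : a + b + 2 * p + q ≤ 3 * ρ * X
  a_one_leaf : 2 * a + 2 * b + 7 * p + 3 * q ≤ 5 * ρ ^ 2 * X
  a_two_leaves : 3 * a + 3 * b + 4 * p + q ≤ 3 * ρ ^ 3 * X

theorem tallBounds_one : TallBounds 1 1 1 1 0 := by
  have := fourthRootFive_gt
  have := fourthRootFive_sq_gt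
  have := fourthRootFive_cube_gt
  constructor <;> (try constructor) <;> linarith

theorem StarBounds.step {X b p q : ℝ} (h : StarBounds X b p q) {w Y : ℝ} (hw : 1 ≤ w)
    (hY : w - 1 + ρ ^ 2 ≤ Y) :
    StarBounds (X * Y) (w * b) (w * p + b) (w * q + p) := by
  obtain ⟨h1, h2, h3, h4, h5, h6, h7, h8, h9, h10⟩ := h
  have r1 := fourthRootFive_gt
  have r2 := fourthRootFive_sq_gt
  have r3 := fourthRootFive_cube_gt
  have hX : 0 ≤ X := by linarith
  have hXY : (w - 1 + ρ ^ 2) * X ≤ X * Y := by nlinarith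
  have hXY' : (w + 1) * X ≤ X * Y := by nlinarith
  have hw0 : 0 ≤ w := by linarith
  have hw1 : 0 ≤ w - 1 := by linarith
  have m1 := mul_le_mul_of_nonneg_left hXY' (by positivity : 0 ≤ ρ ^ 3)
  have m2 := mul_le_mul_of_nonneg_left hXY (by linarith : 0 ≤ ρ)
  have m3 := mul_le_mul_of_nonneg_left hXY (by positivity : 0 ≤ ρ ^ 2)
  have m4 := mul_le_mul_of_nonneg_left hXY (by positivity : 0 ≤ ρ ^ 3)
  have e4 : ρ ^ 2 * (ρ ^ 2 * X) = 5 * X := by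
    rw [← mul_assoc, ← pow_add, fourthRootFive_pow_four]
  have e5 : ρ ^ 3 * (ρ ^ 2 * X) = 5 * (ρ * X) := by
    rw [← mul_assoc, ← pow_add, show 3 + 2 = 4 + 1 by rfl, pow_succ, fourthRootFive_pow_four]
    ring
  have e3 : ρ * (ρ ^ 2 * X) = ρ ^ 3 * X := by ring
  have r1X := mul_le_mul_of_nonneg_right r1.le hX
  have r3X := mul_le_mul_of_nonneg_right r3.le hX
  constructor
  · positivity
  · nlinarith
  · nlinarith
  · nlinarith
  · nlinarith [mul_le_mul_of_nonneg_left h5 hw0]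
  · nlinarith [mul_le_mul_of_nonneg_left h6 hw0]
  · nlinarith [mul_le_mul_of_nonneg_left h7 hw0]
  · nlinarith [mul_le_mul_of_nonneg_left h8 hw1]
  · nlinarith [mul_le_mul_of_nonneg_left h9 hw1]
  · nlinarith [mul_le_mul_of_nonneg_left h10 hw1]

theorem TallBounds.step_one_leaf {X a b p q : ℝ} (h : TallBounds X a b p q) {w : ℕ} {Y : ℝ}
    (hY : w + 2 ≤ Y) (hY' : 5 ≤ Y ∨ w = 1 ∧ ρ ^ 3 ≤ Y) :
    2 * (w * p + a + b) + (w * q + p) ≤ ρ ^ 2 * (X * Y) := by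
  obtain ⟨⟨h1, h2, h3, h4, h5, h6, h7, h8, h9, h10⟩, h11, h12, h13, h14, h15⟩ := h
  have r1 := fourthRootFive_lt
  have r2 := fourthRootFive_sq_gt
  have hX : 0 ≤ X := by linarith
  have hw0 : (0 : ℝ) ≤ w := w.cast_nonneg
  have r2X := mul_le_mul_of_nonneg_right r2.le hX
  have hXY := mul_le_mul_of_nonneg_left hY (by positivity : 0 ≤ ρ ^ 2 * X)
  rcases le_or_gt 3 w with h3w | h3w
  · have h3w' : (0 : ℝ) ≤ w - 3 := by
      have : (3 : ℝ) ≤ w := by exact_mod_cast h3w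
      linarith
    linarith [mul_le_mul_of_nonneg_left h9 h3w']
  · rcases hY' with hY' | ⟨rfl, hY'⟩
    · have hw2 : (w : ℝ) ≤ 2 := by exact_mod_cast Nat.le_of_lt_succ h3w
      have k1 := mul_le_mul_of_nonneg_left h9 hw0
      have k2 : (w : ℝ) * (ρ ^ 2 * X) ≤ 2 * (ρ ^ 2 * X) :=
        mul_le_mul_of_nonneg_right hw2 (by positivity)
      have k3 := mul_le_mul_of_nonneg_left hY' (by positivity : 0 ≤ ρ ^ 2 * X)
      linarith
    · have k3 := mul_le_mul_of_nonneg_left hY' (by positivity : 0 ≤ ρ ^ 2 * X)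
      have e5 : ρ ^ 2 * X * ρ ^ 3 = 5 * (ρ * X) := by
        calc _ = ρ ^ 4 * (ρ * X) := by ring
          _ = _ := by rw [fourthRootFive_pow_four]
      have k4 := mul_le_mul_of_nonneg_right fourthRootFive_sq_lt.le hX
      have k5 := mul_le_mul_of_nonneg_right fourthRootFive_gt.le hX
      push_cast
      linarith

theorem TallBounds.step {X a b p q : ℝ} (h : TallBounds X a b p q) {w : ℕ} {Y : ℝ} (hw : 1 ≤ w)
    (hY : w + 2 ≤ Y) (hY' : 5 ≤ Y ∨ w = 1 ∧ ρ ^ 3 ≤ Y) :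
    TallBounds (X * Y) (w * a) (w * b + a) (w * p + a + b) (w * q + p) := by
  have one_leaf := h.step_one_leaf hY hY'
  have hp : 0 ≤ p := h.b_nonneg.trans h.b_le
  obtain ⟨⟨h1, h2, h3, h4, h5, h6, h7, h8, h9, h10⟩, h11, h12, h13, h14, h15⟩ := h
  have r1 := fourthRootFive_gt
  have r2 := fourthRootFive_sq_gt
  have r3 := fourthRootFive_cube_gt
  have hX : 0 ≤ X := by linarith
  have hXY : ((w : ℝ) + 2) * X ≤ X * Y := by nlinarith
  have hw' : (1 : ℝ) ≤ w := by exact_mod_cast hw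
  have hw0 : (0 : ℝ) ≤ w := by linarith
  have hw1 : (0 : ℝ) ≤ w - 1 := by linarith
  have m1 := mul_le_mul_of_nonneg_left hXY (by linarith : 0 ≤ ρ)
  have m2 := mul_le_mul_of_nonneg_left hXY (by positivity : 0 ≤ ρ ^ 2)
  have m3 := mul_le_mul_of_nonneg_left hXY (by positivity : 0 ≤ ρ ^ 3)
  have r1X := mul_le_mul_of_nonneg_right r1.le hX
  have r2X := mul_le_mul_of_nonneg_right r2.le hX
  have r3X := mul_le_mul_of_nonneg_right r3.le hX
  constructor
  · constructor
    · positivity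
    · linarith [mul_le_mul_of_nonneg_left h2 hw0]
    · linarith [mul_le_mul_of_nonneg_left h3 hw0]
    · positivity
    · linarith [mul_le_mul_of_nonneg_left h5 hw0]
    · linarith [mul_le_mul_of_nonneg_left h6 hw0]
    · linarith [mul_le_mul_of_nonneg_left h7 hw0]
    · linarith [mul_le_mul_of_nonneg_left h8 hw1]
    · exact one_leaf
    · linarith [mul_le_mul_of_nonneg_left h10 hw1]
  · positivity
  · linarith [mul_le_mul_of_nonneg_left h12 hw0]
  · linarith [mul_le_mul_of_nonneg_left h13 hw0]
  · linarith [mul_le_mul_of_nonneg_left h14 hw0]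
  · linarith [mul_le_mul_of_nonneg_left h15 hw0]

theorem StarBounds.leaves {X b p q : ℝ} (h : StarBounds X b p q) (n : ℕ) :
    p * (n + 1) + q ≤ ρ ^ (n + 1) * X := by
  match n with
  | 0 => simpa using h.no_leaf
  | 1 => simpa [one_add_one_eq_two, mul_comm p] using h.one_leaf
  | n + 2 =>
    induction n with
    | zero =>
      have := h.two_leaves
      norm_num
      linarith
    | succ n ih =>
      have hX : 0 ≤ X := by linarith [h.b_nonneg, h.b_le, h.p_le]
      have h₁ : ρ ^ 3 * X ≤ ρ ^ (n + 2 + 1) * X :=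
        mul_le_mul_of_nonneg_right
          (pow_le_pow_right₀ (by linarith [fourthRootFive_gt]) (by omega)) hX
      have h₂ := mul_le_mul_of_nonneg_right fourthRootFive_cube_gt.le hX
      have h₃ := mul_le_mul_of_nonneg_left fourthRootFive_gt.le
        (by have := fourthRootFive_pos; positivity : 0 ≤ ρ ^ (n + 2 + 1) * X)
      have e : ρ ^ (n + 1 + 2 + 1) * X = ρ ^ (n + 2 + 1) * X * ρ := by ring
      rw [e]
      push_cast at ih ⊢
      nlinarith [h.p_le]

/-- A set of codes together with a number of vertices, as for the one-vertex tree. -/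
def IsLeafItem (T : Finset ℕ × ℕ) : Prop := T.1 = {pathCode 0} ∧ T.2 = 1

/-- A set of codes together with a number of vertices, as for a tree of height one. -/
def IsStarItem (T : Finset ℕ × ℕ) : Prop :=
  pathCode 0 ∈ T.1 ∧ pathCode 1 ∈ T.1 ∧ pathCode 2 ∉ T.1 ∧ 2 ≤ T.2 ∧ T.1.card ≤ T.2

/-- A set of codes together with a number of vertices, as for a tree of height at least two. -/
def IsTallItem (T : Finset ℕ × ℕ) : Prop :=
  pathCode 0 ∈ T.1 ∧ pathCode 1 ∈ T.1 ∧ pathCode 2 ∈ T.1 ∧ 3 ≤ T.2 ∧ (T.1.card : ℝ) ≤ ρ ^ T.2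

theorem IsLeafItem.pathClosed {T : Finset ℕ × ℕ} (h : IsLeafItem T) : PathClosed T.1 := by
  simp [PathClosed, h.1, pathCode_one_ne_zero, pathCode_two_ne_zero]

theorem IsStarItem.pathClosed {T : Finset ℕ × ℕ} (h : IsStarItem T) : PathClosed T.1 :=
  ⟨fun _ => h.2.1, fun _ => h.1⟩

theorem IsTallItem.pathClosed {T : Finset ℕ × ℕ} (h : IsTallItem T) : PathClosed T.1 :=
  ⟨fun _ => h.2.1, fun _ => h.1⟩

theorem IsStarItem.card_sdiff_le {T : Finset ℕ × ℕ} (h : IsStarItem T) :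
    (T.1 \ pathExcluded 3).card + 2 ≤ T.2 := by
  obtain ⟨h0, h1, -, -, hc⟩ := h
  have hsub : {pathCode 0, pathCode 1} ⊆ T.1 := by simp [Finset.insert_subset_iff, h0, h1]
  have h2 := Finset.card_sdiff_add_card_eq_card hsub
  rw [Finset.card_pair pathCode_one_ne_zero.symm] at h2
  have h3 : (T.1 \ pathExcluded 3).card ≤ (T.1 \ {pathCode 0, pathCode 1}).card :=
    Finset.card_le_card fun x => by simp [pathExcluded]; tauto
  omega

theorem IsTallItem.card_sdiff {T : Finset ℕ × ℕ} (h : IsTallItem T) :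
    (T.1 \ pathExcluded 3).card + 3 = T.1.card := by
  obtain ⟨h0, h1, h2, -, -⟩ := h
  have hsub : pathExcluded 3 ⊆ T.1 := by
    simp [pathExcluded, Finset.insert_subset_iff, h0, h1, h2]
  have hc : (pathExcluded 3).card = 3 := by
    simp [pathExcluded, Finset.card_insert_of_notMem, pathCode_one_ne_zero.symm,
      pathCode_two_ne_zero.symm, pathCode_two_ne_one.symm]
  rw [← Finset.card_sdiff_add_card_eq_card hsub, hc]

theorem pickCount_three_leaves {l : List (Finset ℕ × ℕ)} (hl : ∀ T ∈ l, IsLeafItem T) :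
    pickCount 3 (l.map Prod.fst) ≤ 1 := by
  induction l with
  | nil => simp [pickCount, pick]
  | cons T l ih =>
    have h := pickCount_three_cons_le T.1 (l.map Prod.fst)
    have h' := ih fun S hS => hl S (List.mem_cons_of_mem _ hS)
    have hT : T.1 \ pathExcluded 3 = ∅ := by
      simp [(hl T List.mem_cons_self).1, pathExcluded]
    rw [hT] at h
    simpa using h.trans (by simpa using h')

theorem pickCount_two_leaves {l : List (Finset ℕ × ℕ)} (hl : ∀ T ∈ l, IsLeafItem T) :
    pickCount 2 (l.map Prod.fst) ≤ l.length + 1 := by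
  induction l with
  | nil => simp [pickCount, pick]
  | cons T l ih =>
    have hl' : ∀ S ∈ l, IsLeafItem S := fun S hS => hl S (List.mem_cons_of_mem _ hS)
    have h := pickCount_two_cons_le T.1 (l.map Prod.fst)
    have h' := ih hl'
    have h₃ := pickCount_three_leaves hl'
    have hT : T.1 \ pathExcluded 3 = ∅ := by
      simp [(hl T List.mem_cons_self).1, pathExcluded]
    rw [hT] at h
    simp only [Finset.card_empty, List.map_cons, List.length_cons] at *
    linarith

theorem sum_snd_leaves {l : List (Finset ℕ × ℕ)} (hl : ∀ T ∈ l, IsLeafItem T) :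
    (l.map Prod.snd).sum = l.length := by
  rw [List.map_congr_left (g := fun _ => 1) fun T hT => (hl T hT).2]
  simp

theorem pickCount_one_leaves {l : List (Finset ℕ × ℕ)} (hl : ∀ T ∈ l, IsLeafItem T) :
    pickCount 1 (l.map Prod.fst) = pickCount 2 (l.map Prod.fst) := by
  apply pickCount_one_eq_two
  simp only [List.mem_map, forall_exists_index, and_imp]
  rintro _ T hT rfl
  simp [(hl T hT).1, pathCode_one_ne_zero]

theorem pickCount_stars_leaves_le {l₁ l₂ : List (Finset ℕ × ℕ)} (h₁ : ∀ T ∈ l₁, IsStarItem T)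
    (h₂ : ∀ T ∈ l₂, IsLeafItem T) {X b p q : ℝ} (h : StarBounds X b p q) :
    b * pickCount 1 ((l₁ ++ l₂).map Prod.fst) + (p - b) * pickCount 2 ((l₁ ++ l₂).map Prod.fst) +
      q * pickCount 3 ((l₁ ++ l₂).map Prod.fst) ≤
      ρ ^ (((l₁ ++ l₂).map Prod.snd).sum + 1) * X := by
  induction l₁ generalizing X b p q with
  | nil =>
    have hp : 0 ≤ p := h.b_nonneg.trans h.b_le
    have k₂ : (pickCount 2 (l₂.map Prod.fst) : ℝ) ≤ l₂.length + 1 := by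
      exact_mod_cast pickCount_two_leaves h₂
    have k₃ : (pickCount 3 (l₂.map Prod.fst) : ℝ) ≤ 1 := by
      exact_mod_cast pickCount_three_leaves h₂
    rw [List.nil_append, sum_snd_leaves h₂, pickCount_one_leaves h₂]
    linarith [h.leaves l₂.length, mul_le_mul_of_nonneg_left k₂ hp,
      mul_le_mul_of_nonneg_left k₃ h.q_nonneg]
  | cons T l ih =>
    have hT := h₁ T List.mem_cons_self
    have hl : ∀ S ∈ l, IsStarItem S := fun S hS => h₁ S (List.mem_cons_of_mem _ hS)
    obtain ⟨k, hk⟩ := Nat.exists_eq_add_of_le' hT.2.2.2.1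
    have hstep := h.step (w := k + 1) (Y := ρ ^ T.2) (by linarith [Nat.cast_nonneg (α := ℝ) k])
      (by rw [hk]; linarith [sq_add_le_fourthRootFive_pow k])
    have hrec := ih hl hstep
    have hclosed : ∀ C ∈ (l ++ l₂).map Prod.fst, PathClosed C := by
      simp only [List.mem_map, List.mem_append, forall_exists_index, and_imp]
      rintro _ S (hS | hS) rfl
      · exact (hl S hS).pathClosed
      · exact (h₂ S hS).pathClosed
    have hx : (T.1 \ pathExcluded 3).card + 1 ≤ k + 1 := by
      have := hT.card_sdiff_le
      omega
    have c₁ := (pickCount_one_cons_le T.1 hclosed).trans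
      (Nat.add_le_add_right (Nat.add_le_add_right (Nat.mul_le_mul_right _ hx) _) _)
    have c₂ := (pickCount_two_cons_le T.1 ((l ++ l₂).map Prod.fst)).trans
      (Nat.add_le_add_right (Nat.mul_le_mul_right _ hx) _)
    have c₃ := (pickCount_three_cons_le T.1 ((l ++ l₂).map Prod.fst)).trans
      (Nat.mul_le_mul_right _ hx)
    rw [← Nat.cast_le (α := ℝ)] at c₁ c₂ c₃
    push_cast at c₁ c₂ c₃
    have e₁ := mul_le_mul_of_nonneg_left c₁ h.b_nonneg
    have e₂ := mul_le_mul_of_nonneg_left c₂ (sub_nonneg.2 h.b_le)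
    have e₃ := mul_le_mul_of_nonneg_left c₃ h.q_nonneg
    have e : ρ ^ (T.2 + ((l ++ l₂).map Prod.snd).sum + 1) * X =
        ρ ^ (((l ++ l₂).map Prod.snd).sum + 1) * (X * ρ ^ T.2) := by ring
    simp only [List.cons_append, List.map_cons, List.sum_cons]
    rw [e]
    linarith

theorem pickCount_tall_stars_leaves_le {l₀ l₁ l₂ : List (Finset ℕ × ℕ)}
    (h₀ : ∀ T ∈ l₀, IsTallItem T) (h₁ : ∀ T ∈ l₁, IsStarItem T)
    (h₂ : ∀ T ∈ l₂, IsLeafItem T) {X a b p q : ℝ} (h : TallBounds X a b p q) :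
    a * pickCount 0 ((l₀ ++ (l₁ ++ l₂)).map Prod.fst) +
      (b - a) * pickCount 1 ((l₀ ++ (l₁ ++ l₂)).map Prod.fst) +
      (p - b) * pickCount 2 ((l₀ ++ (l₁ ++ l₂)).map Prod.fst) +
      q * pickCount 3 ((l₀ ++ (l₁ ++ l₂)).map Prod.fst) ≤
      ρ ^ (((l₀ ++ (l₁ ++ l₂)).map Prod.snd).sum + 1) * X := by
  induction l₀ generalizing X a b p q with
  | nil =>
    have h01 : pickCount 0 ((l₁ ++ l₂).map Prod.fst) = pickCount 1 ((l₁ ++ l₂).map Prod.fst) := by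
      apply pickCount_zero_eq_one
      simp only [List.mem_map, List.mem_append, forall_exists_index, and_imp]
      rintro _ T (hT | hT) rfl
      · exact (h₁ T hT).2.2.1
      · simp [(h₂ T hT).1, pathCode_two_ne_zero]
    rw [List.nil_append, h01]
    linarith [pickCount_stars_leaves_le h₁ h₂ h.toStarBounds]
  | cons T l ih =>
    have hT := h₀ T List.mem_cons_self
    have hl : ∀ S ∈ l, IsTallItem S := fun S hS => h₀ S (List.mem_cons_of_mem _ hS)
    obtain ⟨x, hx⟩ : ∃ x, (T.1 \ pathExcluded 3).card = x := ⟨_, rfl⟩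
    have hcard : x + 3 = T.1.card := by rw [← hx, hT.card_sdiff]
    have hpow : ((x + 1 : ℕ) : ℝ) + 2 ≤ ρ ^ T.2 := by
      refine le_trans (le_of_eq ?_) hT.2.2.2.2
      rw [← hcard]; push_cast; ring
    have hY' : 5 ≤ ρ ^ T.2 ∨ x + 1 = 1 ∧ ρ ^ 3 ≤ ρ ^ T.2 := by
      rcases hT.2.2.2.1.eq_or_lt with h3 | h3
      · right
        rw [← h3] at hpow ⊢
        have : ((x + 1 : ℕ) : ℝ) < (2 : ℕ) := by
          push_cast at hpow ⊢
          linarith [fourthRootFive_cube_lt]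
        have := Nat.cast_lt.1 this
        exact ⟨by omega, le_rfl⟩
      · left
        rw [← fourthRootFive_pow_four]
        exact pow_le_pow_right₀ (by linarith [fourthRootFive_gt]) h3
    have hrec := ih hl (h.step (w := x + 1) (by omega) hpow hY')
    have hclosed : ∀ C ∈ (l ++ (l₁ ++ l₂)).map Prod.fst, PathClosed C := by
      simp only [List.mem_map, List.mem_append, forall_exists_index, and_imp]
      rintro _ S (hS | hS | hS) rfl
      · exact (hl S hS).pathClosed
      · exact (h₁ S hS).pathClosed
      · exact (h₂ S hS).pathClosed
    have c₀ := pickCount_zero_cons_le T.1 hclosed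
    have c₁ := pickCount_one_cons_le T.1 hclosed
    have c₂ := pickCount_two_cons_le T.1 ((l ++ (l₁ ++ l₂)).map Prod.fst)
    have c₃ := pickCount_three_cons_le T.1 ((l ++ (l₁ ++ l₂)).map Prod.fst)
    rw [hx, ← Nat.cast_le (α := ℝ)] at c₀ c₁ c₂ c₃
    push_cast at c₀ c₁ c₂ c₃ hrec
    have e₀ := mul_le_mul_of_nonneg_left c₀ h.a_nonneg
    have e₁ := mul_le_mul_of_nonneg_left c₁ (sub_nonneg.2 h.a_le)
    have e₂ := mul_le_mul_of_nonneg_left c₂ (sub_nonneg.2 h.b_le)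
    have e₃ := mul_le_mul_of_nonneg_left c₃ h.q_nonneg
    have e : ρ ^ (T.2 + ((l ++ (l₁ ++ l₂)).map Prod.snd).sum + 1) * X =
        ρ ^ (((l ++ (l₁ ++ l₂)).map Prod.snd).sum + 1) * (X * ρ ^ T.2) := by ring
    simp only [List.cons_append, List.map_cons, List.sum_cons]
    rw [e]
    linarith

/-- The three kinds of items. -/
def IsItem (T : Finset ℕ × ℕ) : Prop := IsTallItem T ∨ IsStarItem T ∨ IsLeafItem T

theorem card_pick_le {l : List (Finset ℕ × ℕ)} (hl : ∀ T ∈ l, IsItem T) :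
    ((pick ∅ (l.map Prod.fst)).card : ℝ) ≤ ρ ^ ((l.map Prod.snd).sum + 1) := by
  classical
  obtain ⟨l₀, l₁, l₂, hperm, h₀, h₁, h₂⟩ : ∃ l₀ l₁ l₂ : List (Finset ℕ × ℕ),
      (l₀ ++ (l₁ ++ l₂)).Perm l ∧ (∀ T ∈ l₀, IsTallItem T) ∧ (∀ T ∈ l₁, IsStarItem T) ∧
        ∀ T ∈ l₂, IsLeafItem T := by
    let s := l.filter fun T => !decide (IsTallItem T)
    refine ⟨l.filter fun T => IsTallItem T, s.filter fun T => IsStarItem T,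
      s.filter fun T => !decide (IsStarItem T),
      ((List.filter_append_perm _ s).append_left _).trans (List.filter_append_perm _ l), ?_, ?_, ?_⟩
    · simp
    · simp
    · intro T hT
      simp only [s, List.mem_filter, Bool.not_eq_true', decide_eq_false_iff_not] at hT
      rcases hl T hT.1.1 with h | h | h
      · exact absurd h hT.1.2
      · exact absurd h hT.2
      · exact h
  have h := pickCount_tall_stars_leaves_le h₀ h₁ h₂ tallBounds_one
  rw [(hperm.map Prod.snd).sum_eq] at h
  rw [← pick_perm ∅ (hperm.map Prod.fst)]
  simpa [pickCount, pathExcluded] using h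

/-- The item of the rooted tree whose branches at the root have the items in `l`. -/
def joinItems (l : List (Finset ℕ × ℕ)) : Finset ℕ × ℕ :=
  ((pick ∅ (l.map Prod.fst)).image treeCode, (l.map Prod.snd).sum + 1)

theorem card_joinItems (l : List (Finset ℕ × ℕ)) :
    (joinItems l).1.card = (pick ∅ (l.map Prod.fst)).card :=
  Finset.card_image_of_injective _ treeCode_injective

theorem pathCode_zero_mem_joinItems (l : List (Finset ℕ × ℕ)) :
    pathCode 0 ∈ (joinItems l).1 :=
  Finset.mem_image_of_mem _ (zero_mem_pick _ _)

theorem pathCode_succ_mem_joinItems {l : List (Finset ℕ × ℕ)} {n : ℕ} :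
    pathCode (n + 1) ∈ (joinItems l).1 ↔ ∃ T ∈ l, pathCode n ∈ T.1 := by
  constructor
  · intro h
    obtain ⟨m, hm, he⟩ := Finset.mem_image.1 h
    rw [treeCode_injective he] at hm
    obtain ⟨C, hC, h⟩ := exists_mem_of_mem_pick hm (Multiset.mem_singleton_self _)
    obtain ⟨T, hT, rfl⟩ := List.mem_map.1 hC
    exact ⟨T, hT, h⟩
  · rintro ⟨T, hT, h⟩
    exact Finset.mem_image_of_mem _ (singleton_mem_pick (List.mem_map_of_mem hT) h)

theorem IsItem.pathCode_zero_mem {T : Finset ℕ × ℕ} (h : IsItem T) : pathCode 0 ∈ T.1 := by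
  rcases h with h | h | h
  · exact h.1
  · exact h.1
  · simp [h.1]

theorem isItem_joinItems {l : List (Finset ℕ × ℕ)} (hl : ∀ T ∈ l, IsItem T) :
    IsItem (joinItems l) := by
  by_cases hleaf : ∀ T ∈ l, IsLeafItem T
  · rcases eq_or_ne l [] with rfl | hne
    · exact Or.inr (Or.inr ⟨by simp [joinItems, pick, pathCode], by simp [joinItems]⟩)
    · obtain ⟨T, hT⟩ := List.exists_mem_of_ne_nil l hne
      have hpos : 0 < l.length := List.length_pos_of_mem hT
      have h01 : pickCount 0 (l.map Prod.fst) = pickCount 1 (l.map Prod.fst) := by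
        apply pickCount_zero_eq_one
        simp only [List.mem_map, forall_exists_index, and_imp]
        rintro _ S hS rfl
        simp [(hleaf S hS).1, pathCode_two_ne_zero]
      have hcard := pickCount_two_leaves hleaf
      rw [← pickCount_one_leaves hleaf, ← h01] at hcard
      refine Or.inr (Or.inl ⟨pathCode_zero_mem_joinItems l, pathCode_succ_mem_joinItems.2
        ⟨T, hT, (hl T hT).pathCode_zero_mem⟩, fun h => ?_, ?_, ?_⟩)
      · obtain ⟨S, hS, h⟩ := pathCode_succ_mem_joinItems.1 h
        simp [(hleaf S hS).1, pathCode_one_ne_zero] at h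
      · simp only [joinItems, sum_snd_leaves hleaf]
        omega
      · rw [card_joinItems]
        simp only [joinItems, sum_snd_leaves hleaf]
        exact hcard
  · push Not at hleaf
    obtain ⟨T, hT, hTl⟩ := hleaf
    have hT' : pathCode 1 ∈ T.1 ∧ 2 ≤ T.2 := by
      rcases hl T hT with h | h | h
      · exact ⟨h.2.1, by have := h.2.2.2.1; omega⟩
      · exact ⟨h.2.1, h.2.2.2.1⟩
      · exact absurd h hTl
    refine Or.inl ⟨pathCode_zero_mem_joinItems l, pathCode_succ_mem_joinItems.2
      ⟨T, hT, (hl T hT).pathCode_zero_mem⟩, pathCode_succ_mem_joinItems.2 ⟨T, hT, hT'.1⟩, ?_, ?_⟩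
    · have := List.single_le_sum (l := l.map Prod.snd) (by simp) T.2 (List.mem_map_of_mem hT)
      simp only [joinItems]
      omega
    · rw [card_joinItems]
      exact card_pick_le hl

theorem card_joinItems_le {l : List (Finset ℕ × ℕ)} (hl : ∀ T ∈ l, IsItem T) :
    ((joinItems l).1.card : ℝ) ≤ ρ ^ (joinItems l).2 := by
  rw [card_joinItems]
  exact card_pick_le hl

theorem coe_map_filter_mem_pick {V : Type*} {C : V → Finset ℕ} {g : V → ℕ} {l : List V}
    (p : V → Bool) (hg : ∀ v ∈ l, g v ∈ C v) :
    (((l.filter p).map g : List ℕ) : Multiset ℕ) ∈ pick ∅ (l.map C) := by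
  induction l with
  | nil => simp [pick]
  | cons v l ih =>
    have h := ih fun w hw => hg w (List.mem_cons_of_mem _ hw)
    rw [List.map_cons, mem_pick_cons]
    by_cases hp : p v
    · right
      refine ⟨g v, hg v List.mem_cons_self, by simp, _, h, ?_⟩
      simp [hp]
    · left
      simpa [hp] using h

/-- A map sending each vertex other than the root `r` to a vertex closer to `r`. -/
structure ParentMap_s6 {V : Type*} (r : V) where
  /-- The parent of a vertex. -/
  par : V → V
  /-- The distance to the root. -/
  depth : V → ℕ
  depth_root : depth r = 0
  depth_par : ∀ v, v ≠ r → depth v = depth (par v) + 1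

namespace ParentMap_s6

open Classical in
/-- The vertices with parent `v`. -/
noncomputable def children {V : Type*} [Fintype V] {r : V} (P : ParentMap_s6 r) (v : V) : Finset V :=
  Finset.univ.filter fun w => w ≠ r ∧ P.par w = v

variable {V : Type*} [Fintype V] {r : V} (P : ParentMap_s6 r)

theorem mem_children {v w : V} : w ∈ P.children v ↔ w ≠ r ∧ P.par w = v := by
  simp [children]

/-- The item of the branch at `v`, truncated to `n` levels below `v`. -/
noncomputable def item : ℕ → V → Finset ℕ × ℕ
  | 0, _ => joinItems []
  | n + 1, v => joinItems ((P.children v).toList.map (item n))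

theorem isItem_item (n : ℕ) (v : V) : IsItem (P.item n v) := by
  induction n generalizing v with
  | zero => exact isItem_joinItems (by simp)
  | succ n ih =>
    refine isItem_joinItems ?_
    simp only [List.mem_map, forall_exists_index, and_imp]
    rintro _ w - rfl
    exact ih w

theorem card_item_le (n : ℕ) (v : V) : ((P.item n v).1.card : ℝ) ≤ ρ ^ (P.item n v).2 := by
  cases n with
  | zero => exact card_joinItems_le (by simp)
  | succ n =>
    refine card_joinItems_le ?_
    simp only [List.mem_map, forall_exists_index, and_imp]
    rintro _ w - rfl
    exact P.isItem_item n w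

theorem item_succ_snd (n : ℕ) (v : V) :
    (P.item (n + 1) v).2 = ∑ w ∈ P.children v, (P.item n w).2 + 1 := by
  simp [item, joinItems, ← Finset.sum_map_toList, Function.comp_def]

theorem sum_item_snd_le (n d : ℕ) :
    ∑ v with P.depth v = d, (P.item n v).2 ≤ (Finset.univ.filter fun v => d ≤ P.depth v).card := by
  classical
  induction n generalizing d with
  | zero =>
    simp only [item, joinItems, List.map_nil, List.sum_nil, zero_add, Finset.sum_const, smul_eq_mul,
      mul_one]
    exact Finset.card_le_card fun v => by simp +contextual
  | succ n ih =>
    simp only [item_succ_snd, Finset.sum_add_distrib, Finset.sum_const, smul_eq_mul, mul_one]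
    have h : ∑ v with P.depth v = d, ∑ w ∈ P.children v, (P.item n w).2 =
        ∑ w with P.depth w = d + 1, (P.item n w).2 := by
      rw [← Finset.sum_fiberwise_of_maps_to (s := Finset.univ.filter fun w => P.depth w = d + 1)
        (t := Finset.univ.filter fun v => P.depth v = d) (g := P.par)]
      · refine Finset.sum_congr rfl fun v hv => Finset.sum_congr ?_ fun _ _ => rfl
        have hv : P.depth v = d := by simpa using hv
        ext w
        simp only [mem_children, Finset.mem_filter, Finset.mem_univ, true_and]
        constructor
        · rintro ⟨hw, rfl⟩
          exact ⟨by rw [P.depth_par w hw, hv], rfl⟩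
        · rintro ⟨hw, rfl⟩
          refine ⟨fun h => ?_, rfl⟩
          rw [h, P.depth_root] at hw
          omega
      · intro w hw
        have hw : P.depth w = d + 1 := by simpa using hw
        have hwr : w ≠ r := fun h => by
          rw [h, P.depth_root] at hw
          omega
        have := P.depth_par w hwr
        simp only [Finset.mem_filter, Finset.mem_univ, true_and]
        omega
    rw [h]
    refine (Nat.add_le_add_right (ih (d + 1)) _).trans ?_
    rw [← Finset.card_union_of_disjoint]
    · refine Finset.card_le_card fun v => ?_
      simp only [Finset.mem_union, Finset.mem_filter, Finset.mem_univ, true_and]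
      omega
    · rw [Finset.disjoint_left]
      intro v
      simp only [Finset.mem_filter, Finset.mem_univ, true_and]
      omega

theorem item_root_snd_le (n : ℕ) : (P.item n r).2 ≤ Fintype.card V :=
  calc (P.item n r).2 ≤ ∑ v with P.depth v = 0, (P.item n v).2 :=
        Finset.single_le_sum (f := fun v => (P.item n v).2) (fun _ _ => Nat.zero_le _)
          (by simp [P.depth_root])
    _ ≤ _ := P.sum_item_snd_le n 0
    _ ≤ Fintype.card V := Finset.card_le_univ _

open Classical in
/-- The children of `v` in `S`. -/
noncomputable def childrenIn (S : Set V) (v : V) : Finset V := (P.children v).filter (· ∈ S)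

theorem mem_childrenIn {S : Set V} {v w : V} :
    w ∈ P.childrenIn S v ↔ (w ≠ r ∧ P.par w = v) ∧ w ∈ S := by
  simp [childrenIn, mem_children]

/-- The code of the part of `S` in the branch at `v`, truncated to `n` levels below `v`. -/
noncomputable def code (S : Set V) : ℕ → V → ℕ
  | 0, _ => treeCode 0
  | n + 1, v => treeCode ((P.childrenIn S v).val.map (code S n))

theorem code_mem_item (S : Set V) (n : ℕ) (v : V) : P.code S n v ∈ (P.item n v).1 := by
  classical
  induction n generalizing v with
  | zero => exact Finset.mem_image_of_mem _ (zero_mem_pick _ _)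
  | succ n ih =>
    refine Finset.mem_image_of_mem _ ?_
    rw [List.map_map, childrenIn, Finset.filter_val, ← Finset.coe_toList, Multiset.filter_coe,
      Multiset.map_coe]
    exact coe_map_filter_mem_pick _ fun w _ => ih w

theorem exists_children_matching {S T : Set V} {n : ℕ} {v v' : V}
    (h : P.code S (n + 1) v = P.code T (n + 1) v') :
    ∃ σ τ : V → V,
      (∀ w ∈ P.childrenIn S v,
        σ w ∈ P.childrenIn T v' ∧ P.code S n w = P.code T n (σ w) ∧ τ (σ w) = w) ∧
      ∀ w ∈ P.childrenIn T v', τ w ∈ P.childrenIn S v ∧ σ (τ w) = w := by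
  classical
  have hm := treeCode_injective h
  have hfib : ∀ c, Nonempty ({w : P.childrenIn S v // P.code S n w = c} ≃
      {w : P.childrenIn T v' // P.code T n w = c}) := by
    intro c
    have hcount : ∀ (S : Set V) (v : V),
        Fintype.card {w : P.childrenIn S v // P.code S n w = c} =
          ((P.childrenIn S v).val.map (P.code S n)).count c := by
      intro S v
      rw [Multiset.count_map, Fintype.card_subtype, ← Finset.card_val, Finset.univ_eq_attach,
        Finset.filter_attach (fun w => P.code S n w = c), Finset.card_val, Finset.card_map,
        Finset.card_attach, ← Finset.card_val, Finset.filter_val]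
      simp only [eq_comm]
    exact Fintype.card_eq.1 (by rw [hcount, hcount, hm])
  let e := Equiv.ofFiberEquiv (f := fun w : P.childrenIn S v => P.code S n w)
    (g := fun w : P.childrenIn T v' => P.code T n w) fun c => (hfib c).some
  have he : ∀ w, P.code T n (e w) = P.code S n w := fun w =>
    Equiv.ofFiberEquiv_map (f := fun w : P.childrenIn S v => P.code S n w)
      (g := fun w : P.childrenIn T v' => P.code T n w) (fun c => (hfib c).some) w
  refine ⟨fun w => if hw : w ∈ P.childrenIn S v then e ⟨w, hw⟩ else w,
    fun w => if hw : w ∈ P.childrenIn T v' then e.symm ⟨w, hw⟩ else w, ?_, ?_⟩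
  · intro w hw
    simp [hw, he]
  · intro w hw
    simp [hw]

/-- Equal codes come from a bijection compatible with parents. -/
theorem exists_matching {S T : Set V} (hrS : r ∈ S) (hrT : r ∈ T)
    (hS : ∀ v ∈ S, v ≠ r → P.par v ∈ S) (hT : ∀ v ∈ T, v ≠ r → P.par v ∈ T)
    {n : ℕ} (hn : ∀ v, P.depth v ≤ n) (h : P.code S n r = P.code T n r) :
    ∃ f g : V → V, f r = r ∧ g r = r ∧
      (∀ v ∈ S, f v ∈ T ∧ g (f v) = v ∧ (v ≠ r → f v ≠ r ∧ P.par (f v) = f (P.par v))) ∧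
      ∀ v ∈ T, g v ∈ S ∧ f (g v) = v ∧ (v ≠ r → g v ≠ r ∧ P.par (g v) = g (P.par v)) := by
  classical
  have hmatch : ∀ (k : ℕ) (v v' : V), ∃ σ τ : V → V,
      P.code S (k + 1) v = P.code T (k + 1) v' →
      (∀ w ∈ P.childrenIn S v,
        σ w ∈ P.childrenIn T v' ∧ P.code S k w = P.code T k (σ w) ∧ τ (σ w) = w) ∧
      ∀ w ∈ P.childrenIn T v', τ w ∈ P.childrenIn S v ∧ σ (τ w) = w := by
    intro k v v'
    by_cases h : P.code S (k + 1) v = P.code T (k + 1) v'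
    · obtain ⟨σ, τ, h'⟩ := P.exists_children_matching h
      exact ⟨σ, τ, fun _ => h'⟩
    · exact ⟨id, id, fun h' => absurd h' h⟩
  choose σ τ hστ using hmatch
  let F : ℕ → V → V := fun d => d.rec (fun _ => r)
    fun d F v => σ (n - (d + 1)) (P.par v) (F (P.par v)) v
  let G : ℕ → V → V := fun d => d.rec (fun _ => r)
    fun d G v => τ (n - (d + 1)) (G (P.par v)) (P.par v) v
  have root_of_depth : ∀ v, P.depth v = 0 → v = r := by
    intro v hv
    by_contra hne
    have := P.depth_par v hne
    omega
  have ne_root : ∀ {v d}, P.depth v = d + 1 → v ≠ r := by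
    rintro v d hv rfl
    rw [P.depth_root] at hv
    omega
  have hF : ∀ d v, v ∈ S → P.depth v = d →
      F d v ∈ T ∧ P.depth (F d v) = d ∧ P.code S (n - d) v = P.code T (n - d) (F d v) ∧
        G d (F d v) = v ∧ (v ≠ r → F d v ≠ r ∧ P.par (F d v) = F (d - 1) (P.par v)) := by
    intro d
    induction d with
    | zero =>
      intro v hv hd
      obtain rfl := root_of_depth v hd
      exact ⟨hrT, P.depth_root, h, rfl, fun h => absurd rfl h⟩
    | succ d ih =>
      intro v hv hd
      have hvr := ne_root hd
      have hdp : P.depth (P.par v) = d := by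
        have := P.depth_par v hvr
        omega
      obtain ⟨-, i₂, i₃, i₄, -⟩ := ih (P.par v) (hS v hv hvr) hdp
      have hnd : n - d = n - (d + 1) + 1 := by
        have := hn v
        omega
      rw [hnd] at i₃
      obtain ⟨j₁, j₂, j₃⟩ := (hστ _ _ _ i₃).1 v (P.mem_childrenIn.2 ⟨⟨hvr, rfl⟩, hv⟩)
      obtain ⟨⟨k₁, k₂⟩, k₃⟩ := P.mem_childrenIn.1 j₁
      refine ⟨k₃, ?_, j₂, ?_, fun _ => ⟨k₁, k₂⟩⟩
      · change P.depth (σ _ _ _ v) = _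
        rw [P.depth_par _ k₁, k₂, i₂]
      · change τ (n - (d + 1)) (G d (P.par (σ _ _ _ v))) (P.par (σ _ _ _ v)) (σ _ _ _ v) = v
        rw [k₂, i₄, j₃]
  have hG : ∀ d v, v ∈ T → P.depth v = d →
      G d v ∈ S ∧ P.depth (G d v) = d ∧ P.code S (n - d) (G d v) = P.code T (n - d) v ∧
        F d (G d v) = v ∧ (v ≠ r → G d v ≠ r ∧ P.par (G d v) = G (d - 1) (P.par v)) := by
    intro d
    induction d with
    | zero =>
      intro v hv hd
      obtain rfl := root_of_depth v hd
      exact ⟨hrS, P.depth_root, h, rfl, fun h => absurd rfl h⟩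
    | succ d ih =>
      intro v hv hd
      have hvr := ne_root hd
      have hdp : P.depth (P.par v) = d := by
        have := P.depth_par v hvr
        omega
      obtain ⟨-, i₂, i₃, i₄, -⟩ := ih (P.par v) (hT v hv hvr) hdp
      have hnd : n - d = n - (d + 1) + 1 := by
        have := hn v
        omega
      rw [hnd] at i₃
      obtain ⟨j₁, j₃⟩ := (hστ _ _ _ i₃).2 v (P.mem_childrenIn.2 ⟨⟨hvr, rfl⟩, hv⟩)
      have j₂ := ((hστ _ _ _ i₃).1 _ j₁).2.1
      rw [j₃] at j₂
      obtain ⟨⟨k₁, k₂⟩, k₃⟩ := P.mem_childrenIn.1 j₁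
      refine ⟨k₃, ?_, j₂, ?_, fun _ => ⟨k₁, k₂⟩⟩
      · change P.depth (τ _ _ _ v) = _
        rw [P.depth_par _ k₁, k₂, i₂]
      · change σ (n - (d + 1)) (P.par (τ _ _ _ v)) (F d (P.par (τ _ _ _ v))) (τ _ _ _ v) = v
        rw [k₂, i₄, j₃]
  refine ⟨fun v => F (P.depth v) v, fun v => G (P.depth v) v, ?_, ?_, ?_, ?_⟩
  · simp only [P.depth_root]; rfl
  · simp only [P.depth_root]; rfl
  · intro v hv
    obtain ⟨a₁, a₂, -, a₄, a₅⟩ := hF _ v hv rfl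
    refine ⟨a₁, by simpa only [a₂] using a₄, fun hvr => ⟨(a₅ hvr).1, ?_⟩⟩
    rw [(a₅ hvr).2, P.depth_par v hvr, Nat.add_sub_cancel]
  · intro v hv
    obtain ⟨a₁, a₂, -, a₄, a₅⟩ := hG _ v hv rfl
    refine ⟨a₁, by simpa only [a₂] using a₄, fun hvr => ⟨(a₅ hvr).1, ?_⟩⟩
    rw [(a₅ hvr).2, P.depth_par v hvr, Nat.add_sub_cancel]

end ParentMap_s6

theorem SimpleGraph.IsTree.exists_parentMap {V : Type*} {G : SimpleGraph V} (hG : G.IsTree)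
    (r : V) : ∃ P : ParentMap_s6 r, ∀ (v : V) (q : G.Walk v r), q.IsPath →
      q.snd = P.par v ∧ q.length = P.depth v := by
  choose p hp hu using fun v => hG.existsUnique_path v r
  refine ⟨⟨fun v => (p v).snd, fun v => (p v).length, ?_, ?_⟩, ?_⟩
  · rw [← hu r .nil .nil, Walk.length_nil]
  · intro v hv
    have hnil : ¬ (p v).Nil := Walk.not_nil_of_ne hv
    rw [← hu _ _ (hp v).tail, Walk.length_tail_add_one hnil]
  · intro v q hq
    rw [hu v q hq]
    exact ⟨rfl, rfl⟩

section Tree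

variable {V : Type*} {G : SimpleGraph V} {r : V} {P : ParentMap_s6 r}

theorem adj_iff_par (hG : G.IsTree)
    (hP : ∀ (v : V) (q : G.Walk v r), q.IsPath → q.snd = P.par v ∧ q.length = P.depth v)
    {u v : V} : G.Adj u v ↔ (u ≠ r ∧ P.par u = v) ∨ (v ≠ r ∧ P.par v = u) := by
  have key : ∀ {u v : V}, u ≠ r → P.par u = v → G.Adj u v := by
    rintro u _ hu rfl
    obtain ⟨p, hp, -⟩ := hG.existsUnique_path u r
    rw [← (hP u p hp).1]
    exact p.adj_snd (Walk.not_nil_of_ne hu)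
  refine ⟨fun h => ?_, ?_⟩
  · obtain ⟨p, hp, -⟩ := hG.existsUnique_path u r
    by_cases hv : v ∈ p.support
    · refine Or.inl ⟨?_, ?_⟩
      · rintro rfl
        rw [Walk.eq_nil_iff_nil.2 (Walk.isPath_iff_nil.1 hp), Walk.support_nil,
          List.mem_singleton] at hv
        exact h.ne hv.symm
      · rw [← (hP u p hp).1, hG.isAcyclic.eq_snd_of_adj_start hp h hv]
    · refine Or.inr ⟨fun hvr => hv (hvr ▸ p.end_mem_support), ?_⟩
      rw [← (hP v (.cons h.symm p) (hp.cons hv)).1, Walk.snd_cons]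
  · rintro (⟨hu, h⟩ | ⟨hv, h⟩)
    · exact key hu h
    · exact (key hv h).symm

theorem par_mem_of_connected
    (hP : ∀ (v : V) (q : G.Walk v r), q.IsPath → q.snd = P.par v ∧ q.length = P.depth v)
    {S : Set V} (hr : r ∈ S) (hS : (G.induce S).Connected) {v : V} (hv : v ∈ S) :
    P.par v ∈ S := by
  obtain ⟨p, hp⟩ := (hS ⟨v, hv⟩ ⟨r, hr⟩).exists_isPath
  have hq := hp.map (f := (Embedding.induce S).toHom) (Embedding.induce (G := G) S).injective
  rw [← (hP v _ hq).1]
  have : (p.map (Embedding.induce S).toHom).snd ∈ (p.map (Embedding.induce S).toHom).support :=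
    Walk.getVert_mem_support _ _
  rw [Walk.support_map, List.mem_map] at this
  obtain ⟨w, -, hw⟩ := this
  exact hw ▸ w.2

theorem rootedSubtreeIso_of_code_eq [Fintype V] (hG : G.IsTree)
    (hP : ∀ (v : V) (q : G.Walk v r), q.IsPath → q.snd = P.par v ∧ q.length = P.depth v)
    (S T : RootedSubtree G r)
    (h : P.code S.1 (Fintype.card V) r = P.code T.1 (Fintype.card V) r) :
    RootedSubtreeIso G r S T := by
  have hn : ∀ v, P.depth v ≤ Fintype.card V := by
    intro v
    obtain ⟨p, hp, -⟩ := hG.existsUnique_path v r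
    rw [← (hP v p hp).2]
    exact hp.length_lt.le
  have hS := fun v => par_mem_of_connected hP S.2.1 S.2.2 (v := v)
  have hT := fun v => par_mem_of_connected hP T.2.1 T.2.2 (v := v)
  obtain ⟨f, g, hf, -, hfS, hgT⟩ := P.exists_matching S.2.1 T.2.1 (fun v hv _ => hS v hv)
    (fun v hv _ => hT v hv) hn h
  have hpar : ∀ u ∈ S.1, ∀ v ∈ S.1,
      (f u ≠ r ∧ P.par (f u) = f v) ↔ (u ≠ r ∧ P.par u = v) := by
    intro u hu v hv
    have hur : f u ≠ r ↔ u ≠ r := by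
      refine ⟨?_, fun hur => ((hfS u hu).2.2 hur).1⟩
      rintro h rfl
      exact h hf
    rw [hur]
    refine and_congr_right fun hu' => ?_
    rw [((hfS u hu).2.2 hu').2]
    refine ⟨fun h => ?_, fun h => h ▸ rfl⟩
    rw [← (hfS _ (hS u hu)).2.1, h, (hfS v hv).2.1]
  refine ⟨⟨⟨fun v => ⟨f v, (hfS v v.2).1⟩, fun v => ⟨g v, (hgT v v.2).1⟩,
    fun v => Subtype.ext (hfS v v.2).2.1, fun v => Subtype.ext (hgT v v.2).2.1⟩, ?_⟩,
    Subtype.ext hf⟩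
  rintro ⟨u, hu⟩ ⟨v, hv⟩
  simp only [Equiv.coe_fn_mk, comap_adj, Function.Embedding.subtype_apply]
  rw [adj_iff_par hG hP, adj_iff_par hG hP, hpar u hu v hv, hpar v hv u hu]

theorem nr_le_card_item [Fintype V] (hG : G.IsTree)
    (hP : ∀ (v : V) (q : G.Walk v r), q.IsPath → q.snd = P.par v ∧ q.length = P.depth v) :
    nr G r ≤ (P.item (Fintype.card V) r).1.card := by
  let c : Quot (RootedSubtreeIso G r) → (P.item (Fintype.card V) r).1 :=
    fun q => ⟨P.code q.out.1 (Fintype.card V) r, P.code_mem_item _ _ _⟩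
  have hc : Function.Injective c := by
    intro q q' h
    rw [← Quot.out_eq q, ← Quot.out_eq q']
    exact Quot.sound (rootedSubtreeIso_of_code_eq hG hP _ _ (congrArg Subtype.val h))
  simpa [nr] using Nat.card_le_card_of_injective c hc

end Tree

theorem nr_le_rpow {V : Type*} [Fintype V] {G : SimpleGraph V} (hG : G.IsTree) (r : V) :
    (nr G r : ℝ) ≤ (5 : ℝ) ^ ((Fintype.card V : ℝ) / 4) := by
  obtain ⟨P, hP⟩ := hG.exists_parentMap r
  calc (nr G r : ℝ) ≤ (P.item (Fintype.card V) r).1.card := mod_cast nr_le_card_item hG hP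
    _ ≤ ρ ^ (P.item (Fintype.card V) r).2 := P.card_item_le _ _
    _ ≤ ρ ^ Fintype.card V :=
      pow_le_pow_right₀ (by linarith [fourthRootFive_gt]) (P.item_root_snd_le _)
    _ = _ := fourthRootFive_pow _

/-- For every rooted tree `T` with `n` vertices, `nr T ≤ 5 ^ (n/4)`;
equivalently `R_n ≤ 5 ^ (n/4)` for all `n ≥ 1`. -/
theorem nr_le_five_pow :
    (∀ (V : Type) [Fintype V] (G : SimpleGraph V) (r : V), G.IsTree →
      (nr G r : ℝ) ≤ (5 : ℝ) ^ ((Fintype.card V : ℝ) / 4)) ∧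
    ∀ n : ℕ, 1 ≤ n → (maxNR n : ℝ) ≤ (5 : ℝ) ^ ((n : ℝ) / 4) := by
  refine ⟨fun V _ G r hG => nr_le_rpow hG r, fun n _ => ?_⟩
  have hbound : ∀ k ∈ {k | ∃ (G : SimpleGraph (Fin n)) (r : Fin n), G.IsTree ∧ nr G r = k},
      (k : ℝ) ≤ (5 : ℝ) ^ ((n : ℝ) / 4) := by
    rintro _ ⟨G, r, hG, rfl⟩
    simpa using nr_le_rpow hG r
  rw [maxNR]
  rcases Set.eq_empty_or_nonempty
    {k | ∃ (G : SimpleGraph (Fin n)) (r : Fin n), G.IsTree ∧ nr G r = k} with h | h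
  · rw [h, csSup_empty]
    simp only [Nat.bot_eq_zero, Nat.cast_zero]
    positivity
  · exact hbound _ (Nat.sSup_mem h ⟨_, fun k hk => Nat.le_floor (hbound k hk)⟩)
end

section
/- For every rooted tree T with n ≥ 8 vertices, nr(T) ≤ 5^{n/4} − 1. -/
open SimpleGraph

/-- Finite plane forests in the first-child / next-sibling encoding: `cons a b` is the forest whose
first tree has the trees of `a` below its root, followed by the forest `b`.
A rooted tree is represented by the forest of its branches at the root. -/
inductive PlaneForest : Type
  | nil : PlaneForest
  | cons (a b : PlaneForest) : PlaneForest
  deriving DecidableEq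

namespace PlaneForest

/-- The number of vertices of a forest. -/
def size : PlaneForest → ℕ
  | nil => 0
  | cons a b => 1 + size a + size b

/-- Concatenation of forests. -/
def append : PlaneForest → PlaneForest → PlaneForest
  | nil, g => g
  | cons a b, g => cons a (append b g)

/-- Two plane forests are equivalent if they differ by reordering siblings. -/
inductive Equivalent : PlaneForest → PlaneForest → Prop
  | refl (f : PlaneForest) : Equivalent f f
  | swap (a b c : PlaneForest) : Equivalent (cons a (cons b c)) (cons b (cons a c))
  | congr {a a' b b' : PlaneForest} : Equivalent a a' → Equivalent b b' →
      Equivalent (cons a b) (cons a' b')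
  | trans {f g h : PlaneForest} : Equivalent f g → Equivalent g h → Equivalent f h

theorem Equivalent.symm {f g : PlaneForest} (h : Equivalent f g) : Equivalent g f := by
  induction h with
  | refl f => exact .refl f
  | swap a b c => exact .swap b a c
  | congr _ _ iha ihb => exact .congr iha ihb
  | trans _ _ ih₁ ih₂ => exact .trans ih₂ ih₁

/-- The Matula number of a forest. -/
noncomputable def matula : PlaneForest → ℕ
  | nil => 1
  | cons a b => Nat.nth Nat.Prime (matula a - 1) * matula b

theorem matula_pos (f : PlaneForest) : 0 < matula f := by
  induction f with
  | nil => simp [matula]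
  | cons a b _ ihb => exact Nat.mul_pos (Nat.prime_nth_prime _).pos ihb

theorem exists_cons_of_prime_dvd_matula (g : PlaneForest) {p : ℕ} (hp : p.Prime)
    (h : p ∣ matula g) :
    ∃ c d, Equivalent g (cons c d) ∧ Nat.nth Nat.Prime (matula c - 1) = p := by
  induction g with
  | nil => simp [matula, hp.ne_one] at h
  | cons c d _ ihd =>
    rcases (hp.dvd_mul).1 h with h | h
    · exact ⟨c, d, .refl _, ((Nat.prime_dvd_prime_iff_eq hp (Nat.prime_nth_prime _)).1 h).symm⟩
    · obtain ⟨c', d', e, hc⟩ := ihd h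
      exact ⟨c', cons c d', (Equivalent.congr (.refl c) e).trans (.swap _ _ _), hc⟩

theorem Equivalent.matula_eq {f g : PlaneForest} (h : Equivalent f g) :
    matula f = matula g := by
  induction h with
  | refl f => rfl
  | swap a b c => simp only [matula]; ring
  | congr _ _ iha ihb => simp only [matula, iha, ihb]
  | trans _ _ ih₁ ih₂ => exact ih₁.trans ih₂

theorem equivalent_of_matula_eq {f g : PlaneForest} (h : matula f = matula g) :
    Equivalent f g := by
  induction f generalizing g with
  | nil =>
    cases g with
    | nil => exact .refl _
    | cons c d =>
      have := (Nat.prime_nth_prime (matula c - 1)).one_lt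
      have := matula_pos d
      simp only [matula] at h
      nlinarith
  | cons a b iha ihb =>
    have hp := Nat.prime_nth_prime (matula a - 1)
    obtain ⟨c, d, e, hc⟩ := exists_cons_of_prime_dvd_matula g hp (h ▸ Dvd.intro _ rfl)
    have hac : matula a = matula c := by
      have := Nat.nth_injective Nat.infinite_setOfPred_prime hc
      have := matula_pos a
      have := matula_pos c
      lia
    rw [e.matula_eq] at h
    simp only [matula, hc] at h
    exact (Equivalent.congr (iha hac) (ihb (Nat.eq_of_mul_eq_mul_left hp.pos h))).trans e.symm

theorem Equivalent.size_eq {f g : PlaneForest} (h : Equivalent f g) : size f = size g := by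
  induction h with
  | refl f => rfl
  | swap a b c => simp only [size]; ring
  | congr _ _ iha ihb => simp only [size, iha, ihb]
  | trans _ _ ih₁ ih₂ => exact ih₁.trans ih₂

/-- The Matula numbers of the rooted subtrees of the rooted tree with branches `f`. -/
noncomputable def subtrees : PlaneForest → Finset ℕ
  | nil => {1}
  | cons a b => subtrees b ∪
      Finset.image₂ (fun x y => Nat.nth Nat.Prime (x - 1) * y) (subtrees a) (subtrees b)

theorem mem_subtrees_cons {a b : PlaneForest} {z : ℕ} :
    z ∈ subtrees (cons a b) ↔ z ∈ subtrees b ∨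
      ∃ x ∈ subtrees a, ∃ y ∈ subtrees b, Nat.nth Nat.Prime (x - 1) * y = z := by
  simp [subtrees, Finset.mem_image₂]

theorem Equivalent.subtrees_eq {f g : PlaneForest} (h : Equivalent f g) :
    subtrees f = subtrees g := by
  induction h with
  | refl f => rfl
  | congr _ _ iha ihb => simp only [subtrees, iha, ihb]
  | trans _ _ ih₁ ih₂ => exact ih₁.trans ih₂
  | swap a b c =>
    have key : ∀ a b, subtrees (cons a (cons b c)) ⊆ subtrees (cons b (cons a c)) := by
      intro a b z
      simp only [mem_subtrees_cons]
      rintro ((h | ⟨x, hx, y, hy, rfl⟩) | ⟨x, hx, y, hy | ⟨x', hx', y', hy', rfl⟩, rfl⟩)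
      · exact .inl (.inl h)
      · exact .inr ⟨x, hx, y, .inl hy, rfl⟩
      · exact .inl (.inr ⟨x, hx, y, hy, rfl⟩)
      · exact .inr ⟨x', hx', _, .inr ⟨x, hx, y', hy', rfl⟩, by ring⟩
    exact (key a b).antisymm (key b a)

theorem one_mem_subtrees (f : PlaneForest) : 1 ∈ subtrees f := by
  induction f with
  | nil => simp [subtrees]
  | cons a b _ ihb => exact mem_subtrees_cons.2 (.inl ihb)

theorem two_mem_subtrees {f : PlaneForest} (hf : 0 < size f) : 2 ∈ subtrees f := by
  cases f with
  | nil => simp [size] at hf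
  | cons a b =>
    exact mem_subtrees_cons.2 (.inr ⟨1, one_mem_subtrees a, 1, one_mem_subtrees b, by
      simp [Nat.nth_prime_zero_eq_two]⟩)

theorem size_append (f g : PlaneForest) : size (append f g) = size f + size g := by
  induction f with
  | nil => simp [append, size]
  | cons a b _ ihb => simp only [append, size, ihb]; ring

theorem subtrees_append (f g : PlaneForest) :
    subtrees (append f g) = Finset.image₂ (· * ·) (subtrees f) (subtrees g) := by
  induction f with
  | nil => ext; simp [append, subtrees]
  | cons a b _ ihb =>
    ext z
    simp only [append, mem_subtrees_cons, ihb, Finset.mem_image₂]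
    constructor
    · rintro (⟨y, hy, y', hy', rfl⟩ | ⟨x, hx, _, ⟨y, hy, y', hy', rfl⟩, rfl⟩)
      · exact ⟨y, .inl hy, y', hy', rfl⟩
      · exact ⟨_, .inr ⟨x, hx, y, hy, rfl⟩, y', hy', by ring⟩
    · rintro ⟨_, hy | ⟨x, hx, y, hy, rfl⟩, y', hy', rfl⟩
      · exact .inl ⟨_, hy, y', hy', rfl⟩
      · exact .inr ⟨x, hx, _, ⟨y, hy, y', hy', rfl⟩, by ring⟩

theorem card_subtrees_append_lt {f g : PlaneForest} (hf : 0 < size f) (hg : 0 < size g) :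
    (subtrees (append f g)).card < (subtrees f).card * (subtrees g).card := by
  rw [subtrees_append]
  refine (Finset.card_image₂_le _ _ _).lt_of_ne fun h => ?_
  have h₁ : ((1, 2) : ℕ × ℕ) ∈ (subtrees f ×ˢ subtrees g : Set (ℕ × ℕ)) :=
    ⟨one_mem_subtrees f, two_mem_subtrees hg⟩
  have h₂ : ((2, 1) : ℕ × ℕ) ∈ (subtrees f ×ˢ subtrees g : Set (ℕ × ℕ)) :=
    ⟨two_mem_subtrees hf, one_mem_subtrees g⟩
  have := Finset.card_image₂_iff.1 h h₁ h₂ (by simp)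
  simp at this

theorem Equivalent.append_right {f f' : PlaneForest} (h : Equivalent f f') (g : PlaneForest) :
    Equivalent (append f g) (append f' g) := by
  induction h with
  | refl f => exact .refl _
  | swap a b c => exact .swap _ _ _
  | congr ha _ _ ihb => exact .congr ha ihb
  | trans _ _ ih₁ ih₂ => exact .trans ih₁ ih₂

theorem equivalent_cons_append (a f g : PlaneForest) :
    Equivalent (cons a (append f g)) (append f (cons a g)) := by
  induction f with
  | nil => exact .refl _
  | cons b c _ ih => exact (Equivalent.swap _ _ _).trans (.congr (.refl _) ih)

/-- Merge two increasing lists, dropping duplicates. -/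
def mergeDedup (l₁ l₂ : List ℕ) : List ℕ :=
  List.rec (fun l => l)
    (fun a t ih l => List.rec (a :: t)
      (fun b l' ih' => bif Nat.blt a b then a :: ih (b :: l')
        else bif Nat.beq a b then a :: ih l' else b :: ih') l) l₁ l₂

theorem mem_mergeDedup {z : ℕ} (l₁ l₂ : List ℕ) (h : z ∈ l₁ ∨ z ∈ l₂) :
    z ∈ mergeDedup l₁ l₂ := by
  induction l₁ generalizing l₂ with
  | nil => simpa [mergeDedup] using h
  | cons a t ih =>
    induction l₂ with
    | nil => simpa [mergeDedup] using h
    | cons b l ih' =>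
      have e : mergeDedup (a :: t) (b :: l) = bif Nat.blt a b then a :: mergeDedup t (b :: l)
        else bif Nat.beq a b then a :: mergeDedup t l else b :: mergeDedup (a :: t) l := rfl
      rw [e]
      have h₁ := ih (b :: l)
      have h₂ := ih l
      cases hlt : Nat.blt a b
      · cases heq : Nat.beq a b
        · simp only [cond_false, List.mem_cons] at *
          tauto
        · have := Nat.eq_of_beq_eq_true heq
          subst this
          simp only [cond_false, cond_true, List.mem_cons] at *
          tauto
      · simp only [cond_true, List.mem_cons] at *
        tauto

/-- An initial segment of the list of primes. -/
def smallPrimes : List ℕ :=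
  [2, 3, 5, 7, 11, 13, 17, 19, 23, 29, 31, 37, 41, 43, 47, 53, 59, 61, 67, 71, 73, 79, 83, 89, 97,
    101, 103, 107, 109, 113, 127, 131, 137, 139, 149, 151, 157, 163, 167, 173, 179, 181, 191, 193,
    197, 199, 211, 223, 227, 229, 233, 239]

/-- The `n`-th prime, read off from a table when `n` is small. -/
noncomputable def nthPrime (n : ℕ) : ℕ :=
  List.rec (fun n => Nat.nth Nat.Prime (52 + n))
    (fun p _ ih n => Nat.rec p (fun m _ => ih m) n) smallPrimes n

theorem nthPrime_eq (n : ℕ) : nthPrime n = Nat.nth Nat.Prime n := by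
  have key : ∀ i < 52, Nat.Prime (nthPrime i) ∧ Nat.count Nat.Prime (nthPrime i) = i := by
    decide +kernel
  by_cases h : n < 52
  · obtain ⟨hp, hc⟩ := key n h
    conv_rhs => rw [← hc]
    exact (Nat.nth_count hp).symm
  · obtain ⟨m, rfl⟩ := Nat.exists_eq_add_of_le (not_lt.1 h)
    rw [Nat.add_comm]
    exact congrArg (Nat.nth Nat.Prime) (Nat.add_comm 52 m)

/-- A list containing the Matula numbers of the rooted subtrees of the tree with branches `f`. -/
noncomputable def subtreeList : PlaneForest → List ℕ
  | nil => [1]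
  | cons a b => (subtreeList a).foldr
      (fun x l => mergeDedup ((subtreeList b).map (nthPrime (x - 1) * ·)) l) (subtreeList b)

theorem subtrees_subset_subtreeList (f : PlaneForest) {z : ℕ} (hz : z ∈ subtrees f) :
    z ∈ subtreeList f := by
  induction f generalizing z with
  | nil => simpa [subtrees, subtreeList] using hz
  | cons a b iha ihb =>
    have key : ∀ l : List ℕ, (z ∈ subtreeList b ∨
        ∃ x ∈ l, ∃ y ∈ subtreeList b, Nat.nth Nat.Prime (x - 1) * y = z) →
        z ∈ l.foldr (fun x l => mergeDedup ((subtreeList b).map (nthPrime (x - 1) * ·)) l)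
          (subtreeList b) := by
      intro l
      induction l with
      | nil => simp
      | cons x l ih =>
        intro h
        apply mem_mergeDedup
        simp only [List.mem_map, List.exists_mem_cons_iff, nthPrime_eq] at h ⊢
        simp only [nthPrime_eq] at ih
        rcases h with h | h | h
        · exact .inr (ih (.inl h))
        · exact .inl h
        · exact .inr (ih (.inr h))
    apply key
    rcases mem_subtrees_cons.1 hz with h | ⟨x, hx, y, hy, e⟩
    · exact .inl (ihb h)
    · exact .inr ⟨x, iha hx, y, ihb hy, e⟩

theorem card_subtrees_le_length (f : PlaneForest) :
    (subtrees f).card ≤ (subtreeList f).length :=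
  (Finset.card_le_card fun _ hz =>
    List.mem_toFinset.2 (subtrees_subset_subtreeList f hz)).trans (List.toFinset_card_le _)

/-- The branches of the trees in `exceptional`, as positions in that list. -/
def exceptionalIndices : List (List ℕ) :=
  [[], [0], [0, 0], [1], [0, 1], [0, 0, 1], [0, 2], [0, 3], [0, 4], [0, 0, 4]]

/-- The forest whose trees are the given entries of a list `l`. -/
def ofIndices (l : List PlaneForest) (is : List ℕ) : PlaneForest :=
  is.foldr (fun i f => cons (l.getD i nil) f) nil

/-- The trees with too many rooted subtrees: those violating the bound of
`card_subtrees_bound_or_exceptional`. -/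
def exceptional : List PlaneForest :=
  exceptionalIndices.foldl (fun l is => l ++ [ofIndices l is]) []

/-- Nonempty multisets of exceptional trees with at most `5 ^ (size / 4)` rooted subtrees. -/
def reducible : List (List ℕ) :=
  [[2, 2], [3, 3], [4, 4], [4, 5], [4, 6], [4, 7], [5, 5], [5, 6], [5, 7], [5, 8], [5, 9],
  [6, 6], [6, 7], [6, 8], [6, 9], [7, 7], [7, 8], [7, 9], [8, 8], [8, 9], [9, 9], [1, 1, 1],
  [1, 1, 2], [1, 1, 3], [1, 2, 3], [1, 2, 4], [1, 2, 5], [1, 2, 6], [1, 2, 7], [1, 3, 4],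
  [1, 3, 5], [1, 3, 6], [1, 3, 7], [2, 3, 4], [2, 3, 5], [2, 3, 6], [2, 3, 7], [2, 3, 8],
  [2, 4, 8], [2, 4, 9], [3, 4, 8], [3, 4, 9], [0, 0, 0, 0], [1, 1, 4, 8], [1, 1, 4, 9],
  [0, 0, 0, 1, 1], [0, 0, 0, 1, 2], [0, 0, 0, 1, 3], [0, 0, 0, 2, 3], [0, 0, 0, 2, 4],
  [0, 0, 0, 2, 5], [0, 0, 0, 2, 6], [0, 0, 0, 2, 7], [0, 0, 0, 3, 4], [0, 0, 0, 3, 5],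
  [0, 0, 0, 3, 6], [0, 0, 0, 3, 7], [0, 0, 1, 1, 4], [0, 0, 1, 1, 5], [0, 0, 1, 1, 6],
  [0, 0, 1, 1, 7], [0, 0, 1, 1, 9], [0, 0, 2, 3, 9], [0, 0, 0, 1, 4, 8], [0, 0, 0, 1, 4, 9]]

/-- The multisets of exceptional trees without a part in `reducible`. -/
def irreducible : List (List ℕ) :=
  [[], [0], [1], [2], [3], [4], [5], [6], [7], [8], [9], [0, 0], [0, 1], [0, 2], [0, 3],
  [0, 4], [0, 5], [0, 6], [0, 7], [0, 8], [0, 9], [1, 1], [1, 2], [1, 3], [1, 4], [1, 5],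
  [1, 6], [1, 7], [1, 8], [1, 9], [2, 3], [2, 4], [2, 5], [2, 6], [2, 7], [2, 8], [2, 9],
  [3, 4], [3, 5], [3, 6], [3, 7], [3, 8], [3, 9], [4, 8], [4, 9], [0, 0, 0], [0, 0, 1],
  [0, 0, 2], [0, 0, 3], [0, 0, 4], [0, 0, 5], [0, 0, 6], [0, 0, 7], [0, 0, 8], [0, 0, 9],
  [0, 1, 1], [0, 1, 2], [0, 1, 3], [0, 1, 4], [0, 1, 5], [0, 1, 6], [0, 1, 7], [0, 1, 8],
  [0, 1, 9], [0, 2, 3], [0, 2, 4], [0, 2, 5], [0, 2, 6], [0, 2, 7], [0, 2, 8], [0, 2, 9],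
  [0, 3, 4], [0, 3, 5], [0, 3, 6], [0, 3, 7], [0, 3, 8], [0, 3, 9], [0, 4, 8], [0, 4, 9],
  [1, 1, 4], [1, 1, 5], [1, 1, 6], [1, 1, 7], [1, 1, 8], [1, 1, 9], [1, 2, 8], [1, 2, 9],
  [1, 3, 8], [1, 3, 9], [1, 4, 8], [1, 4, 9], [2, 3, 9], [0, 0, 0, 1], [0, 0, 0, 2],
  [0, 0, 0, 3], [0, 0, 0, 4], [0, 0, 0, 5], [0, 0, 0, 6], [0, 0, 0, 7], [0, 0, 0, 8],
  [0, 0, 0, 9], [0, 0, 1, 1], [0, 0, 1, 2], [0, 0, 1, 3], [0, 0, 1, 4], [0, 0, 1, 5],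
  [0, 0, 1, 6], [0, 0, 1, 7], [0, 0, 1, 8], [0, 0, 1, 9], [0, 0, 2, 3], [0, 0, 2, 4],
  [0, 0, 2, 5], [0, 0, 2, 6], [0, 0, 2, 7], [0, 0, 2, 8], [0, 0, 2, 9], [0, 0, 3, 4],
  [0, 0, 3, 5], [0, 0, 3, 6], [0, 0, 3, 7], [0, 0, 3, 8], [0, 0, 3, 9], [0, 0, 4, 8],
  [0, 0, 4, 9], [0, 1, 1, 4], [0, 1, 1, 5], [0, 1, 1, 6], [0, 1, 1, 7], [0, 1, 1, 8],
  [0, 1, 1, 9], [0, 1, 2, 8], [0, 1, 2, 9], [0, 1, 3, 8], [0, 1, 3, 9], [0, 1, 4, 8],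
  [0, 1, 4, 9], [0, 2, 3, 9], [0, 0, 0, 1, 4], [0, 0, 0, 1, 5], [0, 0, 0, 1, 6],
  [0, 0, 0, 1, 7], [0, 0, 0, 1, 8], [0, 0, 0, 1, 9], [0, 0, 0, 2, 8], [0, 0, 0, 2, 9],
  [0, 0, 0, 3, 8], [0, 0, 0, 3, 9], [0, 0, 0, 4, 8], [0, 0, 0, 4, 9], [0, 0, 1, 1, 8],
  [0, 0, 1, 2, 8], [0, 0, 1, 2, 9], [0, 0, 1, 3, 8], [0, 0, 1, 3, 9], [0, 0, 1, 4, 8],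
  [0, 0, 1, 4, 9]]

theorem reducible_bound : ∀ is ∈ reducible, 0 < size (ofIndices exceptional is) ∧
    (subtreeList (ofIndices exceptional is)).length ^ 4 ≤ 5 ^ size (ofIndices exceptional is) := by
  decide +kernel

theorem irreducible_bound : ∀ is ∈ irreducible,
    ((subtreeList (ofIndices exceptional is)).length + 1) ^ 4
      ≤ 5 ^ (size (ofIndices exceptional is) + 1) ∨ ofIndices exceptional is ∈ exceptional := by
  decide +kernel

theorem exceptional_bound : ∀ f ∈ exceptional, size f < 7 ∧
    (subtreeList f).length ^ 4 ≤ 5 ^ (size f + 1) := by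
  decide +kernel

theorem insert_irreducible {is : List ℕ} (his : is ∈ irreducible) {i : ℕ} (hi : i < 10) :
    (∃ js ∈ reducible, js.Sublist (is.orderedInsert (· ≤ ·) i)) ∨
      is.orderedInsert (· ≤ ·) i ∈ irreducible := by
  have key : ((List.range 10).all fun i => irreducible.all fun is =>
      (reducible.filter (List.elem i)).any
        (fun js => js.isSublist (is.orderedInsert (· ≤ ·) i)) ||
        irreducible.elem (is.orderedInsert (· ≤ ·) i)) = true := by
    decide +kernel
  have := List.all_eq_true.1 (List.all_eq_true.1 key i (List.mem_range.2 hi)) is his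
  rw [Bool.or_eq_true, List.any_eq_true] at this
  simp only [List.mem_filter, List.isSublist_iff_sublist, List.elem_eq_mem,
    decide_eq_true_eq, and_assoc] at this
  exact this.imp_left fun ⟨js, hjs, _, h⟩ => ⟨js, hjs, h⟩

theorem ofIndices_append (l : List PlaneForest) (is js : List ℕ) :
    ofIndices l (is ++ js) = append (ofIndices l is) (ofIndices l js) := by
  induction is with
  | nil => rfl
  | cons i is ih => exact congrArg (cons _) ih

theorem equivalent_ofIndices_of_perm (l : List PlaneForest) {is js : List ℕ} (h : is.Perm js) :
    Equivalent (ofIndices l is) (ofIndices l js) := by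
  induction h with
  | nil => exact .refl _
  | cons i _ ih => exact .congr (.refl _) ih
  | swap i j is => exact .swap _ _ _
  | trans _ _ ih₁ ih₂ => exact .trans ih₁ ih₂

theorem length_exceptional : exceptional.length = 10 := by
  decide +kernel

theorem exists_reducible_or_irreducible (f : PlaneForest) {n : ℕ} (hf : size f ≤ n)
    (ih : ∀ a, size a < n → (((subtrees a).card + 1) ^ 4 ≤ 5 ^ (size a + 1) ∨
      ∃ t ∈ exceptional, Equivalent a t)) :
    (∃ g h, Equivalent f (append g h) ∧ 0 < size g ∧ (subtrees g).card ^ 4 ≤ 5 ^ size g) ∨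
      ∃ is ∈ irreducible, Equivalent f (ofIndices exceptional is) := by
  induction f with
  | nil => exact .inr ⟨[], by simp [irreducible], .refl _⟩
  | cons a b _ ihb =>
    simp only [size] at hf
    rcases ihb (by lia) with ⟨g, h, e, hg, hc⟩ | ⟨is, his, e⟩
    · exact .inl ⟨g, cons a h, (Equivalent.congr (.refl a) e).trans
        (equivalent_cons_append a g h), hg, hc⟩
    rcases ih a (by lia) with ha | ⟨t, ht, hat⟩
    · refine .inl ⟨cons a nil, b, .refl _, by simp only [size]; lia, ?_⟩
      have hle : (subtrees (cons a nil)).card ≤ (subtrees a).card + 1 := by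
        refine (Finset.card_union_le _ _).trans ?_
        have := Finset.card_image₂_le (fun x y => Nat.nth Nat.Prime (x - 1) * y) (subtrees a)
          (subtrees nil)
        simp only [subtrees, Finset.card_singleton] at this ⊢
        lia
      refine (Nat.pow_le_pow_left hle 4).trans (ha.trans (le_of_eq ?_))
      simp [size, Nat.add_comm]
    · obtain ⟨i, hi, rfl⟩ := List.getElem_of_mem ht
      have hab : Equivalent (cons a b)
          (ofIndices exceptional (is.orderedInsert (· ≤ ·) i)) := by
        have hd : cons exceptional[i] (ofIndices exceptional is)
            = ofIndices exceptional (i :: is) := by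
          simp only [ofIndices, List.foldr_cons, List.getD_eq_getElem _ _ hi]
        refine (Equivalent.congr hat e).trans ?_
        rw [hd]
        exact equivalent_ofIndices_of_perm _ (List.perm_orderedInsert _ _ _).symm
      rcases insert_irreducible his (length_exceptional ▸ hi) with ⟨js, hjs, hsub⟩ | h
      · obtain ⟨ks, hks⟩ := hsub.exists_perm_append
        obtain ⟨hpos, hc⟩ := reducible_bound js hjs
        refine .inl ⟨ofIndices exceptional js, ofIndices exceptional ks, ?_, hpos,
          (Nat.pow_le_pow_left (card_subtrees_le_length _) 4).trans hc⟩
        rw [← ofIndices_append]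
        exact hab.trans (equivalent_ofIndices_of_perm _ hks)
      · exact .inr ⟨_, h, hab⟩

theorem succ_pow_four_le {c m : ℕ} (hm : 0 < m) (h : c ^ 4 ≤ 5 ^ m) :
    (c + 1) ^ 4 ≤ 5 ^ (m + 1) := by
  rcases le_or_gt 3 c with hc | hc
  · have h₁ : (3 * (c + 1)) ^ 4 ≤ (4 * c) ^ 4 := Nat.pow_le_pow_left (by lia) 4
    rw [mul_pow, mul_pow] at h₁
    rw [pow_succ]
    lia
  · have hm' : m = 1 ∨ 2 ≤ m := by lia
    rcases hm' with rfl | hm'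
    · interval_cases c <;> simp_all
    · calc (c + 1) ^ 4 ≤ 3 ^ 4 := Nat.pow_le_pow_left (by lia) 4
        _ ≤ 5 ^ (2 + 1) := by norm_num
        _ ≤ 5 ^ (m + 1) := Nat.pow_le_pow_right (by norm_num) (by lia)

theorem card_subtrees_bound_or_exceptional (f : PlaneForest) :
    ((subtrees f).card + 1) ^ 4 ≤ 5 ^ (size f + 1) ∨ ∃ t ∈ exceptional, Equivalent f t := by
  induction hn : size f using Nat.strong_induction_on generalizing f with
  | _ n ih =>
  subst hn
  have ih' : ∀ a, size a < size f → (((subtrees a).card + 1) ^ 4 ≤ 5 ^ (size a + 1) ∨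
      ∃ t ∈ exceptional, Equivalent a t) := fun a ha => ih _ ha a rfl
  rcases exists_reducible_or_irreducible f le_rfl ih' with ⟨g, h, e, hg, hc⟩ | ⟨is, his, e⟩
  · left
    rw [e.subtrees_eq, e.size_eq]
    have hsize := e.size_eq
    rw [size_append] at hsize ⊢
    rcases Nat.eq_zero_or_pos (size h) with hh | hh
    · cases h with
      | cons a b => simp only [size] at hh; lia
      | nil =>
        have hcard : (subtrees (append g nil)).card = (subtrees g).card := by
          simp [subtrees_append, subtrees]
        rw [hcard, hh]
        exact succ_pow_four_le hg hc
    · have hch : (subtrees h).card ^ 4 ≤ 5 ^ (size h + 1) := by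
        rcases ih' h (by lia) with hb | ⟨t, ht, hht⟩
        · exact (Nat.pow_le_pow_left (Nat.le_succ _) 4).trans hb
        · rw [hht.subtrees_eq, hht.size_eq]
          exact (Nat.pow_le_pow_left (card_subtrees_le_length _) 4).trans
            (exceptional_bound t ht).2
      calc ((subtrees (append g h)).card + 1) ^ 4
          ≤ ((subtrees g).card * (subtrees h).card) ^ 4 :=
            Nat.pow_le_pow_left (card_subtrees_append_lt hg hh) 4
        _ = (subtrees g).card ^ 4 * (subtrees h).card ^ 4 := mul_pow _ _ _
        _ ≤ 5 ^ size g * 5 ^ (size h + 1) := Nat.mul_le_mul hc hch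
        _ = 5 ^ (size g + size h + 1) := by rw [← pow_add, Nat.add_assoc]
  · rcases irreducible_bound is his with hb | hx
    · left
      rw [e.subtrees_eq, e.size_eq]
      exact (Nat.pow_le_pow_left (Nat.succ_le_succ (card_subtrees_le_length _)) 4).trans hb
    · exact .inr ⟨_, hx, e⟩

theorem card_subtrees_bound {f : PlaneForest} (hf : 7 ≤ size f) :
    ((subtrees f).card + 1) ^ 4 ≤ 5 ^ (size f + 1) := by
  rcases card_subtrees_bound_or_exceptional f with h | ⟨t, ht, e⟩
  · exact h
  · have := (exceptional_bound t ht).1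
    rw [e.size_eq] at hf
    lia

/-- Every vertex of `S` is joined to `v` by a walk in `S`. -/
def JoinedTo {V : Type*} (G : SimpleGraph V) (v : V) (S : Set V) : Prop :=
  ∀ x ∈ S, Relation.ReflTransGen (fun x y => G.Adj x y ∧ y ∈ S) v x

/-- `Represents G v A f`: the vertex set `A` spans a subtree of `G` whose branches at the root `v`
form the plane forest `f`. -/
inductive Represents {V : Type*} (G : SimpleGraph V) : V → Set V → PlaneForest → Prop
  | nil (v : V) : Represents G v {v} nil
  | cons {v s : V} {A B : Set V} {a b : PlaneForest} : G.Adj v s → Disjoint A B →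
      Represents G s A a → Represents G v B b →
      (∀ x ∈ A, ∀ y ∈ B, G.Adj x y → x = s ∧ y = v) → Represents G v (A ∪ B) (cons a b)

namespace Represents

variable {V : Type*} {G : SimpleGraph V} {v : V} {A : Set V} {f g : PlaneForest}

theorem root_mem (h : Represents G v A f) : v ∈ A := by
  induction h with
  | nil v => rfl
  | cons _ _ _ _ _ _ ih => exact .inr ih

theorem of_equivalent (e : Equivalent f g) (h : Represents G v A f) : Represents G v A g := by
  induction e generalizing v A with
  | refl f => exact h
  | trans _ _ ih₁ ih₂ => exact ih₂ (ih₁ h)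
  | congr _ _ iha ihb =>
    cases h with
    | cons hadj hd ha hb he => exact .cons hadj hd (iha ha) (ihb hb) he
  | swap a b c =>
    cases h with
    | @cons _ s₁ A₁ _ _ _ hadj₁ hd₁ h₁ h he₁ =>
    cases h with
    | @cons _ s₂ A₂ B _ _ hadj₂ hd₂ h₂ h he₂ =>
    rw [Set.disjoint_union_right] at hd₁
    rw [Set.union_left_comm]
    refine .cons hadj₂ (Set.disjoint_union_right.2 ⟨hd₁.1.symm, hd₂⟩) h₂
      (.cons hadj₁ hd₁.2 h₁ h fun x hx y hy => he₁ x hx y (.inr hy)) ?_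
    rintro x hx y (hy | hy) hxy
    · obtain ⟨-, rfl⟩ := he₁ y hy x (.inl hx) hxy.symm
      exact (Set.disjoint_left.1 hd₂ hx h.root_mem).elim
    · exact he₂ x hx y hy hxy

theorem ncard_eq (h : Represents G v A f) : A.Finite ∧ A.ncard = size f + 1 := by
  induction h with
  | nil v => simp [size]
  | cons _ hd _ _ _ iha ihb =>
    refine ⟨iha.1.union ihb.1, ?_⟩
    rw [Set.ncard_union_eq hd iha.1 ihb.1, iha.2, ihb.2, size]
    ring

theorem exists_of_subset (h : Represents G v A f) {S : Set V} (hS : S ⊆ A) (hv : v ∈ S)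
    (hj : JoinedTo G v S) : ∃ g, Represents G v S g ∧ matula g ∈ subtrees f := by
  induction h generalizing S with
  | nil v =>
    obtain rfl : S = {v} := hS.antisymm (by simpa using hv)
    exact ⟨_, .nil v, by simp [matula, subtrees]⟩
  | @cons v s A B a b hadj hd ha hb he iha ihb =>
    have key : ∀ x, Relation.ReflTransGen (fun x y => G.Adj x y ∧ y ∈ S) v x →
        (x ∈ B → Relation.ReflTransGen (fun x y => G.Adj x y ∧ y ∈ S ∩ B) v x) ∧
        (x ∈ A → s ∈ S ∧ Relation.ReflTransGen (fun x y => G.Adj x y ∧ y ∈ S ∩ A) s x) := by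
      intro x hx
      induction hx with
      | refl => exact ⟨fun _ => .refl, fun h => (Set.disjoint_left.1 hd h hb.root_mem).elim⟩
      | @tail x y hx hxy ih =>
        have hxS : x ∈ S := by
          cases hx with
          | refl => exact hv
          | tail _ h => exact h.2
        refine ⟨fun hy => ?_, fun hy => ?_⟩
        · rcases hS hxS with hxA | hxB
          · obtain ⟨-, rfl⟩ := he x hxA y hy hxy.1
            exact .refl
          · exact (ih.1 hxB).tail ⟨hxy.1, hxy.2, hy⟩
        · rcases hS hxS with hxA | hxB
          · exact ⟨(ih.2 hxA).1, (ih.2 hxA).2.tail ⟨hxy.1, hxy.2, hy⟩⟩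
          · obtain ⟨rfl, -⟩ := he y hy x hxB hxy.1.symm
            exact ⟨hxy.2, .refl⟩
    obtain ⟨g, hg, hgm⟩ := ihb (S := S ∩ B) Set.inter_subset_right ⟨hv, hb.root_mem⟩
      fun x hx => (key x (hj x hx.1)).1 hx.2
    by_cases hsA : ∃ x ∈ S, x ∈ A
    · obtain ⟨x, hxS, hxA⟩ := hsA
      have hs : s ∈ S := ((key x (hj x hxS)).2 hxA).1
      obtain ⟨g', hg', hgm'⟩ := iha (S := S ∩ A) Set.inter_subset_right ⟨hs, ha.root_mem⟩
        fun x hx => ((key x (hj x hx.1)).2 hx.2).2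
      refine ⟨PlaneForest.cons g' g, ?_, mem_subtrees_cons.2 (.inr ⟨_, hgm', _, hgm, rfl⟩)⟩
      have hU : S = (S ∩ A) ∪ (S ∩ B) := by
        rw [← Set.inter_union_distrib_left, Set.inter_eq_left.2 hS]
      rw [hU]
      exact .cons hadj (hd.mono Set.inter_subset_right Set.inter_subset_right) hg' hg
        fun x hx y hy => he x hx.2 y hy.2
    · push Not at hsA
      have hU : S ∩ B = S := Set.inter_eq_left.2 fun x hx => (hS hx).resolve_left (hsA x hx)
      rw [hU] at hg
      exact ⟨g, hg, mem_subtrees_cons.2 (.inl hgm)⟩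

theorem exists_bijOn {v' : V} {A' : Set V} (h : Represents G v A f) (h' : Represents G v' A' f) :
    ∃ φ : V → V, Set.BijOn φ A A' ∧ φ v = v' ∧
      ∀ x ∈ A, ∀ y ∈ A, G.Adj (φ x) (φ y) ↔ G.Adj x y := by
  classical
  induction h generalizing v' A' with
  | nil v =>
    cases h'
    exact ⟨fun _ => v', by simp, rfl, by simp⟩
  | @cons v s A B a b hadj hd ha hb he iha ihb =>
    cases h' with
    | @cons _ s' A' B' _ _ hadj' hd' ha' hb' he' =>
    obtain ⟨φ, hφ, hφs, hφadj⟩ := iha ha'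
    obtain ⟨ψ, hψ, hψv, hψadj⟩ := ihb hb'
    have hB : ∀ x ∈ B, x ∉ A := fun x hx hxA => Set.disjoint_left.1 hd hxA hx
    have hχA : Set.EqOn φ (A.piecewise φ ψ) A := fun x hx => by simp [hx]
    have hχB : Set.EqOn ψ (A.piecewise φ ψ) B := fun x hx => by simp [hB x hx]
    have hcross : ∀ x ∈ A, ∀ y ∈ B, G.Adj (φ x) (ψ y) ↔ G.Adj x y := by
      intro x hx y hy
      constructor
      · intro h
        obtain ⟨h₁, h₂⟩ := he' _ (hφ.mapsTo hx) _ (hψ.mapsTo hy) h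
        rw [hφ.injOn hx ha.root_mem (h₁.trans hφs.symm),
          hψ.injOn hy hb.root_mem (h₂.trans hψv.symm)]
        exact hadj.symm
      · intro h
        obtain ⟨rfl, rfl⟩ := he x hx y hy h
        rw [hφs, hψv]
        exact hadj'.symm
    refine ⟨A.piecewise φ ψ, (hφ.congr hχA).union (hψ.congr hχB) ?_, ?_, ?_⟩
    · refine (Set.injOn_union hd).2 ⟨(hφ.congr hχA).injOn, (hψ.congr hχB).injOn, ?_⟩
      intro x hx y hy h
      rw [← hχA hx, ← hχB hy] at h
      exact Set.disjoint_left.1 hd' (hφ.mapsTo hx) (h ▸ hψ.mapsTo hy)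
    · rw [← hχB hb.root_mem, hψv]
    · rintro x (hx | hx) y (hy | hy)
      · rw [← hχA hx, ← hχA hy]; exact hφadj x hx y hy
      · rw [← hχA hx, ← hχB hy]; exact hcross x hx y hy
      · rw [← hχB hx, ← hχA hy, G.adj_comm, G.adj_comm x]; exact hcross y hy x hx
      · rw [← hχB hx, ← hχB hy]; exact hψadj x hx y hy

end Represents

theorem exists_represents {V : Type*} {G : SimpleGraph V} (hG : G.IsAcyclic) {v : V} {A : Set V}
    (hA : A.Finite) (hv : v ∈ A) (hj : JoinedTo G v A) : ∃ f, Represents G v A f := by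
  induction hn : A.ncard using Nat.strong_induction_on generalizing v A with
  | _ n ih =>
  subst hn
  by_cases hs : ∃ s ∈ A, G.Adj v s
  · obtain ⟨s, hs, hadj⟩ := hs
    set R : V → V → Prop := fun x y => G.Adj x y ∧ y ∈ A ∧ y ≠ v with hR
    set A₁ : Set V := {x | Relation.ReflTransGen R s x} with hA₁
    have hsub : ∀ x ∈ A₁, x ∈ A ∧ x ≠ v := by
      intro x hx
      cases hx with
      | refl => exact ⟨hs, hadj.ne'⟩
      | tail _ h => exact h.2
    have hleave : ∀ x ∈ A₁, ∀ y ∈ A \ A₁, G.Adj x y → y = v := by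
      intro x hx y hy hxy
      by_contra hne
      exact hy.2 (Relation.ReflTransGen.tail hx ⟨hxy, hy.1, hne⟩)
    have hback : ∀ x ∈ A₁, G.Adj x v → x = s := by
      intro x hx hxv
      by_contra hne
      have hbridge := isAcyclic_iff_forall_adj_isBridge.1 hG hadj
      rw [isBridge_iff] at hbridge
      apply hbridge
      have hreach : (G \ fromEdgeSet {s(v, s)}).Reachable s x := by
        clear hne hxv
        induction hx with
        | refl => exact .refl _
        | @tail y z hy hyz ihy =>
          refine ihy.trans (SimpleGraph.Adj.reachable ?_)
          have := (hsub y hy).2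
          have := hyz.2.2
          simp only [sdiff_adj, fromEdgeSet_adj, Set.mem_singleton_iff, Sym2.eq_iff]
          exact ⟨hyz.1, by tauto⟩
      have hlast : (G \ fromEdgeSet {s(v, s)}).Adj x v := by
        simp only [sdiff_adj, fromEdgeSet_adj, Set.mem_singleton_iff, Sym2.eq_iff]
        exact ⟨hxv, by have := hxv.ne; tauto⟩
      exact (hreach.trans hlast.reachable).symm
    have hv₁ : v ∉ A₁ := fun h => (hsub v h).2 rfl
    have hA₁A : A₁ ⊆ A := fun x hx => (hsub x hx).1
    have hsA₁ : s ∈ A₁ := Relation.ReflTransGen.refl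
    have hj₁ : JoinedTo G s A₁ := by
      intro x hx
      induction hx with
      | refl => exact .refl
      | tail h₁ h₂ ih => exact ih.tail ⟨h₂.1, h₁.tail h₂⟩
    have hj₂ : JoinedTo G v (A \ A₁) := by
      have key : ∀ x, Relation.ReflTransGen (fun x y => G.Adj x y ∧ y ∈ A) v x → x ∈ A \ A₁ →
          Relation.ReflTransGen (fun x y => G.Adj x y ∧ y ∈ A \ A₁) v x := by
        intro x hx
        induction hx with
        | refl => exact fun _ => .refl
        | @tail x y hx hxy ih =>
          intro hy
          have hxA : x ∈ A := by
            cases hx with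
            | refl => exact hv
            | tail _ h => exact h.2
          by_cases hx₁ : x ∈ A₁
          · rw [hleave x hx₁ y hy hxy.1]
          · exact (ih ⟨hxA, hx₁⟩).tail ⟨hxy.1, hy⟩
      exact fun x hx => key x (hj x hx.1) hx
    obtain ⟨a, ha⟩ := ih A₁.ncard (Set.ncard_lt_ncard ⟨hA₁A, fun h => hv₁ (h hv)⟩ hA)
      (hA.subset hA₁A) hsA₁ hj₁ rfl
    obtain ⟨b, hb⟩ := ih (A \ A₁).ncard
      (Set.ncard_lt_ncard ⟨Set.sdiff_subset, fun h => (h hs).2 hsA₁⟩ hA)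
      (hA.subset Set.sdiff_subset) ⟨hv, hv₁⟩ hj₂ rfl
    refine ⟨cons a b, ?_⟩
    rw [← Set.union_sdiff_cancel hA₁A]
    refine .cons hadj Set.disjoint_sdiff_right ha hb fun x hx y hy hxy => ?_
    obtain rfl := hleave x hx y hy hxy
    exact ⟨hback x hx hxy, rfl⟩
  · push Not at hs
    obtain rfl : A = {v} := by
      refine Set.Subset.antisymm (fun x hx => ?_) (by simpa using hv)
      rcases (hj x hx).cases_head with h | ⟨y, h, -⟩
      · exact h.symm
      · exact (hs y h.2 h.1).elim
    exact ⟨nil, .nil v⟩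

theorem joinedTo_of_connected {V : Type*} {G : SimpleGraph V} {v : V} {S : Set V} (hv : v ∈ S)
    (h : (G.induce S).Connected) : JoinedTo G v S := by
  intro x hx
  have hr := (reachable_iff_reflTransGen _ _).1 (h.preconnected ⟨v, hv⟩ ⟨x, hx⟩)
  exact Relation.ReflTransGen.lift (fun y : S => (y : V)) (fun _ z hyz => ⟨hyz, z.2⟩) _ _ hr

theorem nr_le_card_subtrees {V : Type*} {G : SimpleGraph V} {r : V} {f : PlaneForest}
    (hf : Represents G r Set.univ f) : nr G r ≤ (subtrees f).card := by
  have hrep (S : RootedSubtree G r) : ∃ g, Represents G r S.1 g ∧ matula g ∈ subtrees f :=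
    hf.exists_of_subset (Set.subset_univ _) S.2.1 (joinedTo_of_connected S.2.1 S.2.2)
  choose code hcode hmem using hrep
  have hinj : Function.Injective
      (fun q : Quot (RootedSubtreeIso G r) => (⟨_, hmem q.out⟩ : subtrees f)) := by
    intro q q' h
    rw [← Quot.out_eq q, ← Quot.out_eq q']
    apply Quot.sound
    have e := equivalent_of_matula_eq (congrArg Subtype.val h)
    obtain ⟨φ, hφ, hr, hadj⟩ := ((hcode q.out).of_equivalent e).exists_bijOn (hcode q'.out)
    exact ⟨⟨hφ.equiv φ, fun {x y} => hadj x x.2 y y.2⟩, Subtype.ext hr⟩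
  have := Nat.card_le_card_of_injective _ hinj
  simpa [nr] using this

end PlaneForest

/-- For every rooted tree `T` with `n ≥ 8` vertices, `nr T ≤ 5 ^ (n/4) - 1`. -/
theorem nr_le_five_pow_sub_one {V : Type*} [Fintype V] (G : SimpleGraph V) (r : V)
    (hG : G.IsTree) (h8 : 8 ≤ Fintype.card V) :
    (nr G r : ℝ) ≤ (5 : ℝ) ^ ((Fintype.card V : ℝ) / 4) - 1 := by
  have hj : PlaneForest.JoinedTo G r Set.univ := fun x _ => by
    simpa using (reachable_iff_reflTransGen _ _).1 (hG.connected.preconnected r x)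
  obtain ⟨f, hf⟩ := PlaneForest.exists_represents hG.isAcyclic Set.finite_univ trivial hj
  have hsize := hf.ncard_eq.2
  rw [Set.ncard_univ, Nat.card_eq_fintype_card] at hsize
  have hbound : (nr G r + 1) ^ 4 ≤ 5 ^ Fintype.card V := by
    rw [hsize]
    exact (Nat.pow_le_pow_left (Nat.succ_le_succ (PlaneForest.nr_le_card_subtrees hf)) 4).trans
      (PlaneForest.card_subtrees_bound (by lia))
  have hpow : ((5 : ℝ) ^ ((Fintype.card V : ℝ) / 4)) ^ 4 = 5 ^ Fintype.card V := by
    rw [← Real.rpow_natCast, ← Real.rpow_mul (by norm_num), ← Real.rpow_natCast]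
    congr 1
    push_cast
    ring
  have hle : ((nr G r : ℝ) + 1) ^ 4 ≤ ((5 : ℝ) ^ ((Fintype.card V : ℝ) / 4)) ^ 4 := by
    rw [hpow]
    exact_mod_cast hbound
  have := le_of_pow_le_pow_left₀ (by norm_num) (by positivity) hle
  linarith
end
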